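/- Let n ≥ 1, let ω be a Pólya weight of order n, and let a ∈ ℝ^n have pairwise distinct nonzero entries. Let a' be a random vector in (0,∞)^n with probability density p_ω and let k ∈ U(n) be an independent Haar-distributed unitary matrix. Then for every bounded measurable permutation-symmetric function f: ℝ^n → ℝ: ∫_{U(n)} ∫_{(0,∞)^n} f( eig( diag(√a'_1,…,√a'_n) · k diag(a) k* · diag(√a'_1,…,√a'_n) ) ) p_ω(a') da' dk = ∫_{ℝ^n} f(ã) p(ã|a) dã, where p(ã|a) = (1/n!) · ( ∏_{j=1}^{n} Mω(j) )^{−1} · ( Δ_n(ã)/Δ_n(a) ) · det[ 1{ã_b a_c > 0} · ω(ã_b/a_c)/|a_c| ]_{b,c=1,…,n}. -/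

import Mathlib

open MeasureTheory Matrix Finset Filter Set
open scoped Classical

noncomputable section

namespace RMT

instance matMS (l m : ℕ) : MeasurableSpace (Matrix (Fin l) (Fin m) ℂ) :=
  inferInstanceAs (MeasurableSpace (Fin l → Fin m → ℂ))

/-- `μ` is the normalized Haar probability measure of `U(l)`, viewed as a measure on the
space of `l × l` complex matrices: it is a probability measure, it is carried by the
unitary group, and it is invariant under left translation by every unitary matrix.
(These properties determine `μ` uniquely.) -/
def IsHaarUnitary (l : ℕ) (μ : Measure (Matrix (Fin l) (Fin l) ℂ)) : Prop :=
  IsProbabilityMeasure μ ∧ μ {A | A ∈ Matrix.unitaryGroup (Fin l) ℂ}ᶜ = 0 ∧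
    ∀ U ∈ Matrix.unitaryGroup (Fin l) ℂ, μ.map (fun A => U * A) = μ

/-- The eigenvalues (with multiplicity, in a fixed order) of a Hermitian matrix;
junk value `0` on non-Hermitian matrices. -/
def eigs {n : ℕ} (y : Matrix (Fin n) (Fin n) ℂ) : Fin n → ℝ :=
  if h : y.IsHermitian then h.eigenvalues else 0

/-- The operator `f ↦ x·f'`. -/
def xdOp (f : ℝ → ℝ) : ℝ → ℝ := fun x => x * deriv f x

/-- The operator `f ↦ -x·f'`. -/
def negxdOp (f : ℝ → ℝ) : ℝ → ℝ := fun x => -(x * deriv f x)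

/-- The Mellin transform `Mω(j) = ∫_0^∞ x^{j-1} ω(x) dx` at a positive integer `j`. -/
def MellinNat (ω : ℝ → ℝ) (j : ℕ) : ℝ := ∫ x in Set.Ioi (0 : ℝ), x ^ (j - 1) * ω x

/-- The Vandermonde determinant `Δ_n(a) = ∏_{c>d} (a_c - a_d)`. -/
def VdmF {n : ℕ} (a : Fin n → ℝ) : ℝ := ∏ c : Fin n, ∏ d ∈ Finset.Iio c, (a c - a d)

/-- The density `p_ω` of the Pólya ensemble associated with the weight `ω`. -/
def polyaDensity (n : ℕ) (ω : ℝ → ℝ) (a' : Fin n → ℝ) : ℝ :=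
  VdmF a' * Matrix.det (Matrix.of fun b c : Fin n => (negxdOp^[(b : ℕ)] ω) (a' c)) /
    ∏ j ∈ Finset.range n, ((Nat.factorial (j + 1) : ℝ) * MellinNat ω (j + 1))

/-- `ω` is a Pólya weight of order `n`. -/
def IsPolyaWeight (n : ℕ) (ω : ℝ → ℝ) : Prop :=
  (∀ x ∈ Set.Ioi (0 : ℝ), 0 ≤ ω x) ∧
  ContDiffOn ℝ ((n - 1 : ℕ) : ℕ∞) ω (Set.Ioi 0) ∧
  (∀ j < n, ∀ k : ℕ, 1 ≤ k → k ≤ n + 1 →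
    Tendsto (fun x : ℝ => x ^ k * (xdOp^[j] ω) x) (nhdsWithin 0 (Set.Ioi 0)) (nhds 0) ∧
    Tendsto (fun x : ℝ => x ^ k * (xdOp^[j] ω) x) atTop (nhds 0)) ∧
  (∀ j < n, ∀ k : ℕ, 1 ≤ k → k ≤ n + 1 →
    IntegrableOn (fun x : ℝ => x ^ (k - 1) * |(xdOp^[j] ω) x|) (Set.Ioi 0)) ∧
  (∀ j : ℕ, 1 ≤ j → j ≤ n → 0 < MellinNat ω j) ∧
  (∀ a' : Fin n → ℝ, (∀ i, 0 < a' i) → 0 ≤ polyaDensity n ω a')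

/-- The diagonal matrix `diag(√a'_1, …, √a'_n)` as a complex matrix. -/
def sqrtDiag {n : ℕ} (a' : Fin n → ℝ) : Matrix (Fin n) (Fin n) ℂ :=
  Matrix.diagonal fun i => ((Real.sqrt (a' i) : ℝ) : ℂ)

/-- A real diagonal matrix as a complex matrix. -/
def realDiag {n : ℕ} (a : Fin n → ℝ) : Matrix (Fin n) (Fin n) ℂ :=
  Matrix.diagonal fun i => ((a i : ℝ) : ℂ)

end RMT

namespace RMT

/-- The joint eigenvalue density `p(ã|a)` of `g x g*` for a Pólya ensemble `g` and fixed
`x` with eigenvalues `a` (square case). -/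
def fixedDensity (n : ℕ) (ω : ℝ → ℝ) (a t : Fin n → ℝ) : ℝ :=
  (1 / (Nat.factorial n : ℝ)) * (∏ j ∈ Finset.range n, MellinNat ω (j + 1))⁻¹ *
    (VdmF t / VdmF a) *
    Matrix.det (Matrix.of fun b c : Fin n =>
      if 0 < t b * a c then ω (t b / a c) / |a c| else 0)

theorem det_functional_monic {R : Type*} [CommRing R] (M : ℕ) (q : Fin M → Polynomial R)
    (hdeg : ∀ i, (q i).natDegree = i) (hmon : ∀ i, (q i).Monic)
    (c : Fin M → (Polynomial R →ₗ[R] R)) :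
    Matrix.det (Matrix.of fun i j : Fin M => c j (q i)) =
      Matrix.det (Matrix.of fun i j : Fin M => c j (Polynomial.X ^ (i : ℕ))) := by
  have h : (Matrix.of fun i j : Fin M => c j (q i)) =
      (Matrix.of fun i k : Fin M => (q k).coeff i)ᵀ *
        (Matrix.of fun i j : Fin M => c j (Polynomial.X ^ (i : ℕ))) := by
    ext i j
    simp only [Matrix.mul_apply, Matrix.of_apply, Matrix.transpose_apply]
    have h1 : q i = ∑ k ∈ Finset.range M, (q i).coeff k • (Polynomial.X ^ k : Polynomial R) := by
      conv_lhs => rw [(q i).as_sum_range' M (by rw [hdeg i]; exact i.2)]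
      refine Finset.sum_congr rfl fun k _ => ?_
      rw [← Polynomial.C_mul_X_pow_eq_monomial, Polynomial.smul_eq_C_mul]
    conv_lhs => rw [h1]
    rw [map_sum, ← Fin.sum_univ_eq_sum_range (fun k => c j ((q i).coeff k • (Polynomial.X ^ k : Polynomial R)))]
    simp
  rw [h, Matrix.det_mul, Matrix.det_transpose, Matrix.det_matrixOfPolynomials q hdeg hmon, one_mul]

/-- Vandermonde by rows. -/
def vdet {R : Type*} [CommRing R] {m : ℕ} (z : Fin m → R) : R :=
  Matrix.det (Matrix.of fun i j : Fin m => z j ^ (i : ℕ))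

theorem vdet_eq {R : Type*} [CommRing R] {m : ℕ} (z : Fin m → R) :
    vdet z = Matrix.det (Matrix.vandermonde z) := by
  rw [← Matrix.det_transpose]; rfl

theorem VdmF_eq {m : ℕ} (z : Fin m → ℝ) : VdmF z = vdet z := by
  rw [vdet_eq, Matrix.det_vandermonde, VdmF]
  rw [Finset.prod_sigma', Finset.prod_sigma']
  refine Finset.prod_bij' (fun x _ => ⟨x.2, x.1⟩) (fun x _ => ⟨x.2, x.1⟩) ?_ ?_ ?_ ?_ ?_ <;> simp

theorem vdet_ne_zero {R : Type*} [CommRing R] [IsDomain R] {m : ℕ} {z : Fin m → R}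
    (hz : Function.Injective z) : vdet z ≠ 0 := by
  rw [vdet_eq]; exact Matrix.det_vandermonde_ne_zero_iff.2 hz

theorem det_functional_snoc {R : Type*} [CommRing R] (m : ℕ) (g : Polynomial R)
    (hg : g.Monic) (hd : g.natDegree = m) (c : Fin (m + 1) → (Polynomial R →ₗ[R] R)) :
    Matrix.det (Matrix.of fun i j : Fin (m + 1) => c j
      (Fin.snoc (α := fun _ => Polynomial R)
        (fun i : Fin m => (Polynomial.X ^ (i : ℕ) : Polynomial R)) g i)) =
      Matrix.det (Matrix.of fun i j : Fin (m + 1) => c j (Polynomial.X ^ (i : ℕ))) := by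
  by_cases hR : Nontrivial R
  swap
  · have := not_nontrivial_iff_subsingleton.1 hR
    exact Subsingleton.elim _ _
  refine det_functional_monic (m + 1) (Fin.snoc (α := fun _ => Polynomial R)
        (fun i : Fin m => (Polynomial.X ^ (i : ℕ) : Polynomial R)) g) ?_ ?_ c
  · intro i
    refine Fin.lastCases ?_ (fun i => ?_) i
    · simp [hd]
    · simp
  · intro i
    refine Fin.lastCases ?_ (fun i => ?_) i
    · simpa using hg
    · simp

theorem monic_prod_X_sub {R : Type*} [CommRing R] {m : ℕ} (z : Fin m → R) :
    (∏ k, (Polynomial.X - Polynomial.C (z k))).Monic :=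
  Polynomial.monic_prod_of_monic _ _ (fun _ _ => Polynomial.monic_X_sub_C _)

theorem natDegree_prod_X_sub {R : Type*} [CommRing R] [Nontrivial R] {m : ℕ} (z : Fin m → R) :
    (∏ k, (Polynomial.X - Polynomial.C (z k))).natDegree = m := by
  rw [Polynomial.natDegree_prod_of_monic]
  · simp
  · intro k _
    exact Polynomial.monic_X_sub_C _

theorem vdet_succAbove {R : Type*} [CommRing R] [Nontrivial R]
    {m : ℕ} (z : Fin (m + 1) → R) (j : Fin (m + 1)) :
    (-1) ^ (m + (j : ℕ)) * vdet (fun k => z (j.succAbove k)) * ∏ k, (z j - z (j.succAbove k)) =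
      vdet z := by
  have h := det_functional_snoc m
      (∏ k, (Polynomial.X - Polynomial.C (z (j.succAbove k)))) (monic_prod_X_sub _)
      (natDegree_prod_X_sub _) (fun l => Polynomial.leval (z l))
  simp only [Polynomial.leval_apply, Polynomial.eval_pow, Polynomial.eval_X] at h
  have h2 : vdet z = (Matrix.of fun i j : Fin (m + 1) => z j ^ (i : ℕ)).det := rfl
  rw [h2, ← h, Matrix.det_succ_row _ (Fin.last m), Finset.sum_eq_single j]
  · simp only [Fin.val_last, Matrix.of_apply, Fin.snoc_last, Polynomial.eval_prod,
      Polynomial.eval_sub, Polynomial.eval_X, Polynomial.eval_C]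
    rw [mul_assoc, mul_assoc, mul_comm (vdet _)]
    congr 2
    rw [vdet]
    congr 1
    ext i k
    simp [Fin.succAbove_last]
  · intro l _ hl
    obtain ⟨k, hk⟩ := Fin.exists_succAbove_eq hl
    have : (∏ k, (z l - z (j.succAbove k))) = 0 :=
      Finset.prod_eq_zero (Finset.mem_univ k) (by rw [hk, sub_self])
    simp [Polynomial.eval_prod, this]
  · simp

/-- the dual Jacobi-Trudi determinant -/
def Jf {R : Type*} [CommRing R] (m : ℕ) (κ : Fin m → ℕ) (χ : Polynomial R) : R :=
  Matrix.det (Matrix.of fun i j : Fin m => (Polynomial.X ^ (i : ℕ) * χ).coeff (κ j))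

/-- polynomial with roots `a` -/
def Pa {R : Type*} [CommRing R] {n : ℕ} (a : Fin n → R) : Polynomial R :=
  ∏ k, (Polynomial.X - Polynomial.C (a k))

theorem Pa_monic {R : Type*} [CommRing R] {n : ℕ} (a : Fin n → R) : (Pa a).Monic :=
  monic_prod_X_sub a

theorem Pa_natDegree {R : Type*} [CommRing R] [Nontrivial R] {n : ℕ} (a : Fin n → R) :
    (Pa a).natDegree = n := natDegree_prod_X_sub a

theorem Pa_eval {R : Type*} [CommRing R] {n : ℕ} (a : Fin n → R) (z : R) :
    (Pa a).eval z = ∏ k, (z - a k) := by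
  simp [Pa, Polynomial.eval_prod]

/-- Jacobi-Trudi, block determinant form -/
theorem Jf_block {R : Type*} [CommRing R] [Nontrivial R] {n m : ℕ} (a : Fin n → R)
    (κ : Fin m → ℕ) :
    vdet a * Jf m κ (Pa a) = Matrix.det (Matrix.of fun r s : Fin (n + m) =>
      Sum.elim (fun c => a c ^ (r : ℕ)) (fun j => if κ j = (r : ℕ) then (1 : R) else 0)
        (finSumFinEquiv.symm s)) := by
  have h := det_functional_monic (n + m)
    (fun i => Sum.elim (fun c : Fin n => (Polynomial.X ^ (c : ℕ) : Polynomial R))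
      (fun j : Fin m => Polynomial.X ^ (j : ℕ) * Pa a) (finSumFinEquiv.symm i))
    (by
      intro i
      obtain ⟨i, rfl⟩ := finSumFinEquiv.surjective i
      rcases i with i | i
      · simp
      · rw [Equiv.symm_apply_apply, finSumFinEquiv_apply_right, Fin.val_natAdd, Sum.elim_inr]
        rw [(Polynomial.monic_X_pow _).natDegree_mul (Pa_monic a), Pa_natDegree]
        simp [add_comm])
    (by
      intro i
      obtain ⟨i, rfl⟩ := finSumFinEquiv.surjective i
      rcases i with i | i
      · simp [Polynomial.monic_X_pow]
      · simpa using (Polynomial.monic_X_pow _).mul (Pa_monic a))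
    (fun s => Sum.elim (fun c => Polynomial.leval (a c)) (fun j => Polynomial.lcoeff R (κ j))
        (finSumFinEquiv.symm s))
  have h2 : (Matrix.of fun r s : Fin (n + m) =>
      Sum.elim (fun c => a c ^ (r : ℕ)) (fun j => if κ j = (r : ℕ) then (1 : R) else 0)
        (finSumFinEquiv.symm s)) = (Matrix.of fun i j : Fin (n + m) =>
        (Sum.elim (fun c => Polynomial.leval (a c)) (fun j => Polynomial.lcoeff R (κ j))
        (finSumFinEquiv.symm j) : Polynomial R →ₗ[R] R) (Polynomial.X ^ (i : ℕ))) := by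
    ext r s
    obtain ⟨s, rfl⟩ := finSumFinEquiv.surjective s
    rcases s with s | s
    · simp
    · simp [Polynomial.coeff_X_pow]
  rw [h2, ← h, ← Matrix.det_submatrix_equiv_self finSumFinEquiv]
  have h3 : ((Matrix.of fun i j : Fin (n + m) =>
        (Sum.elim (fun c => Polynomial.leval (a c)) (fun j => Polynomial.lcoeff R (κ j))
        (finSumFinEquiv.symm j) : Polynomial R →ₗ[R] R)
        (Sum.elim (fun c : Fin n => (Polynomial.X ^ (c : ℕ) : Polynomial R))
      (fun j : Fin m => Polynomial.X ^ (j : ℕ) * Pa a) (finSumFinEquiv.symm i))).submatrix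
        finSumFinEquiv finSumFinEquiv) =
      Matrix.fromBlocks (Matrix.of fun i j : Fin n => a j ^ (i : ℕ))
        (Matrix.of fun (i : Fin n) (j : Fin m) => (Polynomial.X ^ (i : ℕ) : Polynomial R).coeff (κ j))
        0 (Matrix.of fun i j : Fin m => (Polynomial.X ^ (i : ℕ) * Pa a).coeff (κ j)) := by
    ext i j
    rcases i with i | i <;> rcases j with j | j <;>
      simp only [Matrix.submatrix_apply, Matrix.of_apply, Equiv.symm_apply_apply, Sum.elim_inl,
        Sum.elim_inr, Matrix.fromBlocks_apply₁₁, Matrix.fromBlocks_apply₁₂,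
        Matrix.fromBlocks_apply₂₁, Matrix.fromBlocks_apply₂₂, Polynomial.leval_apply,
        Polynomial.lcoeff_apply]
    · simp
    · have : ∏ k, (a j - a k) = 0 := Finset.prod_eq_zero (Finset.mem_univ j) (sub_self _)
      simp [Pa_eval, this]
  rw [h3, Matrix.det_fromBlocks_zero₂₁]
  rfl

/-- Jacobi-Trudi with a complementary set of exponents: up to a sign independent of `a`. -/
theorem Jf_alternant {n m : ℕ} (κ : Fin m → ℕ) (hκ : Function.Injective κ)
    (hlt : ∀ j, κ j < n + m) :
    ∃ (ε : ℤˣ) (ℓ : Fin n → ℕ), Function.Injective ℓ ∧ (∀ j, ℓ j < n + m) ∧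
      ∀ (R : Type) [CommRing R] [Nontrivial R] (a : Fin n → R), vdet a * Jf m κ (Pa a) =
        ((ε : ℤ) : R) * Matrix.det (Matrix.of fun i c : Fin n => a c ^ (ℓ i)) := by
  set κ' : Fin m → Fin (n + m) := fun j => ⟨κ j, hlt j⟩ with hκ'
  have hκi : Function.Injective κ' := fun i j h => hκ (by simpa [hκ'] using h)
  set S : Finset (Fin (n + m)) := (Finset.univ.image κ')ᶜ with hS
  have hcard : S.card = n := by
    rw [hS, Finset.card_compl, Finset.card_image_of_injective _ hκi]
    simp
  set ℓ' := S.orderEmbOfFin hcard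
  have hℓS : ∀ i, ℓ' i ∈ S := fun i => Finset.orderEmbOfFin_mem S hcard i
  have hne : ∀ i j, κ' j ≠ ℓ' i := by
    intro i j h
    have := hℓS i
    rw [← h, hS, Finset.mem_compl] at this
    exact this (Finset.mem_image_of_mem _ (Finset.mem_univ j))
  have hinj : Function.Injective (Sum.elim (fun i => ℓ' i) κ') :=
    Function.Injective.sumElim ℓ'.injective hκi (fun i j => (hne i j).symm)
  have hbij : Function.Bijective (Sum.elim (fun i => ℓ' i) κ') :=
    (Fintype.bijective_iff_injective_and_card _).2 ⟨hinj, by simp⟩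
  set e : Fin n ⊕ Fin m ≃ Fin (n + m) := Equiv.ofBijective _ hbij with he
  set τ : Equiv.Perm (Fin n ⊕ Fin m) := e.trans finSumFinEquiv.symm with hτ
  refine ⟨Equiv.Perm.sign τ, fun i => ℓ' i, fun i j h => ℓ'.injective (Fin.ext h),
    fun j => (ℓ' j).2, ?_⟩
  intro R _ _ a
  rw [Jf_block, ← Matrix.det_submatrix_equiv_self finSumFinEquiv]
  set D := (Matrix.of fun r s : Fin (n + m) =>
      Sum.elim (fun c => a c ^ (r : ℕ)) (fun j => if κ j = (r : ℕ) then (1 : R) else 0)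
        (finSumFinEquiv.symm s)) with hD
  have h1 : (D.submatrix finSumFinEquiv finSumFinEquiv).submatrix τ id =
      Matrix.fromBlocks (Matrix.of fun i c : Fin n => a c ^ (ℓ' i : ℕ)) 0
        (Matrix.of fun (i : Fin m) (c : Fin n) => a c ^ (κ i)) 1 := by
    ext i j
    rcases i with i | i <;> rcases j with j | j
    · simp [hD, hτ, he]
    · have := hne i j
      simp only [hD, hτ, he, Matrix.submatrix_apply, Matrix.of_apply, Equiv.trans_apply,
        Equiv.apply_symm_apply, Equiv.ofBijective_apply, Sum.elim_inl, id,
        Equiv.symm_apply_apply, Sum.elim_inr, Matrix.fromBlocks_apply₁₂]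
      rw [if_neg]
      · rfl
      · intro h
        exact this (Fin.ext h)
    · simp [hD, hτ, he, hκ']
    · simp only [hD, hτ, he, Matrix.submatrix_apply, Matrix.of_apply, Equiv.trans_apply,
        Equiv.apply_symm_apply, Equiv.ofBijective_apply, id,
        Equiv.symm_apply_apply, Sum.elim_inr, Matrix.fromBlocks_apply₂₂, hκ', Matrix.one_apply]
      by_cases h : i = j
      · simp [h]
      · rw [if_neg h, if_neg (fun h' => h (hκ h').symm)]
  have h2 := Matrix.det_permute τ (D.submatrix finSumFinEquiv finSumFinEquiv)
  rw [h1, Matrix.det_fromBlocks_zero₁₂, Matrix.det_one, mul_one] at h2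
  rw [h2, ← mul_assoc, ← Int.cast_mul, ← Units.val_mul, Int.units_mul_self]
  simp

open MvPolynomial in
theorem E_homog {N : ℕ} (E : MvPolynomial (Fin N) ℂ →ₗ[ℂ] ℂ)
    (hsum : ∀ G, E ((∑ i, X i) * G) = E G)
    (hex : ∀ i j G, E (X j * (G + X i * pderiv i G)) = E (X i * (G + X j * pderiv j G)))
    (d : ℕ) (G : MvPolynomial (Fin N) ℂ) (hG : G.IsHomogeneous d) (i : Fin N) :
    ((N : ℂ) + d) * E (X i * G) = E (G + X i * pderiv i G) := by
  have h1 : ∑ j, E (X j * (G + X i * pderiv i G)) = ∑ j, E (X i * (G + X j * pderiv j G)) :=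
    Finset.sum_congr rfl fun j _ => hex i j G
  rw [← map_sum, ← map_sum, ← Finset.sum_mul, hsum, ← Finset.mul_sum, Finset.sum_add_distrib,
    hG.sum_X_mul_pderiv] at h1
  rw [h1]
  have : (X i * (∑ _j : Fin N, G + d • G) : MvPolynomial (Fin N) ℂ) =
      ((N : ℂ) + d) • (X i * G) := by
    simp only [Finset.sum_const, Finset.card_univ, Fintype.card_fin, add_smul, mul_add, ← Nat.cast_smul_eq_nsmul ℂ]
    simp
  rw [this, map_smul, smul_eq_mul]

/-- `∏_{k ≠ i} (z - a k)` -/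
def cc {N : ℕ} (a : Fin N → ℂ) (i : Fin N) (z : ℂ) : ℂ := ∏ k ∈ Finset.univ.erase i, (z - a k)

theorem cc_mul {N : ℕ} (a : Fin N → ℂ) (i : Fin N) (z : ℂ) :
    (z - a i) * cc a i z = (Pa a).eval z := by
  rw [Pa_eval, cc, Finset.mul_prod_erase _ (fun k => z - a k) (Finset.mem_univ i)]

theorem cc_sum {N : ℕ} (a : Fin N → ℂ) (z : ℂ) :
    ∑ i, cc a i z = (Polynomial.derivative (Pa a)).eval z := by
  rw [Pa, Polynomial.derivative_prod_finset]
  simp [cc, Polynomial.eval_finsetSum, Polynomial.eval_prod]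

/-- the linear form `∑ c_i(z) X_i` -/
def QQ {N : ℕ} (a : Fin N → ℂ) (z : ℂ) : MvPolynomial (Fin N) ℂ :=
  ∑ i, MvPolynomial.C (cc a i z) * MvPolynomial.X i

theorem QQ_homog {N : ℕ} (a : Fin N → ℂ) (z : ℂ) : (QQ a z).IsHomogeneous 1 :=
  MvPolynomial.IsHomogeneous.sum _ _ _ fun i _ => by
    simpa using (MvPolynomial.isHomogeneous_C (Fin N) (cc a i z)).mul (MvPolynomial.isHomogeneous_X ℂ i)

theorem QQ_pderiv {N : ℕ} (a : Fin N → ℂ) (z : ℂ) (i : Fin N) :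
    MvPolynomial.pderiv i (QQ a z) = MvPolynomial.C (cc a i z) := by
  simp only [QQ, map_sum, MvPolynomial.pderiv_C_mul, MvPolynomial.pderiv_X]
  rw [Finset.sum_eq_single i]
  · simp
  · intro j _ hj
    simp [Ne.symm hj]
  · simp

theorem QQ_ident {N : ℕ} (a : Fin N → ℂ) (z0 z : ℂ) (h : z ≠ z0) :
    ∑ i, MvPolynomial.C (cc a i z0 * cc a i z) * (MvPolynomial.X i : MvPolynomial (Fin N) ℂ) =
      ((Pa a).eval z / (z - z0)) • QQ a z0 - ((Pa a).eval z0 / (z - z0)) • QQ a z := by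
  simp only [QQ, Finset.smul_sum, ← Finset.sum_sub_distrib, MvPolynomial.smul_eq_C_mul]
  refine Finset.sum_congr rfl fun i _ => ?_
  rw [← mul_assoc, ← mul_assoc, ← sub_mul, ← map_mul, ← map_mul, ← map_sub]
  congr 2
  rw [← cc_mul a i z, ← cc_mul a i z0]
  have : z - z0 ≠ 0 := sub_ne_zero.2 h
  field_simp
  ring

theorem pderiv_prod_fin {N : ℕ} {ι : Type*} [DecidableEq ι] (s : Finset ι) (i : Fin N)
    (f : ι → MvPolynomial (Fin N) ℂ) :
    MvPolynomial.pderiv i (∏ j ∈ s, f j) =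
      ∑ j ∈ s, (∏ k ∈ s.erase j, f k) * MvPolynomial.pderiv i (f j) := by
  induction s using Finset.induction_on with
  | empty => simp
  | insert b s hb ih =>
    rw [Finset.prod_insert hb, Derivation.leibniz, ih, Finset.sum_insert hb,
      Finset.erase_insert hb, smul_eq_mul, smul_eq_mul, Finset.mul_sum, add_comm]
    congr 1
    refine Finset.sum_congr rfl fun j hj => ?_
    have hjb : b ≠ j := fun h => hb (h ▸ hj)
    rw [Finset.erase_insert_of_ne hjb, Finset.prod_insert (fun h => hb (Finset.mem_of_mem_erase h)), mul_assoc]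

open MvPolynomial in
theorem E_rec {N : ℕ} (E : MvPolynomial (Fin N) ℂ →ₗ[ℂ] ℂ)
    (hsum : ∀ G, E ((∑ i, X i) * G) = E G)
    (hex : ∀ i j G, E (X j * (G + X i * pderiv i G)) = E (X i * (G + X j * pderiv j G)))
    (a : Fin N → ℂ) (m : ℕ) (z0 : ℂ) (z : Fin m → ℂ) (hz : ∀ j, z j ≠ z0) :
    ((N : ℂ) + m) * E (QQ a z0 * ∏ j, QQ a (z j)) =
      (Polynomial.derivative (Pa a)).eval z0 * E (∏ j, QQ a (z j)) +
      ∑ j, ((Pa a).eval (z j) / (z j - z0) * E (QQ a z0 * ∏ k ∈ Finset.univ.erase j, QQ a (z k))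
        - (Pa a).eval z0 / (z j - z0) * E (∏ k, QQ a (z k))) := by
  set G := ∏ j, QQ a (z j) with hG
  have hGh : G.IsHomogeneous m := by
    have := MvPolynomial.IsHomogeneous.prod Finset.univ (fun j => QQ a (z j)) (fun _ => 1)
      (fun j _ => QQ_homog a (z j))
    simpa using this
  have h1 : QQ a z0 * G = ∑ i, cc a i z0 • (X i * G) := by
    simp only [QQ, Finset.sum_mul, MvPolynomial.smul_eq_C_mul, mul_assoc]
  have h2 : ((N : ℂ) + m) * E (QQ a z0 * G) = ∑ i, cc a i z0 * E (G + X i * pderiv i G) := by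
    rw [h1, map_sum, Finset.mul_sum]
    refine Finset.sum_congr rfl fun i _ => ?_
    rw [map_smul, smul_eq_mul, ← E_homog E hsum hex m G hGh i]
    ring
  rw [h2]
  simp only [map_add, mul_add, Finset.sum_add_distrib]
  rw [← Finset.sum_mul, cc_sum]
  congr 1
  have h3 : ∀ i, pderiv i G = ∑ j, (∏ k ∈ Finset.univ.erase j, QQ a (z k)) * C (cc a i (z j)) := by
    intro i
    rw [hG, pderiv_prod_fin]
    refine Finset.sum_congr rfl fun j _ => ?_
    rw [QQ_pderiv]
  have h4 : ∑ i, cc a i z0 • (X i * pderiv i G) = ∑ j, (∏ k ∈ Finset.univ.erase j, QQ a (z k)) *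
      ∑ i, MvPolynomial.C (cc a i z0 * cc a i (z j)) * (MvPolynomial.X i : MvPolynomial (Fin N) ℂ) := by
    simp only [h3, Finset.mul_sum, Finset.smul_sum]
    rw [Finset.sum_comm]
    refine Finset.sum_congr rfl fun j _ => Finset.sum_congr rfl fun i _ => ?_
    rw [MvPolynomial.smul_eq_C_mul, map_mul]
    ring
  calc ∑ i, cc a i z0 * E (X i * pderiv i G) = E (∑ i, cc a i z0 • (X i * pderiv i G)) := by
        rw [map_sum]; simp
    _ = _ := by
        rw [h4, map_sum]
        refine Finset.sum_congr rfl fun j _ => ?_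
        rw [QQ_ident a z0 (z j) (hz j), mul_sub, map_sub, mul_smul_comm, mul_smul_comm, map_smul,
          map_smul, smul_eq_mul, smul_eq_mul, mul_comm (∏ k ∈ _, _) (QQ a z0),
          Finset.prod_erase_mul _ _ (Finset.mem_univ j)]

theorem prod_erase_succAbove {R : Type*} [CommMonoid R] {m : ℕ} (j : Fin (m + 1)) (f : Fin (m + 1) → R) :
    ∏ k, f (j.succAbove k) = ∏ k ∈ Finset.univ.erase j, f k := by
  have : Finset.univ.erase j = Finset.univ.map j.succAboveEmb := by
    ext i
    simp only [Finset.mem_erase, Finset.mem_univ, and_true, Finset.mem_map, true_and,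
      Fin.coe_succAboveEmb]
    exact ⟨fun h => Fin.exists_succAbove_eq h, fun ⟨k, hk⟩ => hk ▸ Fin.succAbove_ne j k⟩
  rw [this, Finset.prod_map]; rfl

theorem prod_erase_succ {R : Type*} [CommMonoid R] {m : ℕ} (l : Fin m) (f : Fin (m + 1) → R) :
    ∏ k ∈ Finset.univ.erase l.succ, f k = f 0 * ∏ k ∈ Finset.univ.erase l, f k.succ := by
  have : Finset.univ.erase l.succ = insert 0 ((Finset.univ.erase l).map (Fin.succEmb m)) := by
    ext i
    refine Fin.cases ?_ (fun i => ?_) i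
    · simp [Fin.succ_ne_zero, eq_comm]
    · simp [Fin.succ_ne_zero]
  rw [this, Finset.prod_insert, Finset.prod_map]
  · rfl
  · simp [Fin.succ_ne_zero]

theorem alg_step {m : ℕ} (z : Fin (m + 1) → ℂ) (hz : Function.Injective z)
    (p e D : Fin (m + 1) → ℂ) (dp : ℂ) (π : Polynomial ℂ)
    (hπ : π = ∏ k, (Polynomial.X - Polynomial.C (z (Fin.succ k))))
    (hD0 : D 0 = (Polynomial.derivative π).eval (z 0) * p 0 + π.eval (z 0) * dp)
    (hD : ∀ l : Fin m, D l.succ = (Polynomial.derivative π).eval (z l.succ) * p l.succ) :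
    ∑ j, D j / (∏ k ∈ Finset.univ.erase j, (z j - z k)) * e j =
      dp * e 0 + ∑ l : Fin m, (p l.succ / (z l.succ - z 0) * e l.succ
        - p 0 / (z l.succ - z 0) * e 0) := by
  have hne : ∀ j k, k ≠ j → z j - z k ≠ 0 := fun j k h => sub_ne_zero.2 fun h' => h (hz h'.symm)
  have hπe : ∀ x, π.eval x = ∏ k, (x - z (Fin.succ k)) := fun x => by
    simp [hπ, Polynomial.eval_prod]
  have hπd : ∀ x, (Polynomial.derivative π).eval x =
      ∑ l, ∏ k ∈ Finset.univ.erase l, (x - z (Fin.succ k)) := by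
    intro x
    rw [hπ, Polynomial.derivative_prod_finset]
    simp [Polynomial.eval_finsetSum, Polynomial.eval_prod]
  rw [Fin.sum_univ_succ]
  have h0 : D 0 / (∏ k ∈ Finset.univ.erase (0 : Fin (m + 1)), (z 0 - z k)) =
      dp - ∑ l : Fin m, p 0 / (z l.succ - z 0) := by
    rw [← prod_erase_succAbove]
    simp only [Fin.zero_succAbove]
    have hP : ∏ k : Fin m, (z 0 - z k.succ) ≠ 0 :=
      Finset.prod_ne_zero_iff.2 fun k _ => hne _ _ (Fin.succ_ne_zero k)
    rw [div_eq_iff hP, hD0, hπe, hπd, sub_mul, Finset.sum_mul, Finset.sum_mul, mul_comm dp,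
      add_comm, sub_eq_add_neg, ← Finset.sum_neg_distrib]
    congr 1
    refine Finset.sum_congr rfl fun l _ => ?_
    rw [← Finset.mul_prod_erase _ _ (Finset.mem_univ l)]
    have := hne l.succ 0 (Fin.succ_ne_zero l).symm
    field_simp
    ring
  have hl : ∀ l : Fin m, D l.succ / (∏ k ∈ Finset.univ.erase l.succ, (z l.succ - z k)) =
      p l.succ / (z l.succ - z 0) := by
    intro l
    rw [prod_erase_succ, hD, hπd, Finset.sum_eq_single l]
    · have := hne l.succ 0 (Fin.succ_ne_zero l).symm
      have hP : ∏ k ∈ Finset.univ.erase l, (z l.succ - z k.succ) ≠ 0 :=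
        Finset.prod_ne_zero_iff.2 fun k hk => hne _ _ fun h =>
          Finset.ne_of_mem_erase hk (Fin.succ_injective _ h)
      field_simp
    · intro b _ hb
      exact Finset.prod_eq_zero (Finset.mem_erase.2 ⟨hb.symm, Finset.mem_univ l⟩) (sub_self _)
    · simp
  rw [h0]
  simp only [hl]
  rw [Finset.sum_sub_distrib, ← Finset.sum_mul]
  ring

open MvPolynomial in
theorem E_eval {N : ℕ} (E : MvPolynomial (Fin N) ℂ →ₗ[ℂ] ℂ) (hone : E 1 = 1)
    (hsum : ∀ G, E ((∑ i, X i) * G) = E G)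
    (hex : ∀ i j G, E (X j * (G + X i * pderiv i G)) = E (X i * (G + X j * pderiv j G)))
    (a : Fin N → ℂ) (m : ℕ) (z : Fin m → ℂ) (hz : Function.Injective z) :
    (∏ l ∈ Finset.range m, ((N : ℂ) + l)) * vdet z * E (∏ j, QQ a (z j)) =
      Matrix.det (Matrix.of fun i j : Fin m =>
        (Polynomial.derivative (Polynomial.X ^ (i : ℕ) * Pa a)).eval (z j)) := by
  induction m with
  | zero => simp [vdet, hone]
  | succ m ih =>
    obtain ⟨π, hπ⟩ : ∃ π : Polynomial ℂ,
      π = ∏ k, (Polynomial.X - Polynomial.C (z (Fin.succ k))) := ⟨_, rfl⟩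
    have h := det_functional_snoc m π (hπ ▸ monic_prod_X_sub _) (hπ ▸ natDegree_prod_X_sub _)
      (fun l => (Polynomial.leval (z l)).comp
        (Polynomial.derivative.comp (LinearMap.mulRight ℂ (Pa a))))
    simp only [LinearMap.comp_apply, Polynomial.leval_apply, LinearMap.mulRight_apply] at h
    rw [← h, Matrix.det_succ_row _ (Fin.last m)]
    have hmin : ∀ j : Fin (m + 1), ((Matrix.of fun i j : Fin (m + 1) =>
          (Polynomial.derivative ((Fin.snoc (α := fun _ => Polynomial ℂ)
        (fun i : Fin m => (Polynomial.X ^ (i : ℕ) : Polynomial ℂ)) π i) * Pa a)).eval (z j)).submatrix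
          (Fin.last m).succAbove j.succAbove).det =
          (∏ l ∈ Finset.range m, ((N : ℂ) + l)) * vdet (fun k => z (j.succAbove k)) *
            E (∏ k ∈ Finset.univ.erase j, QQ a (z k)) := by
      intro j
      rw [← prod_erase_succAbove j (fun k => QQ a (z k)), ih (fun k => z (j.succAbove k))
        (hz.comp Fin.succAbove_right_injective)]
      refine congrArg Matrix.det (Matrix.ext fun i k => ?_)
      simp only [Matrix.submatrix_apply, Matrix.of_apply, Fin.succAbove_last, Fin.snoc_castSucc]
    simp only [hmin]
    clear hmin h
    have hv : ∀ j : Fin (m + 1), (-1) ^ (m + (j : ℕ)) * vdet (fun k => z (j.succAbove k)) *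
        ∏ k ∈ Finset.univ.erase j, (z j - z k) = vdet z := by
      intro j
      rw [← prod_erase_succAbove j (fun k => z j - z k)]
      exact vdet_succAbove z j
    have hne : ∀ j k, k ≠ j → z j - z k ≠ 0 := fun j k h => sub_ne_zero.2 fun h' => h (hz h'.symm)
    have hzj : ∀ j, ∏ k ∈ Finset.univ.erase j, (z j - z k) ≠ 0 := fun j =>
      Finset.prod_ne_zero_iff.2 fun k hk => hne j k (Finset.ne_of_mem_erase hk)
    have hv' : ∀ j : Fin (m + 1), (-1) ^ (m + (j : ℕ)) * vdet (fun k => z (j.succAbove k)) =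
        vdet z / ∏ k ∈ Finset.univ.erase j, (z j - z k) := by
      intro j
      rw [eq_div_iff (hzj j), hv]
    have key := alg_step z hz (fun j => (Pa a).eval (z j))
      (fun j => E (∏ k ∈ Finset.univ.erase j, QQ a (z k)))
      (fun j => (Polynomial.derivative (π * Pa a)).eval (z j))
      ((Polynomial.derivative (Pa a)).eval (z 0)) π hπ
      (by simp [Polynomial.derivative_mul]) (by
        intro l
        have : π.eval (z l.succ) = 0 := by
          rw [hπ, Polynomial.eval_prod]
          exact Finset.prod_eq_zero (Finset.mem_univ l) (by simp)
        simp [Polynomial.derivative_mul, this])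
    have hrec := E_rec E hsum hex a m (z 0) (fun k => z k.succ)
      (fun j h => Fin.succ_ne_zero j (hz h))
    have e0 : ∏ k ∈ Finset.univ.erase (0 : Fin (m + 1)), QQ a (z k) = ∏ k : Fin m, QQ a (z k.succ) := by
      rw [← prod_erase_succAbove]; simp
    have e1 : ∀ l : Fin m, ∏ k ∈ Finset.univ.erase l.succ, QQ a (z k) =
        QQ a (z 0) * ∏ k ∈ Finset.univ.erase l, QQ a (z k.succ) := fun l =>
      prod_erase_succ l (fun k => QQ a (z k))
    simp only [e0, e1] at key
    rw [← hrec] at key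
    have : (∏ l ∈ Finset.range (m + 1), ((N : ℂ) + l)) * vdet z * E (∏ j, QQ a (z j)) =
      (∏ l ∈ Finset.range m, ((N : ℂ) + l)) * vdet z *
        (((N : ℂ) + m) * E (QQ a (z 0) * ∏ i : Fin m, QQ a (z i.succ))) := by
      rw [Finset.prod_range_succ, Fin.prod_univ_succ]; ring
    rw [this, ← key, Finset.mul_sum]
    refine Finset.sum_congr rfl fun j _ => ?_
    simp only [Fin.val_last, Matrix.of_apply, Fin.snoc_last]
    have h5 := hv' j
    set Ej := E (∏ k ∈ Finset.univ.erase j, QQ a (z k)) with hEj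
    set Dj := (Polynomial.derivative (π * Pa a)).eval (z j)
    set A := ∏ l ∈ Finset.range m, ((N : ℂ) + l)
    calc A * vdet z * (Dj / (∏ k ∈ Finset.univ.erase j, (z j - z k)) * Ej)
        = (vdet z / ∏ k ∈ Finset.univ.erase j, (z j - z k)) * (A * Dj * Ej) := by ring
      _ = _ := by rw [← h5]; ring

theorem det_cols_sum {R : Type*} [CommRing R] {m M : ℕ} (A : Fin m → Fin M → R)
    (w : Fin m → Fin M → R) :
    Matrix.det (Matrix.of fun i j : Fin m => ∑ s, w j s * A i s) =
      ∑ r : Fin m → Fin M, (∏ j, w j (r j)) * Matrix.det (Matrix.of fun i j => A i (r j)) := by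
  rw [← Matrix.det_transpose]
  have h := (Matrix.detRowAlternating (n := Fin m) (R := R)).toMultilinearMap.map_sum
    (fun (j : Fin m) (s : Fin M) => w j s • (fun i => A i s : Fin m → R))
  have h1 : (fun j : Fin m => ∑ s : Fin M, w j s • (fun i => A i s : Fin m → R)) =
      (Matrix.of fun i j : Fin m => ∑ s, w j s * A i s)ᵀ := by
    ext i j
    simp
  rw [h1] at h
  refine h.trans (Finset.sum_congr rfl fun r _ => ?_)
  rw [MultilinearMap.map_smul_univ (Matrix.detRowAlternating (n := Fin m) (R := R)).toMultilinearMap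
    (fun j => w j (r j)) (fun j => fun i => A i (r j)), smul_eq_mul]
  congr 1
  rw [← Matrix.det_transpose]
  rfl

theorem coeff_eval (M : ℕ) : ∃ w : Fin M → Fin M → ℂ, ∀ (R : Type) [CommRing R] [Algebra ℂ R]
    (f : Polynomial R), f.natDegree < M → ∀ k : Fin M,
      f.coeff k = ∑ s : Fin M, algebraMap ℂ R (w k s) * f.eval (algebraMap ℂ R (s : ℕ)) := by
  set V : Matrix (Fin M) (Fin M) ℂ := Matrix.vandermonde (fun s => ((s : ℕ) : ℂ)) with hV
  have hdet : V.det ≠ 0 := Matrix.det_vandermonde_ne_zero_iff.2 fun i j h => by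
    simpa [Fin.ext_iff] using h
  obtain ⟨W, h1⟩ : ∃ W : Matrix (Fin M) (Fin M) ℂ, W * V = 1 :=
    ⟨V⁻¹, Matrix.nonsing_inv_mul _ (isUnit_iff_ne_zero.2 hdet)⟩
  refine ⟨fun k s => W k s, fun R _ _ f hf k => ?_⟩
  have h2 : ∀ l : Fin M, ∑ s, W k s * ((s : ℕ) : ℂ) ^ (l : ℕ) = if k = l then 1 else 0 := by
    intro l
    have := congrFun (congrFun h1 k) l
    rw [Matrix.mul_apply, Matrix.one_apply] at this
    simpa [hV, Matrix.vandermonde_apply] using this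
  simp only [Polynomial.eval_eq_sum_range' hf, Finset.mul_sum]
  rw [Finset.sum_comm, ← Fin.sum_univ_eq_sum_range (fun l => ∑ s : Fin M, algebraMap ℂ R (W k s) * (f.coeff l * (algebraMap ℂ R (s : ℕ)) ^ l))]
  have h3 : ∀ l : Fin M, ∑ s : Fin M, algebraMap ℂ R (W k s) * (f.coeff l * (algebraMap ℂ R (s : ℕ)) ^ (l : ℕ))
      = f.coeff l * (algebraMap ℂ R (if k = l then 1 else 0)) := by
    intro l
    rw [← h2 l, map_sum, Finset.mul_sum]
    refine Finset.sum_congr rfl fun s _ => ?_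
    rw [map_mul, map_pow]; ring
  simp only [h3]
  rw [Finset.sum_eq_single k]
  · simp
  · intro b _ hb
    rw [if_neg hb.symm]; simp
  · simp

/-- generic compressed characteristic polynomial -/
def Qp {R : Type*} [CommRing R] {N : ℕ} (a p : Fin N → R) : Polynomial R :=
  ∑ i, Polynomial.C (p i) * ∏ k ∈ Finset.univ.erase i, (Polynomial.X - Polynomial.C (a k))

theorem Qp_natDegree {R : Type*} [CommRing R] {N : ℕ} (a p : Fin N → R) :
    (Qp a p).natDegree ≤ N := by
  refine Polynomial.natDegree_sum_le_of_forall_le _ _ fun i _ => ?_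
  refine (Polynomial.natDegree_C_mul_le _ _).trans ?_
  refine (Polynomial.natDegree_prod_le _ _).trans ?_
  refine (Finset.sum_le_sum fun k _ => Polynomial.natDegree_X_sub_C_le _).trans ?_
  simp

theorem Jf_sum_eval {R : Type} [CommRing R] [Algebra ℂ R] {m M : ℕ} (κ : Fin m → ℕ)
    (hM : ∀ j, κ j < M) (w : Fin M → Fin M → ℂ)
    (hw : ∀ (f : Polynomial R), f.natDegree < M → ∀ k : Fin M,
      f.coeff k = ∑ s : Fin M, algebraMap ℂ R (w k s) * f.eval (algebraMap ℂ R (s : ℕ)))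
    (q : Polynomial R) (hq : q.natDegree + m < M) :
    Jf m κ q = ∑ r : Fin m → Fin M, algebraMap ℂ R (∏ j, w ⟨κ j, hM j⟩ (r j)) *
      (algebraMap ℂ R (vdet (fun j => ((r j : ℕ) : ℂ))) *
        ∏ j, q.eval (algebraMap ℂ R ((r j : ℕ) : ℂ))) := by
  have : Jf m κ q =
    Matrix.det (Matrix.of fun i j : Fin m => ∑ s : Fin M, algebraMap ℂ R (w ⟨κ j, hM j⟩ s) *
      ((Polynomial.X ^ (i : ℕ) * q).eval (algebraMap ℂ R ((s : ℕ) : ℂ)))) := by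
    rw [Jf]
    refine congrArg Matrix.det (Matrix.ext fun i j => ?_)
    simp only [Matrix.of_apply]
    rw [← hw _ _ ⟨κ j, hM j⟩]
    refine (Polynomial.natDegree_mul_le).trans_lt ?_
    have h2 := i.2
    have := Polynomial.natDegree_X_pow_le (R := R) (i : ℕ)
    omega
  have hA : ∃ A : Fin m → Fin M → R, ∀ i s,
    A i s = (Polynomial.X ^ (i : ℕ) * q).eval (algebraMap ℂ R ((s : ℕ) : ℂ)) := ⟨_, fun _ _ => rfl⟩
  obtain ⟨A, hA⟩ := hA
  simp only [← hA] at this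
  rw [this, det_cols_sum A (fun (j : Fin m) (s : Fin M) => algebraMap ℂ R (w ⟨κ j, hM j⟩ s))]
  simp only [hA]
  refine Finset.sum_congr rfl fun r _ => ?_
  rw [map_prod]
  congr 1
  rw [vdet, RingHom.map_det, mul_comm, ← Matrix.det_mul_row]
  refine congrArg Matrix.det (Matrix.ext fun i j => ?_)
  simp [mul_comm]

open MvPolynomial in
theorem E_Jf {N : ℕ} (E : MvPolynomial (Fin N) ℂ →ₗ[ℂ] ℂ) (hone : E 1 = 1)
    (hsum : ∀ G, E ((∑ i, X i) * G) = E G)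
    (hex : ∀ i j G, E (X j * (G + X i * pderiv i G)) = E (X i * (G + X j * pderiv j G)))
    (a : Fin N → ℂ) (m : ℕ) (κ : Fin m → ℕ) :
    (∏ l ∈ Finset.range m, ((N : ℂ) + l)) * E (Jf m κ (Qp (fun i => C (a i)) (fun i => X i))) =
      (∏ j, ((κ j : ℂ) + 1)) * Jf m (fun j => κ j + 1) (Pa a) := by
  obtain ⟨M, hM1, hM2⟩ : ∃ M, N + m < M ∧ ∀ j, κ j < M := by
    refine ⟨N + m + 1 + ∑ j, κ j, by omega, fun j => ?_⟩
    have := Finset.single_le_sum (f := κ) (fun _ _ => Nat.zero_le _) (Finset.mem_univ j)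
    omega
  obtain ⟨w, hw⟩ := coeff_eval M
  have hw2 := hw ℂ
  simp only [Algebra.algebraMap_self, RingHom.id_apply] at hw2
  have hQe : ∀ z : ℂ, (Qp (fun i => (C (a i) : MvPolynomial (Fin N) ℂ)) (fun i => X i)).eval (C z) = QQ a z := by
    intro z
    simp [Qp, QQ, cc, Polynomial.eval_finsetSum, Polynomial.eval_prod, mul_comm]
  have hL : Jf m κ (Qp (fun i => (C (a i) : MvPolynomial (Fin N) ℂ)) (fun i => X i)) =
      ∑ r : Fin m → Fin M, (∏ j, w ⟨κ j, hM2 j⟩ (r j)) • (vdet (fun j => ((r j : ℕ) : ℂ)) •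
        ∏ j, QQ a ((r j : ℕ) : ℂ)) := by
    rw [Jf_sum_eval κ hM2 w (hw _) _ (lt_of_le_of_lt (Nat.add_le_add_right (Qp_natDegree _ _) m) hM1)]
    refine Finset.sum_congr rfl fun r _ => ?_
    simp only [MvPolynomial.algebraMap_eq, hQe, MvPolynomial.smul_eq_C_mul]
  have hR : (∏ j, ((κ j : ℂ) + 1)) * Jf m (fun j => κ j + 1) (Pa a) =
      ∑ r : Fin m → Fin M, (∏ j, w ⟨κ j, hM2 j⟩ (r j)) * Matrix.det (Matrix.of fun i j : Fin m =>
        (Polynomial.derivative (Polynomial.X ^ (i : ℕ) * Pa a)).eval ((r j : ℕ) : ℂ)) := by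
    rw [← det_cols_sum (fun (i : Fin m) (s : Fin M) => (Polynomial.derivative (Polynomial.X ^ (i : ℕ) * Pa a)).eval ((s : ℕ) : ℂ)) (fun (j : Fin m) (s : Fin M) => w ⟨κ j, hM2 j⟩ s), Jf, ← Matrix.det_mul_row]
    congr 1
    ext1 i j
    simp only [Matrix.of_apply]
    rw [← hw2 _ _ ⟨κ j, hM2 j⟩, Polynomial.coeff_derivative, mul_comm]
    refine (Polynomial.natDegree_derivative_le _).trans_lt ?_
    refine (Nat.sub_le _ _).trans_lt ?_
    refine (Polynomial.natDegree_mul_le).trans_lt ?_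
    have := Pa_natDegree a
    have h2 := i.2
    rw [Polynomial.natDegree_X_pow]
    omega
  rw [hR, hL, map_sum, Finset.mul_sum]
  refine Finset.sum_congr rfl fun r _ => ?_
  rw [map_smul, map_smul, smul_eq_mul, smul_eq_mul, mul_left_comm]
  congr 1
  by_cases hr : Function.Injective r
  · rw [← E_eval E hone hsum hex a m (fun j => ((r j : ℕ) : ℂ)) (fun i j h => hr (Fin.ext (by simpa using h))),
      mul_assoc]
  · simp only [Function.Injective, not_forall] at hr
    obtain ⟨i, j, hij, hne⟩ := hr
    rw [vdet, Matrix.det_zero_of_column_eq hne, Matrix.det_zero_of_column_eq hne]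
    · simp
    · intro k; simp [hij]
    · intro k; simp [hij]

instance matBorel (l m : ℕ) : BorelSpace (Matrix (Fin l) (Fin m) ℂ) :=
  inferInstanceAs (BorelSpace (Fin l → Fin m → ℂ))

instance matSC (l m : ℕ) : SecondCountableTopology (Matrix (Fin l) (Fin m) ℂ) :=
  inferInstanceAs (SecondCountableTopology (Fin l → Fin m → ℂ))

theorem integrable_of_compact {X : Type*} [TopologicalSpace X] [MeasurableSpace X]
    [OpensMeasurableSpace X] [SecondCountableTopology X] (ν : Measure X) [IsFiniteMeasure ν]
    {K : Set X} (hK : IsCompact K) (hν : ∀ᵐ x ∂ν, x ∈ K) {F : X → ℂ} (hF : Continuous F) :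
    Integrable F ν := by
  obtain ⟨C, hC⟩ := (hK.image hF).isBounded.exists_norm_le
  refine Integrable.of_bound hF.aestronglyMeasurable C ?_
  filter_upwards [hν] with x hx
  exact hC _ ⟨x, hx, rfl⟩

theorem unitary_isClosed (n : ℕ) :
    IsClosed {A : Matrix (Fin n) (Fin n) ℂ | A ∈ Matrix.unitaryGroup (Fin n) ℂ} := by
  have : {A : Matrix (Fin n) (Fin n) ℂ | A ∈ Matrix.unitaryGroup (Fin n) ℂ} =
      {A | A * Aᴴ = 1} := by
    ext A
    simp [Matrix.mem_unitaryGroup_iff, Matrix.star_eq_conjTranspose]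
  rw [this]
  exact isClosed_eq (by fun_prop) continuous_const

theorem unitary_isCompact (n : ℕ) :
    IsCompact {A : Matrix (Fin n) (Fin n) ℂ | A ∈ Matrix.unitaryGroup (Fin n) ℂ} := by
  have h : IsCompact (Set.pi Set.univ fun _ : Fin n => Set.pi Set.univ fun _ : Fin n =>
      Metric.closedBall (0 : ℂ) 1) :=
    isCompact_univ_pi fun _ => isCompact_univ_pi fun _ => isCompact_closedBall _ _
  refine h.of_isClosed_subset (unitary_isClosed n) ?_
  intro A hA i _ j _
  simpa using entry_norm_bound_of_unitary hA i j

section Haar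
variable {n : ℕ} {μ : Measure (Matrix (Fin n) (Fin n) ℂ)}

theorem haar_ae (hμ : IsHaarUnitary n μ) : ∀ᵐ k ∂μ, k ∈ Matrix.unitaryGroup (Fin n) ℂ := hμ.2.1

theorem haar_integrable (hμ : IsHaarUnitary n μ) {F : Matrix (Fin n) (Fin n) ℂ → ℂ}
    (hF : Continuous F) : Integrable F μ := by
  haveI := hμ.1
  exact integrable_of_compact μ (unitary_isCompact n) (haar_ae hμ) hF

theorem haar_left (hμ : IsHaarUnitary n μ) {F : Matrix (Fin n) (Fin n) ℂ → ℂ}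
    (hF : Continuous F) {U : Matrix (Fin n) (Fin n) ℂ} (hU : U ∈ Matrix.unitaryGroup (Fin n) ℂ) :
    ∫ k, F (U * k) ∂μ = ∫ k, F k ∂μ := by
  conv_rhs => rw [← hμ.2.2 U hU]
  rw [integral_map]
  · exact (by fun_prop : Continuous fun A : Matrix (Fin n) (Fin n) ℂ => U * A).aemeasurable
  · exact hF.aestronglyMeasurable

theorem haar_prod_integrable {n m : ℕ} {μ : Measure (Matrix (Fin n) (Fin n) ℂ)}
    {ν : Measure (Matrix (Fin m) (Fin m) ℂ)} (hμ : IsHaarUnitary n μ) (hν : IsHaarUnitary m ν)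
    {F : Matrix (Fin n) (Fin n) ℂ × Matrix (Fin m) (Fin m) ℂ → ℂ} (hF : Continuous F) :
    Integrable F (μ.prod ν) := by
  haveI := hμ.1
  haveI := hν.1
  refine integrable_of_compact (μ.prod ν) ((unitary_isCompact n).prod (unitary_isCompact m)) ?_ hF
  have h1 := (Measure.quasiMeasurePreserving_fst (μ := μ) (ν := ν)).ae (haar_ae hμ)
  have h2 := (Measure.quasiMeasurePreserving_snd (μ := μ) (ν := ν)).ae (haar_ae hν)
  filter_upwards [h1, h2] with x hx1 hx2 using ⟨hx1, hx2⟩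

theorem haar_star (hμ : IsHaarUnitary n μ) {F : Matrix (Fin n) (Fin n) ℂ → ℂ}
    (hF : Continuous F) : ∫ k, F kᴴ ∂μ = ∫ k, F k ∂μ := by
  haveI := hμ.1
  have h := integral_integral_swap (μ := μ) (ν := μ) (f := fun k l => F (kᴴ * l))
    (haar_prod_integrable hμ hμ (by fun_prop))
  have h1 : ∫ k, ∫ l, F (kᴴ * l) ∂μ ∂μ = ∫ k, F k ∂μ := by
    have : ∀ᵐ k ∂μ, ∫ l, F (kᴴ * l) ∂μ = ∫ l, F l ∂μ := by
      filter_upwards [haar_ae hμ] with k hk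
      exact haar_left hμ hF (by simpa [Matrix.star_eq_conjTranspose] using Unitary.star_mem hk)
    rw [integral_congr_ae this]
    simp
  have h2 : ∫ l, ∫ k, F (kᴴ * l) ∂μ ∂μ = ∫ k, F kᴴ ∂μ := by
    have : ∀ᵐ l ∂μ, ∫ k, F (kᴴ * l) ∂μ = ∫ k, F kᴴ ∂μ := by
      filter_upwards [haar_ae hμ] with l hl
      have := haar_left hμ (F := fun k => F (kᴴ * l)) (by fun_prop) hl
      rw [← this]
      have hl' : lᴴ * l = 1 := by
        simpa [Matrix.star_eq_conjTranspose] using Matrix.mem_unitaryGroup_iff'.1 hl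
      simp [Matrix.conjTranspose_mul, Matrix.mul_assoc, hl']
    rw [integral_congr_ae this]
    simp
  rw [← h1, h, h2]

theorem haar_right (hμ : IsHaarUnitary n μ) {F : Matrix (Fin n) (Fin n) ℂ → ℂ}
    (hF : Continuous F) {U : Matrix (Fin n) (Fin n) ℂ} (hU : U ∈ Matrix.unitaryGroup (Fin n) ℂ) :
    ∫ k, F (k * U) ∂μ = ∫ k, F k ∂μ := by
  rw [← haar_star hμ (F := fun k => F (k * U)) (by fun_prop), ← haar_star hμ hF]
  have := haar_left hμ (F := fun k => F kᴴ) (by fun_prop) (U := Uᴴ)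
    (by simpa [Matrix.star_eq_conjTranspose] using Unitary.star_mem hU)
  simpa [Matrix.conjTranspose_mul] using this

theorem haar_exists (n : ℕ) : ∃ μ : Measure (Matrix (Fin n) (Fin n) ℂ), IsHaarUnitary n μ := by
  letI : MeasurableSpace (Matrix.unitaryGroup (Fin n) ℂ) := borel _
  haveI : BorelSpace (Matrix.unitaryGroup (Fin n) ℂ) := ⟨rfl⟩
  haveI : CompactSpace (Matrix.unitaryGroup (Fin n) ℂ) :=
    isCompact_iff_compactSpace.1 (unitary_isCompact n)
  haveI : IsTopologicalGroup (Matrix.unitaryGroup (Fin n) ℂ) := inferInstanceAs (IsTopologicalGroup (unitary (Matrix (Fin n) (Fin n) ℂ)))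
  set K : TopologicalSpace.PositiveCompacts (Matrix.unitaryGroup (Fin n) ℂ) := ⊤
  have hc : Continuous (Subtype.val : Matrix.unitaryGroup (Fin n) ℂ → Matrix (Fin n) (Fin n) ℂ) :=
    continuous_subtype_val
  have hm : Measurable (Subtype.val : Matrix.unitaryGroup (Fin n) ℂ → Matrix (Fin n) (Fin n) ℂ) :=
    hc.measurable
  refine ⟨(Measure.haarMeasure K).map Subtype.val, ?_, ?_, ?_⟩
  · haveI : IsProbabilityMeasure (Measure.haarMeasure K) := ⟨by
      simpa [K] using Measure.haarMeasure_self (K₀ := K)⟩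
    exact Measure.isProbabilityMeasure_map hm.aemeasurable
  · rw [Measure.map_apply hm (unitary_isClosed n).measurableSet.compl]
    convert measure_empty (μ := Measure.haarMeasure K)
    ext x
    simp
  · intro U hU
    rw [Measure.map_map (by exact (by fun_prop : Continuous fun A : Matrix (Fin n) (Fin n) ℂ => U * A).measurable) hm]
    have h1 := map_mul_left_eq_self (Measure.haarMeasure K) ⟨U, hU⟩
    conv_rhs => rw [← h1]
    rw [Measure.map_map hm (by exact (continuous_const.mul continuous_id).measurable)]
    rfl
end Haar

theorem mv_hasDerivAt {N : ℕ} (G : MvPolynomial (Fin N) ℂ) (q : ℝ → Fin N → ℂ) (q' : Fin N → ℂ)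
    (θ : ℝ) (hq : ∀ k, HasDerivAt (fun t => q t k) (q' k) θ) :
    HasDerivAt (fun t => MvPolynomial.eval (q t) G)
      (∑ k, MvPolynomial.eval (q θ) (MvPolynomial.pderiv k G) * q' k) θ := by
  induction G using MvPolynomial.induction_on with
  | C c => simpa using hasDerivAt_const θ c
  | add p r hp hr =>
    have := hp.add hr
    simp only [map_add, add_mul, Finset.sum_add_distrib]
    exact this
  | mul_X p i hp =>
    have := hp.fun_mul (hq i)
    simp only [map_mul, MvPolynomial.eval_X]
    refine this.congr_deriv (Eq.symm ?_)
    simp only [Derivation.leibniz, map_add, smul_eq_mul, map_mul, MvPolynomial.eval_X,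
      MvPolynomial.pderiv_X, add_mul, Finset.sum_add_distrib]
    rw [add_comm]
    congr 1
    · rw [Finset.sum_mul]
      exact Finset.sum_congr rfl fun k _ => by ring
    · rw [Finset.sum_eq_single i]
      · simp
      · intro b _ hb
        simp [Pi.single_apply, hb.symm]
      · simp

/-- differentiate an invariant integral -/
theorem deriv_invariant {n : ℕ} {μ : Measure (Matrix (Fin n) (Fin n) ℂ)} (hμ : IsHaarUnitary n μ)
    (F F' : ℝ → Matrix (Fin n) (Fin n) ℂ → ℂ)
    (hF : Continuous (fun x : ℝ × Matrix (Fin n) (Fin n) ℂ => F x.1 x.2))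
    (hF' : Continuous (fun x : ℝ × Matrix (Fin n) (Fin n) ℂ => F' x.1 x.2))
    (hd : ∀ t u, HasDerivAt (fun t => F t u) (F' t u) t)
    (hc : ∀ t, ∫ u, F t u ∂μ = ∫ u, F 0 u ∂μ) : ∫ u, F' 0 u ∂μ = 0 := by
  have := hμ.1
  obtain ⟨C, hC⟩ := (((isCompact_closedBall (0 : ℝ) 1).prod (unitary_isCompact n)).image
    hF').isBounded.exists_norm_le
  have h := hasDerivAt_integral_of_dominated_loc_of_deriv_le (μ := μ) (F := F) (F' := F')
    (x₀ := (0 : ℝ)) (bound := fun _ => C) (Metric.ball_mem_nhds (0 : ℝ) one_pos)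
    (Eventually.of_forall fun t => (by fun_prop : Continuous (F t)).aestronglyMeasurable)
    (haar_integrable hμ (by fun_prop))
    ((by fun_prop : Continuous (F' 0)).aestronglyMeasurable)
    (by
      filter_upwards [haar_ae hμ] with u hu t ht
      exact hC _ ⟨(t, u), ⟨Metric.ball_subset_closedBall ht, hu⟩, rfl⟩)
    (integrable_const C)
    (Eventually.of_forall fun u t _ => hd t u)
  have h2 : (fun t => ∫ u, F t u ∂μ) = fun _ => ∫ u, F 0 u ∂μ := funext hc
  have h3 := h.2
  rw [h2] at h3
  exact h3.unique (hasDerivAt_const _ _)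

/-- plane rotation -/
def rotU {N : ℕ} (i j : Fin N) (ζ : ℂ) (t : ℝ) : Matrix (Fin N) (Fin N) ℂ :=
  1 + (((Real.cos t : ℝ) : ℂ) - 1) • (Matrix.single i i 1 + Matrix.single j j 1) +
    ((Real.sin t : ℝ) : ℂ) • (Matrix.single i j ζ - Matrix.single j i (star ζ))

theorem rotU_unitary {N : ℕ} (i j : Fin N) (hij : i ≠ j) (ζ : ℂ) (hζ : ζ * star ζ = 1) (t : ℝ) :
    rotU i j ζ t ∈ Matrix.unitaryGroup (Fin N) ℂ := by
  rw [Matrix.mem_unitaryGroup_iff, Matrix.star_eq_conjTranspose]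
  have hcs : ((Real.cos t : ℝ) : ℂ) * (Real.cos t : ℝ) + ((Real.sin t : ℝ) : ℂ) * (Real.sin t : ℝ) = 1 := by
    norm_cast
    nlinarith [Real.sin_sq_add_cos_sq t]
  have hc1 : star ((Real.cos t : ℝ) : ℂ) = ((Real.cos t : ℝ) : ℂ) := Complex.conj_ofReal _
  have hs1 : star ((Real.sin t : ℝ) : ℂ) = ((Real.sin t : ℝ) : ℂ) := Complex.conj_ofReal _
  unfold rotU
  generalize ((Real.cos t : ℝ) : ℂ) = c at *
  generalize ((Real.sin t : ℝ) : ℂ) = s at *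
  have hH : (1 + (c - 1) • (Matrix.single i i (1 : ℂ) + Matrix.single j j 1) +
    s • (Matrix.single i j ζ - Matrix.single j i (star ζ)))ᴴ =
    1 + (c - 1) • (Matrix.single i i (1 : ℂ) + Matrix.single j j 1) +
    s • (Matrix.single j i (star ζ) - Matrix.single i j ζ) := by
    simp only [Matrix.conjTranspose_add, Matrix.conjTranspose_smul, Matrix.conjTranspose_sub,
      Matrix.conjTranspose_one, Matrix.conjTranspose_single, star_sub, hc1, hs1, star_one, star_star]
  rw [hH]
  have e1 : (Matrix.single i i (1 : ℂ) + Matrix.single j j 1) * (Matrix.single i i (1 : ℂ) + Matrix.single j j 1)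
     = (Matrix.single i i (1 : ℂ) + Matrix.single j j 1) := by
    simp [mul_add, add_mul, hij, hij.symm]
  have e2 : (Matrix.single i i (1 : ℂ) + Matrix.single j j 1) * (Matrix.single i j ζ - Matrix.single j i (star ζ))
     = (Matrix.single i j ζ - Matrix.single j i (star ζ)) := by
    simp [mul_sub, add_mul, hij, hij.symm]
  have e3 : (Matrix.single i j ζ - Matrix.single j i (star ζ)) * (Matrix.single i i (1 : ℂ) + Matrix.single j j 1)
     = (Matrix.single i j ζ - Matrix.single j i (star ζ)) := by
    simp [mul_add, sub_mul, hij, hij.symm]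
    abel
  have e4 : (Matrix.single i j ζ - Matrix.single j i (star ζ)) * (Matrix.single i j ζ - Matrix.single j i (star ζ))
     = -(Matrix.single i i (1 : ℂ) + Matrix.single j j 1) := by
    have hζ2 : star ζ * ζ = 1 := by rw [mul_comm]; exact hζ
    simp only [mul_sub, sub_mul, Matrix.single_mul_single_same, Matrix.single_mul_single_of_ne _ _ _ _ hij,
      Matrix.single_mul_single_of_ne _ _ _ _ hij.symm, hζ, hζ2]
    abel
  have e5 : (Matrix.single j i (star ζ) - Matrix.single i j ζ) = -(Matrix.single i j ζ - Matrix.single j i (star ζ)) := by abel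
  rw [e5]
  generalize (Matrix.single i i (1 : ℂ) + Matrix.single j j 1) = P at *
  generalize (Matrix.single i j ζ - Matrix.single j i (star ζ)) = Z at *
  have : (1 + (c - 1) • P + s • Z) * (1 + (c - 1) • P + s • -Z) =
      1 + (2 * (c - 1)) • P + ((c - 1) * (c - 1)) • (P * P) + ((c - 1) * s) • (Z * P - P * Z) - (s * s) • (Z * Z) := by
    simp only [mul_add, add_mul, smul_neg, mul_neg, Matrix.mul_smul, Matrix.smul_mul, mul_one, one_mul]
    module
  rw [this, e1, e2, e3, e4]
  have : 2 * (c - 1) + (c - 1) * (c - 1) + s * s = 0 := by linear_combination hcs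
  have h2 : 1 + (2 * (c - 1)) • P + ((c - 1) * (c - 1)) • P + ((c - 1) * s) • (Z - Z) - (s * s) • -P
    = 1 + (2 * (c - 1) + (c - 1) * (c - 1) + s * s) • P := by module
  rw [h2, this, zero_smul, add_zero]

theorem rotU_mul {N : ℕ} (i j : Fin N) (ζ : ℂ) (t : ℝ) (u : Matrix (Fin N) (Fin N) ℂ) (k c : Fin N) :
    (rotU i j ζ t * u) k c = u k c + (((Real.cos t : ℝ) : ℂ) - 1) *
      ((if k = i then u i c else 0) + (if k = j then u j c else 0)) +
      ((Real.sin t : ℝ) : ℂ) * ((if k = i then ζ * u j c else 0) - (if k = j then star ζ * u i c else 0)) := by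
  simp only [rotU, Matrix.add_mul, Matrix.smul_mul, Matrix.sub_mul, Matrix.add_apply,
    Matrix.smul_apply, Matrix.sub_apply, one_mul, smul_eq_mul]
  have : ∀ (i j : Fin N) (z : ℂ), (Matrix.single i j z * u) k c = if k = i then z * u j c else 0 := by
    intro i j z
    by_cases h : k = i
    · subst h; simp
    · simp [h]
  simp only [this, one_mul]

/-- the moment functional of the squared moduli of a column of a Haar unitary -/
def colE {N : ℕ} (μ : Measure (Matrix (Fin N) (Fin N) ℂ)) (hμ : IsHaarUnitary N μ) (c : Fin N) :
    MvPolynomial (Fin N) ℂ →ₗ[ℂ] ℂ where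
  toFun G := ∫ u, MvPolynomial.eval (fun k => u k c * star (u k c)) G ∂μ
  map_add' G H := by
    simp only [map_add]
    refine integral_add (haar_integrable hμ ?_) (haar_integrable hμ ?_)
    · exact (MvPolynomial.continuous_eval G).comp (by fun_prop)
    · exact (MvPolynomial.continuous_eval H).comp (by fun_prop)
  map_smul' r G := by
    simp only [MvPolynomial.smul_eval, RingHom.id_apply, smul_eq_mul]
    exact integral_const_mul _ _

theorem colE_one {N : ℕ} (μ : Measure (Matrix (Fin N) (Fin N) ℂ)) (hμ : IsHaarUnitary N μ)
    (c : Fin N) : colE μ hμ c 1 = 1 := by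
  have := hμ.1
  simp [colE]

theorem colE_sum {N : ℕ} (μ : Measure (Matrix (Fin N) (Fin N) ℂ)) (hμ : IsHaarUnitary N μ)
    (c : Fin N) (G : MvPolynomial (Fin N) ℂ) :
    colE μ hμ c ((∑ i, MvPolynomial.X i) * G) = colE μ hμ c G := by
  refine integral_congr_ae ?_
  filter_upwards [haar_ae hμ] with u hu
  have h := congrFun (congrFun (Matrix.mem_unitaryGroup_iff'.1 hu) c) c
  rw [Matrix.mul_apply] at h
  simp only [Matrix.star_apply, Matrix.one_apply_eq] at h
  have h' : ∑ k, u k c * star (u k c) = 1 := by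
    rw [← h]; exact Finset.sum_congr rfl fun k _ => mul_comm _ _
  simp only [map_mul, map_sum, MvPolynomial.eval_X, h', one_mul]

theorem colE_rot {N : ℕ} (μ : Measure (Matrix (Fin N) (Fin N) ℂ)) (hμ : IsHaarUnitary N μ)
    (c : Fin N) (G : MvPolynomial (Fin N) ℂ) (i j : Fin N) (hij : i ≠ j) (ζ : ℂ)
    (hζ : ζ * star ζ = 1) :
    ∫ u, (ζ * (u j c * star (u j c) - u i c * star (u i c)) *
        MvPolynomial.eval (fun k => u k c * star (u k c)) G +
      MvPolynomial.eval (fun k => u k c * star (u k c)) (MvPolynomial.pderiv i G - MvPolynomial.pderiv j G) *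
       (ζ * (u i c * star (u i c)) * (u j c * star (u j c)) +
        star ζ * (u i c * star (u j c)) ^ 2)) ∂μ = 0 := by
  set Y : ℝ → Matrix (Fin N) (Fin N) ℂ → Fin N → ℂ := fun t u k => (rotU i j ζ t * u) k c with hY
  set Y' : ℝ → Matrix (Fin N) (Fin N) ℂ → Fin N → ℂ := fun t u k =>
    (-((Real.sin t : ℝ) : ℂ)) * ((if k = i then u i c else 0) + (if k = j then u j c else 0)) +
      ((Real.cos t : ℝ) : ℂ) * ((if k = i then ζ * u j c else 0) - (if k = j then star ζ * u i c else 0)) with hY'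
  have hd : ∀ t u k, HasDerivAt (fun t => Y t u k) (Y' t u k) t := by
    intro t u k
    simp only [hY, hY', rotU_mul]
    have h1 : HasDerivAt (fun t : ℝ => ((Real.cos t : ℝ) : ℂ)) (-((Real.sin t : ℝ) : ℂ)) t := by
      simpa using (Real.hasDerivAt_cos t).ofReal_comp
    have h2 : HasDerivAt (fun t : ℝ => ((Real.sin t : ℝ) : ℂ)) (((Real.cos t : ℝ) : ℂ)) t :=
      (Real.hasDerivAt_sin t).ofReal_comp
    exact (((h1.sub_const 1).mul_const _).const_add _).add (h2.mul_const _)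
  have hYc : ∀ k, Continuous fun x : ℝ × Matrix (Fin N) (Fin N) ℂ => Y x.1 x.2 k := by
    intro k
    simp only [hY, rotU_mul]
    split_ifs <;> fun_prop
  have hYc' : ∀ k, Continuous fun x : ℝ × Matrix (Fin N) (Fin N) ℂ => Y' x.1 x.2 k := by
    intro k
    simp only [hY']
    split_ifs <;> fun_prop
  have hG : ∀ G : MvPolynomial (Fin N) ℂ, Continuous fun x : ℝ × Matrix (Fin N) (Fin N) ℂ =>
      MvPolynomial.eval (fun k => Y x.1 x.2 k * star (Y x.1 x.2 k)) G := fun G =>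
    (MvPolynomial.continuous_eval G).comp (continuous_pi fun k => (hYc k).mul (hYc k).star)
  have key := deriv_invariant hμ
    (fun t u => Y t u i * star (Y t u j) * MvPolynomial.eval (fun k => Y t u k * star (Y t u k)) G)
    (fun t u => (Y' t u i * star (Y t u j) + Y t u i * star (Y' t u j)) *
      MvPolynomial.eval (fun k => Y t u k * star (Y t u k)) G +
      Y t u i * star (Y t u j) * ∑ k, MvPolynomial.eval (fun k => Y t u k * star (Y t u k))
        (MvPolynomial.pderiv k G) * (Y' t u k * star (Y t u k) + Y t u k * star (Y' t u k)))
    (((hYc i).mul (hYc j).star).mul (hG G))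
    ((((((hYc' i).mul (hYc j).star).add ((hYc i).mul (hYc' j).star))).mul (hG G)).add
      (((hYc i).mul (hYc j).star).mul (continuous_finsetSum _ fun k _ => (hG _).mul
        (((hYc' k).mul (hYc k).star).add ((hYc k).mul (hYc' k).star)))))
    (fun t u => ((hd t u i).fun_mul (hd t u j).star).fun_mul
      (mv_hasDerivAt G (fun t k => Y t u k * star (Y t u k)) _ t
        (fun k => (hd t u k).fun_mul (hd t u k).star)))
    (by
      intro t
      have hcont : Continuous fun u : Matrix (Fin N) (Fin N) ℂ => u i c * star (u j c) *
          MvPolynomial.eval (fun k => u k c * star (u k c)) G :=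
        Continuous.mul (by fun_prop) ((MvPolynomial.continuous_eval G).comp (by fun_prop))
      have h1 := haar_left hμ hcont (rotU_unitary i j hij ζ hζ t)
      have h2 := haar_left hμ hcont (rotU_unitary i j hij ζ hζ 0)
      simp only [hY]
      rw [h1, h2])
  rw [← key]
  refine integral_congr_ae (Eventually.of_forall fun u => ?_)
  have hY0 : ∀ k, Y 0 u k = u k c := by
    intro k
    simp [hY, rotU_mul]
  have hY0' : ∀ k, Y' 0 u k = (if k = i then ζ * u j c else 0) - (if k = j then star ζ * u i c else 0) := by
    intro k
    simp [hY']
  have hYi : Y' 0 u i = ζ * u j c := by simp [hY0', hij]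
  have hYj : Y' 0 u j = -(star ζ * u i c) := by simp [hY0', hij.symm]
  simp only [hY0]
  rw [← Finset.add_sum_erase _ _ (Finset.mem_univ i), ← Finset.add_sum_erase _ _
    (Finset.mem_erase.2 ⟨hij.symm, Finset.mem_univ j⟩), Finset.sum_eq_zero, hYi, hYj]
  · simp only [star_mul', star_neg, star_star, map_sub]
    ring
  · intro k hk
    have h1 := Finset.ne_of_mem_erase hk
    have h2 := Finset.ne_of_mem_erase (Finset.mem_of_mem_erase hk)
    simp [hY0', h1, h2]

theorem colE_ex {N : ℕ} (μ : Measure (Matrix (Fin N) (Fin N) ℂ)) (hμ : IsHaarUnitary N μ)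
    (c : Fin N) (i j : Fin N) (G : MvPolynomial (Fin N) ℂ) :
    colE μ hμ c (MvPolynomial.X j * (G + MvPolynomial.X i * MvPolynomial.pderiv i G)) =
    colE μ hμ c (MvPolynomial.X i * (G + MvPolynomial.X j * MvPolynomial.pderiv j G)) := by
  by_cases hij : i = j
  · rw [hij]
  have h1 := colE_rot μ hμ c G i j hij 1 (by simp)
  have h2 := colE_rot μ hμ c G i j hij Complex.I (by simp)
  rw [← sub_eq_zero, ← map_sub]
  set A : Matrix (Fin N) (Fin N) ℂ → ℂ := fun u => (u j c * star (u j c) - u i c * star (u i c)) *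
        MvPolynomial.eval (fun k => u k c * star (u k c)) G +
      MvPolynomial.eval (fun k => u k c * star (u k c)) (MvPolynomial.pderiv i G - MvPolynomial.pderiv j G) *
       ((u i c * star (u i c)) * (u j c * star (u j c))) with hA
  set B : Matrix (Fin N) (Fin N) ℂ → ℂ := fun u =>
      MvPolynomial.eval (fun k => u k c * star (u k c)) (MvPolynomial.pderiv i G - MvPolynomial.pderiv j G) *
       (u i c * star (u j c)) ^ 2 with hB
  have hev : ∀ G : MvPolynomial (Fin N) ℂ, Continuous fun u : Matrix (Fin N) (Fin N) ℂ =>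
      MvPolynomial.eval (fun k => u k c * star (u k c)) G := fun G =>
    (MvPolynomial.continuous_eval G).comp (by fun_prop)
  have hAi : Integrable A μ := haar_integrable hμ (by
    have := hev G
    have := hev (MvPolynomial.pderiv i G - MvPolynomial.pderiv j G)
    fun_prop)
  have hBi : Integrable B μ := haar_integrable hμ (by
    have := hev (MvPolynomial.pderiv i G - MvPolynomial.pderiv j G)
    fun_prop)
  have h1' : ∫ u, A u ∂μ + ∫ u, B u ∂μ = 0 := by
    rw [← integral_add hAi hBi, ← h1]
    refine integral_congr_ae (Eventually.of_forall fun u => ?_)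
    simp only [hA, hB, star_one]
    ring
  have h2' : Complex.I * (∫ u, A u ∂μ) - Complex.I * ∫ u, B u ∂μ = 0 := by
    rw [← integral_const_mul, ← integral_const_mul, ← integral_sub (hAi.const_mul _) (hBi.const_mul _), ← h2]
    refine integral_congr_ae (Eventually.of_forall fun u => ?_)
    have : star Complex.I = -Complex.I := Complex.conj_I
    simp only [hA, hB, this]
    ring
  have h3 : ∫ u, A u ∂μ = 0 := by
    have : ∫ u, A u ∂μ - ∫ u, B u ∂μ = 0 := by
      have : Complex.I * (∫ u, A u ∂μ - ∫ u, B u ∂μ) = 0 := by rw [mul_sub]; exact h2'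
      exact (mul_eq_zero.1 this).resolve_left Complex.I_ne_zero
    linear_combination (h1' + this) / 2
  rw [← h3]
  refine integral_congr_ae (Eventually.of_forall fun u => ?_)
  simp only [hA, map_sub, map_mul, map_add, MvPolynomial.eval_X]
  ring

theorem col_Jf {N : ℕ} (μ : Measure (Matrix (Fin N) (Fin N) ℂ)) (hμ : IsHaarUnitary N μ)
    (c : Fin N) (a : Fin N → ℂ) (m : ℕ) (κ : Fin m → ℕ) :
    (∏ l ∈ Finset.range m, ((N : ℂ) + l)) *
      ∫ u, Jf m κ (Qp a (fun k => u k c * star (u k c))) ∂μ =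
      (∏ j, ((κ j : ℂ) + 1)) * Jf m (fun j => κ j + 1) (Pa a) := by
  rw [← E_Jf (colE μ hμ c) (colE_one μ hμ c) (colE_sum μ hμ c) (colE_ex μ hμ c)]
  congr 1
  refine integral_congr_ae (Eventually.of_forall fun u => ?_)
  simp only [Jf, RingHom.map_det]
  refine congrArg Matrix.det (Matrix.ext fun i j => ?_)
  simp only [Matrix.of_apply, RingHom.mapMatrix_apply, Matrix.map_apply]
  rw [← Polynomial.coeff_map]
  simp [Qp, Polynomial.map_sum, Polynomial.map_prod]

/-- The leading principal submatrix. -/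
def cmpr {R : Type*} {n : ℕ} (M : Matrix (Fin (n + 1)) (Fin (n + 1)) R) : Matrix (Fin n) (Fin n) R :=
  M.submatrix Fin.castSucc Fin.castSucc

theorem charpoly_cmpr {R : Type*} [CommRing R] {n : ℕ} (M : Matrix (Fin (n + 1)) (Fin (n + 1)) R) :
    (cmpr M).charpoly = (M.charmatrix.adjugate) (Fin.last n) (Fin.last n) := by
  rw [Matrix.adjugate_fin_succ_eq_det_submatrix]
  have h1 : ((-1 : Polynomial R)) ^ (((Fin.last n : Fin (n + 1)) : ℕ) + ((Fin.last n : Fin (n + 1)) : ℕ)) = 1 :=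
    Even.neg_one_pow ⟨_, rfl⟩
  rw [h1, one_mul]
  unfold Matrix.charpoly
  refine congrArg Matrix.det (Matrix.ext fun i j => ?_)
  simp only [cmpr, Matrix.submatrix_apply, Fin.succAbove_last, Matrix.charmatrix_apply,
    Matrix.diagonal_apply, (Fin.castSucc_injective n).eq_iff]

theorem charpoly_cmpr_unitary {n : ℕ} (a : Fin (n + 1) → ℂ) (u : Matrix (Fin (n + 1)) (Fin (n + 1)) ℂ)
    (hu : u ∈ Matrix.unitaryGroup (Fin (n + 1)) ℂ) :
    (cmpr (uᴴ * Matrix.diagonal a * u)).charpoly =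
      Qp a (fun k => u k (Fin.last n) * star (u k (Fin.last n))) := by
  have hu1 : uᴴ * u = 1 := by
    rw [← Matrix.star_eq_conjTranspose]; exact Matrix.mem_unitaryGroup_iff'.1 hu
  have hu2 : u * uᴴ = 1 := by
    rw [← Matrix.star_eq_conjTranspose]; exact Matrix.mem_unitaryGroup_iff.1 hu
  rw [charpoly_cmpr]
  set U : Matrix (Fin (n + 1)) (Fin (n + 1)) (Polynomial ℂ) := u.map Polynomial.C with hU
  set V : Matrix (Fin (n + 1)) (Fin (n + 1)) (Polynomial ℂ) := (uᴴ).map Polynomial.C with hV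
  have hVU : V * U = 1 := by
    rw [hU, hV, ← Matrix.map_mul, hu1]; simp
  have hUV : U * V = 1 := by
    rw [hU, hV, ← Matrix.map_mul, hu2]; simp
  have hcm : (uᴴ * Matrix.diagonal a * u).charmatrix =
      V * Matrix.diagonal (fun k => Polynomial.X - Polynomial.C (a k)) * U := by
    have e1 : Matrix.diagonal (fun k => Polynomial.X - Polynomial.C (a k)) =
        Matrix.scalar (Fin (n + 1)) (Polynomial.X : Polynomial ℂ) -
        (Matrix.diagonal a).map Polynomial.C := by
      ext i j
      by_cases h : i = j
      · subst h; simp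
      · simp [h]
    rw [e1, Matrix.mul_sub, Matrix.sub_mul, Matrix.charmatrix, map_mul, map_mul]
    congr 1
    rw [← (Matrix.scalar_commute (Polynomial.X : Polynomial ℂ) (fun r => Commute.all _ _) V).eq,
      Matrix.mul_assoc, hVU, Matrix.mul_one]
  have hadjU : U.adjugate = U.det • V := by
    have := congrArg (fun M => M * V) (Matrix.adjugate_mul U)
    simpa [Matrix.mul_assoc, hUV] using this
  have hadjV : V.adjugate = V.det • U := by
    have := congrArg (fun M => M * U) (Matrix.adjugate_mul V)
    simpa [Matrix.mul_assoc, hVU] using this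
  have hdet : U.det * V.det = 1 := by rw [← Matrix.det_mul, hUV, Matrix.det_one]
  rw [hcm, Matrix.adjugate_mul_distrib, Matrix.adjugate_mul_distrib, hadjU, hadjV,
    Matrix.adjugate_diagonal, Matrix.smul_mul, Matrix.mul_smul, Matrix.mul_smul, smul_smul, hdet, one_smul,
    ← Matrix.mul_assoc, Matrix.mul_apply]
  simp only [Matrix.mul_diagonal, Qp]
  refine Finset.sum_congr rfl fun i _ => ?_
  rw [hU, hV]
  simp only [Matrix.map_apply, Matrix.conjTranspose_apply, Polynomial.C_mul]
  ring

theorem charpoly_coeff_continuous (n k : ℕ) :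
    Continuous fun A : Matrix (Fin n) (Fin n) ℂ => A.charpoly.coeff k := by
  by_cases hk : k < n + 1
  · obtain ⟨w, hw⟩ := coeff_eval (n + 1)
    have : (fun A : Matrix (Fin n) (Fin n) ℂ => A.charpoly.coeff k) = fun A =>
        ∑ s, w ⟨k, hk⟩ s * (Matrix.scalar (Fin n) ((s : ℕ) : ℂ) - A).det := by
      funext A
      have h := hw ℂ A.charpoly (by rw [Matrix.charpoly_natDegree_eq_dim]; simp) ⟨k, hk⟩
      simp only [Algebra.algebraMap_self, RingHom.id_apply] at h
      rw [h]
      refine Finset.sum_congr rfl fun s _ => ?_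
      rw [Matrix.eval_charpoly]
    rw [this]
    fun_prop
  · have : (fun A : Matrix (Fin n) (Fin n) ℂ => A.charpoly.coeff k) = fun A => 0 := by
      funext A
      refine Polynomial.coeff_eq_zero_of_natDegree_lt ?_
      rw [Matrix.charpoly_natDegree_eq_dim]; simp; omega
    rw [this]; exact continuous_const

theorem Jf_continuous {n : ℕ} (m : ℕ) (κ : Fin m → ℕ) :
    Continuous fun A : Matrix (Fin n) (Fin n) ℂ => Jf m κ A.charpoly := by
  unfold Jf
  refine Continuous.matrix_det ?_
  refine continuous_matrix fun i j => ?_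
  simp only [Matrix.of_apply, Polynomial.coeff_X_pow_mul']
  split_ifs
  · exact charpoly_coeff_continuous n _
  · exact continuous_const

theorem Jf_comp_continuous {n m : ℕ} (κ : Fin m → ℕ) {X : Type*} [TopologicalSpace X]
    {g : X → Matrix (Fin n) (Fin n) ℂ} (hg : Continuous g) :
    Continuous fun x => Jf m κ (g x).charpoly := (Jf_continuous m κ).comp hg

theorem cmpr_continuous {n : ℕ} : Continuous (cmpr : Matrix (Fin (n+1)) (Fin (n+1)) ℂ → _) := by
  unfold cmpr; fun_prop

theorem KL {n : ℕ} {μ : Measure (Matrix (Fin (n + 1)) (Fin (n + 1)) ℂ)} (hμ : IsHaarUnitary (n + 1) μ)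
    (H : Matrix (Fin (n + 1)) (Fin (n + 1)) ℂ) (hH : H.IsHermitian) (m : ℕ) (κ : Fin m → ℕ) :
    (∏ l ∈ Finset.range m, (((n + 1 : ℕ) : ℂ) + l)) *
      ∫ u, Jf m κ (cmpr (u * H * uᴴ)).charpoly ∂μ =
      (∏ j, ((κ j : ℂ) + 1)) * Jf m (fun j => κ j + 1) H.charpoly := by
  have hsp := hH.spectral_theorem
  set V := hH.eigenvectorUnitary
  set D : Fin (n + 1) → ℂ := RCLike.ofReal ∘ hH.eigenvalues with hD
  rw [Unitary.conjStarAlgAut_apply] at hsp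
  have hcp : H.charpoly = Pa D := by
    rw [hH.charpoly_eq]; rfl
  have hcont : Continuous fun u : Matrix (Fin (n + 1)) (Fin (n + 1)) ℂ =>
      Jf m κ (cmpr (u * Matrix.diagonal D * uᴴ)).charpoly :=
    Jf_comp_continuous κ (cmpr_continuous.comp (by fun_prop))
  have h1 : ∫ u, Jf m κ (cmpr (u * H * uᴴ)).charpoly ∂μ =
      ∫ u, Jf m κ (cmpr (u * Matrix.diagonal D * uᴴ)).charpoly ∂μ := by
    rw [← haar_right hμ hcont V.2]
    refine integral_congr_ae (Eventually.of_forall fun u => ?_)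
    simp only
    conv_lhs => rw [hsp]
    simp only [Matrix.conjTranspose_mul, Matrix.mul_assoc, Matrix.star_eq_conjTranspose]
  have h2 : ∫ u, Jf m κ (cmpr (u * Matrix.diagonal D * uᴴ)).charpoly ∂μ =
      ∫ u, Jf m κ (Qp D (fun k => u k (Fin.last n) * star (u k (Fin.last n)))) ∂μ := by
    rw [← haar_star hμ hcont]
    refine integral_congr_ae ?_
    filter_upwards [haar_ae hμ] with u hu
    rw [Matrix.conjTranspose_conjTranspose, charpoly_cmpr_unitary D u hu]
  rw [h1, h2, hcp]
  exact col_Jf μ hμ (Fin.last n) D m κ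

theorem cont_conj {n : ℕ} (X : Matrix (Fin n) (Fin n) ℂ) :
    Continuous fun k : Matrix (Fin n) (Fin n) ℂ => k * X * kᴴ :=
  (continuous_id.matrix_mul continuous_const).matrix_mul continuous_id.matrix_conjTranspose

theorem cont_conj2 {n : ℕ} {Y : Type*} [TopologicalSpace Y] {f g : Y → Matrix (Fin n) (Fin n) ℂ}
    (hf : Continuous f) (hg : Continuous g) : Continuous fun y => f y * g y * (f y)ᴴ :=
  (hf.matrix_mul hg).matrix_mul hf.matrix_conjTranspose

theorem Jf_cmpr_continuous {n m : ℕ} (κ : Fin m → ℕ) {X : Type*} [TopologicalSpace X]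
    (g : X → Matrix (Fin (n + 1)) (Fin (n + 1)) ℂ) (hg : Continuous g) :
    Continuous fun x => Jf m κ (cmpr (g x)).charpoly :=
  Jf_comp_continuous κ (g := fun x => cmpr (g x)) (cmpr_continuous.comp hg)

theorem cmpr_mul_left {n : ℕ} (T M : Matrix (Fin (n + 1)) (Fin (n + 1)) ℂ)
    (hT : ∀ i : Fin n, T (Fin.castSucc i) (Fin.last n) = 0) :
    cmpr (T * M * Tᴴ) = cmpr T * cmpr M * (cmpr T)ᴴ := by
  ext i j
  simp only [cmpr, Matrix.submatrix_apply, Matrix.mul_apply, Fin.sum_univ_castSucc,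
    Matrix.conjTranspose_apply, hT, star_zero, mul_zero, zero_mul, add_zero]

/-- embedding `h ↦ h ⊕ 1`. -/
def hat {n : ℕ} (h : Matrix (Fin n) (Fin n) ℂ) : Matrix (Fin (n + 1)) (Fin (n + 1)) ℂ :=
  Matrix.of (Fin.lastCases (Fin.lastCases 1 (fun _ => 0))
    (fun i => Fin.lastCases 0 (fun j => h i j)))

theorem hat_cc {n : ℕ} (h : Matrix (Fin n) (Fin n) ℂ) (i j : Fin n) :
    hat h (Fin.castSucc i) (Fin.castSucc j) = h i j := by simp [hat]
theorem hat_cl {n : ℕ} (h : Matrix (Fin n) (Fin n) ℂ) (i : Fin n) :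
    hat h (Fin.castSucc i) (Fin.last n) = 0 := by simp [hat]
theorem hat_lc {n : ℕ} (h : Matrix (Fin n) (Fin n) ℂ) (i : Fin n) :
    hat h (Fin.last n) (Fin.castSucc i) = 0 := by simp [hat]
theorem hat_ll {n : ℕ} (h : Matrix (Fin n) (Fin n) ℂ) :
    hat h (Fin.last n) (Fin.last n) = 1 := by simp [hat]

theorem cmpr_hat {n : ℕ} (h : Matrix (Fin n) (Fin n) ℂ) : cmpr (hat h) = h := by
  ext i j; simp [cmpr, hat_cc]

theorem hat_unitary {n : ℕ} (h : Matrix (Fin n) (Fin n) ℂ) (hh : h ∈ Matrix.unitaryGroup (Fin n) ℂ) :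
    hat h ∈ Matrix.unitaryGroup (Fin (n + 1)) ℂ := by
  rw [Matrix.mem_unitaryGroup_iff, Matrix.star_eq_conjTranspose] at hh ⊢
  ext i j
  have := fun i j => congrFun (congrFun hh i) j
  simp only [Matrix.mul_apply, Matrix.conjTranspose_apply] at this
  rw [Matrix.mul_apply, Fin.sum_univ_castSucc]
  simp only [Matrix.conjTranspose_apply]
  refine Fin.lastCases ?_ (fun i => ?_) i <;> refine Fin.lastCases ?_ (fun j => ?_) j
  · simp [hat_lc, hat_ll]
  · simp [hat_lc, hat_cl, Matrix.one_apply, (Fin.castSucc_lt_last j).ne']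
  · simp [hat_lc, hat_cl, Matrix.one_apply, (Fin.castSucc_lt_last i).ne]
  · simp only [hat_cc, hat_cl, this, Matrix.one_apply, (Fin.castSucc_injective n).eq_iff]; simp

theorem exists_lower {n : ℕ} (C : Matrix (Fin (n + 1)) (Fin (n + 1)) ℂ) :
    ∃ T w : Matrix (Fin (n + 1)) (Fin (n + 1)) ℂ, w ∈ Matrix.unitaryGroup (Fin (n + 1)) ℂ ∧
      C = T * w ∧ ∀ i : Fin n, T (Fin.castSucc i) (Fin.last n) = 0 := by
  -- zero last row
  set C0 : Matrix (Fin (n + 1)) (Fin (n + 1)) ℂ := Matrix.updateRow C (Fin.last n) 0 with hC0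
  have hdet : C0.det = 0 := Matrix.det_eq_zero_of_row_eq_zero (Fin.last n) (by intro j; simp [hC0])
  obtain ⟨v, hv0, hv⟩ := Matrix.exists_mulVec_eq_zero_iff.2 hdet
  set v' : EuclideanSpace ℂ (Fin (n + 1)) := WithLp.toLp 2 v
  have hv' : v' ≠ 0 := by
    intro h; apply hv0
    have := congrArg WithLp.ofLp h
    simpa [v'] using this
  set x : EuclideanSpace ℂ (Fin (n + 1)) := ((‖v'‖ : ℂ)⁻¹) • v' with hx
  have hxn : ‖x‖ = 1 := by
    rw [hx, norm_smul]; simp [hv']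
  have hfin : Module.finrank ℂ (EuclideanSpace ℂ (Fin (n + 1))) = Fintype.card (Fin (n + 1)) := by simp
  obtain ⟨b, hb⟩ := Orthonormal.exists_orthonormalBasis_extension_of_card_eq (𝕜 := ℂ) hfin
    (v := fun _ : Fin (n + 1) => x) (s := {Fin.last n}) (by
      rw [orthonormal_iff_ite]
      rintro ⟨i, hi⟩ ⟨j, hj⟩
      simp only [Set.mem_singleton_iff] at hi hj
      subst hi; subst hj
      simp [inner_self_eq_norm_sq_to_K, hxn])
  have hbl : b (Fin.last n) = x := hb _ rfl
  set W : Matrix (Fin (n + 1)) (Fin (n + 1)) ℂ := Matrix.of fun i j => (b j).ofLp i with hW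
  have hWU : Wᴴ * W = 1 := by
    ext i j
    have := orthonormal_iff_ite.1 b.orthonormal i j
    rw [EuclideanSpace.inner_eq_star_dotProduct] at this
    simp only [Matrix.mul_apply, Matrix.conjTranspose_apply, hW, Matrix.of_apply, Matrix.one_apply]
    rw [← this]
    simp [dotProduct, mul_comm]
  have hWU2 : W * Wᴴ = 1 := mul_eq_one_comm.1 hWU
  refine ⟨C * W, Wᴴ, ?_, ?_, ?_⟩
  · rw [Matrix.mem_unitaryGroup_iff, Matrix.star_eq_conjTranspose, Matrix.conjTranspose_conjTranspose]
    exact hWU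
  · rw [Matrix.mul_assoc, hWU2, Matrix.mul_one]
  · intro i
    have h1 := congrFun hv (Fin.castSucc i)
    simp only [Matrix.mulVec, dotProduct, Pi.zero_apply] at h1
    rw [Matrix.mul_apply]
    simp only [hW, Matrix.of_apply, hbl, hx]
    have : ∀ j, C0 (Fin.castSucc i) j = C (Fin.castSucc i) j := by
      intro j; simp [hC0, Matrix.updateRow_apply, (Fin.castSucc_lt_last i).ne]
    simp only [this] at h1
    simp only [PiLp.smul_apply, v', smul_eq_mul]
    rw [← mul_zero ((‖v'‖ : ℂ)⁻¹), ← h1, Finset.mul_sum]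
    refine Finset.sum_congr rfl fun j _ => ?_
    ring

theorem Jf_zero_col (m : ℕ) (κ : Fin (m + 1) → ℕ) (j : Fin (m + 1)) (hj : κ j = 0) :
    ∃ (c : ℂ) (κ' : Fin m → ℕ), ∀ χ : Polynomial ℂ, Jf (m + 1) κ χ = c * χ.coeff 0 * Jf m κ' χ := by
  have key : ∀ χ : Polynomial ℂ, Jf (m + 1) κ χ = (-1) ^ (j : ℕ) * χ.coeff 0 *
      det (of fun (i l : Fin m) => (Polynomial.X ^ ((i : ℕ) + 1) * χ).coeff (κ (j.succAbove l))) := by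
    intro χ
    unfold Jf
    rw [Matrix.det_succ_column _ j, Fin.sum_univ_succ, Finset.sum_eq_zero, add_zero]
    · simp only [Matrix.of_apply, hj, Fin.val_zero, zero_add, pow_zero, one_mul]
      congr 1
    · intro i _
      have : (Polynomial.X ^ ((i : ℕ) + 1) * χ).coeff 0 = 0 := by
        rw [Polynomial.coeff_X_pow_mul']; simp
      simp [hj, this]
  by_cases h : ∀ l, 1 ≤ κ (j.succAbove l)
  · refine ⟨(-1) ^ (j : ℕ), fun l => κ (j.succAbove l) - 1, fun χ => ?_⟩
    rw [key]
    congr 1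
    refine congrArg Matrix.det (Matrix.ext fun i l => ?_)
    simp only [Matrix.of_apply]
    obtain ⟨q, hq⟩ := Nat.exists_eq_add_of_le (h l)
    rw [hq, pow_succ', mul_assoc, add_comm 1 q, Polynomial.coeff_X_mul]; simp
  · push Not at h
    obtain ⟨l, hl⟩ := h
    refine ⟨0, fun _ => 0, fun χ => ?_⟩
    rw [key, Matrix.det_eq_zero_of_column_eq_zero l]
    · simp
    · intro i
      have : κ (j.succAbove l) = 0 := by omega
      simp only [Matrix.of_apply, this, Polynomial.coeff_X_pow_mul']; simp

theorem charpoly_coeff_zero {n : ℕ} (A : Matrix (Fin n) (Fin n) ℂ) :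
    A.charpoly.coeff 0 = (-1) ^ n * A.det := by
  rw [Matrix.det_eq_sign_charpoly_coeff, Fintype.card_fin, ← mul_assoc, ← mul_pow]; simp

/-- The product formula at size `n`. -/
def PFat (n m : ℕ) (κ : Fin m → ℕ) : Prop :=
  ∀ (X B : Matrix (Fin n) (Fin n) ℂ) (_ : X.IsHermitian) (μ : Measure (Matrix (Fin n) (Fin n) ℂ))
    (_ : IsHaarUnitary n μ),
    Jf m κ (1 : Matrix (Fin n) (Fin n) ℂ).charpoly *
      ∫ k, Jf m κ (k * X * kᴴ * (Bᴴ * B)).charpoly ∂μ =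
      Jf m κ X.charpoly * Jf m κ (Bᴴ * B).charpoly

theorem inner_lemma {n m : ℕ} (κ : Fin m → ℕ) (IH : PFat n m κ)
    (C X : Matrix (Fin (n + 1)) (Fin (n + 1)) ℂ) (hX : X.IsHermitian)
    (μ : Measure (Matrix (Fin (n + 1)) (Fin (n + 1)) ℂ)) (hμ : IsHaarUnitary (n + 1) μ) :
    Jf m κ (1 : Matrix (Fin n) (Fin n) ℂ).charpoly *
      ∫ k, Jf m κ (cmpr (C * (k * X * kᴴ) * Cᴴ)).charpoly ∂μ =
      (∫ k, Jf m κ (cmpr (k * X * kᴴ)).charpoly ∂μ) * Jf m κ (cmpr (C * Cᴴ)).charpoly := by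
  haveI := hμ.1
  obtain ⟨T, w, hw, rfl, hT⟩ := exists_lower C
  obtain ⟨ν, hν⟩ := haar_exists n
  haveI := hν.1
  have hww : w * wᴴ = 1 := by
    rw [← Matrix.star_eq_conjTranspose]; exact Matrix.mem_unitaryGroup_iff.1 hw
  set S := cmpr T with hS
  have hc1 : Continuous fun k : Matrix (Fin (n + 1)) (Fin (n + 1)) ℂ =>
      Jf m κ (cmpr (T * (k * X * kᴴ) * Tᴴ)).charpoly :=
    Jf_cmpr_continuous κ (fun k => T * (k * X * kᴴ) * Tᴴ) (cont_conj2 continuous_const (cont_conj X))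
  have h1 : ∫ k, Jf m κ (cmpr (T * w * (k * X * kᴴ) * (T * w)ᴴ)).charpoly ∂μ =
      ∫ k, Jf m κ (cmpr (T * (k * X * kᴴ) * Tᴴ)).charpoly ∂μ := by
    rw [← haar_left hμ hc1 hw]
    refine integral_congr_ae (Eventually.of_forall fun u => ?_)
    simp only [Matrix.conjTranspose_mul, Matrix.mul_assoc]
  have h2 : ∀ h ∈ Matrix.unitaryGroup (Fin n) ℂ,
      ∫ k, Jf m κ (h * cmpr (k * X * kᴴ) * hᴴ * (Sᴴ * S)).charpoly ∂μ =
      ∫ k, Jf m κ (cmpr (T * (k * X * kᴴ) * Tᴴ)).charpoly ∂μ := by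
    intro h hh
    rw [← haar_left hμ hc1 (hat_unitary h hh)]
    refine integral_congr_ae (Eventually.of_forall fun k => ?_)
    simp only
    have e1 : hat h * k * X * (hat h * k)ᴴ = hat h * (k * X * kᴴ) * (hat h)ᴴ := by
      simp only [Matrix.conjTranspose_mul, Matrix.mul_assoc]
    rw [e1, cmpr_mul_left T _ hT, cmpr_mul_left (hat h) _ (hat_cl h), cmpr_hat,
      ← Matrix.mul_assoc _ Sᴴ S, Matrix.charpoly_mul_comm, ← hS]
    simp only [Matrix.mul_assoc]
  have h3 : ∫ k, Jf m κ (cmpr (T * (k * X * kᴴ) * Tᴴ)).charpoly ∂μ =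
      ∫ h, ∫ k, Jf m κ (h * cmpr (k * X * kᴴ) * hᴴ * (Sᴴ * S)).charpoly ∂μ ∂ν := by
    symm
    rw [integral_congr_ae (μ := ν) (g := fun _ => ∫ k, Jf m κ (cmpr (T * (k * X * kᴴ) * Tᴴ)).charpoly ∂μ)]
    · simp
    · filter_upwards [haar_ae hν] with h hh using h2 h hh
  have hcm : ∀ k : Matrix (Fin (n + 1)) (Fin (n + 1)) ℂ, (cmpr (k * X * kᴴ)).IsHermitian := by
    intro k
    have : (k * X * kᴴ).IsHermitian := Matrix.isHermitian_mul_mul_conjTranspose k hX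
    exact this.submatrix _
  rw [h1, h3, integral_integral_swap]
  · rw [← integral_const_mul, ← integral_mul_const]
    refine integral_congr_ae (Eventually.of_forall fun k => ?_)
    simp only
    rw [IH _ S (hcm k) ν hν, Matrix.charpoly_mul_comm]
    congr 2
    have e2 : T * w * (T * w)ᴴ = T * 1 * Tᴴ := by
      rw [Matrix.conjTranspose_mul, ← Matrix.mul_assoc, Matrix.mul_assoc T w, hww]
    rw [e2, cmpr_mul_left T 1 hT]
    have : cmpr (1 : Matrix (Fin (n + 1)) (Fin (n + 1)) ℂ) = 1 :=
      Matrix.submatrix_one _ (Fin.castSucc_injective n)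
    rw [this, Matrix.mul_one]
  · refine haar_prod_integrable hν hμ ?_
    have h0 : Continuous fun k : Matrix (Fin (n + 1)) (Fin (n + 1)) ℂ => k * X * kᴴ := cont_conj X
    have h1 : Continuous fun p : Matrix (Fin n) (Fin n) ℂ × Matrix (Fin (n + 1)) (Fin (n + 1)) ℂ =>
      cmpr (p.2 * X * p.2ᴴ) := cmpr_continuous.comp (h0.comp continuous_snd)
    exact Jf_comp_continuous κ (g := fun p : Matrix (Fin n) (Fin n) ℂ ×
      Matrix (Fin (n + 1)) (Fin (n + 1)) ℂ => p.1 * cmpr (p.2 * X * p.2ᴴ) * p.1ᴴ * (Sᴴ * S))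
      ((cont_conj2 continuous_fst h1).matrix_mul continuous_const)

set_option maxHeartbeats 400000 in
theorem PF (n : ℕ) : ∀ (m : ℕ) (κ : Fin m → ℕ), PFat n m κ := by
  induction n with
  | zero =>
    intro m κ X B hX μ hμ
    haveI := hμ.1
    have : ∀ A : Matrix (Fin 0) (Fin 0) ℂ, A = 1 := fun A => Subsingleton.elim _ _
    have e : ∀ k : Matrix (Fin 0) (Fin 0) ℂ, k * X * kᴴ * (Bᴴ * B) = 1 := fun k => this _
    simp only [e]
    rw [this X, this (Bᴴ * B)]; simp
  | succ n IHn =>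
    intro m
    induction m with
    | zero =>
      intro κ X B hX μ hμ
      haveI := hμ.1
      simp [Jf]
    | succ m IHm =>
      intro κ X B hX μ hμ
      haveI := hμ.1
      by_cases hκ : ∃ j, κ j = 0
      · obtain ⟨j, hj⟩ := hκ
        obtain ⟨c, κ', h⟩ := Jf_zero_col m κ j hj
        simp only [h, charpoly_coeff_zero]
        have e : ∫ k, c * ((-1) ^ (n + 1) * (k * X * kᴴ * (Bᴴ * B)).det) *
            Jf m κ' (k * X * kᴴ * (Bᴴ * B)).charpoly ∂μ =
            c * ((-1) ^ (n + 1) * (X.det * (Bᴴ * B).det)) *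
            ∫ k, Jf m κ' (k * X * kᴴ * (Bᴴ * B)).charpoly ∂μ := by
          rw [← integral_const_mul]
          refine integral_congr_ae ?_
          filter_upwards [haar_ae hμ] with k hk
          have hkk : k.det * (kᴴ).det = 1 := by
            rw [← Matrix.det_mul, ← Matrix.star_eq_conjTranspose, Matrix.mem_unitaryGroup_iff.1 hk,
              Matrix.det_one]
          have : (k * X * kᴴ * (Bᴴ * B)).det = X.det * (Bᴴ * B).det := by
            rw [Matrix.det_mul (k * X * kᴴ), Matrix.det_mul (k * X), Matrix.det_mul k]
            linear_combination X.det * (Bᴴ * B).det * hkk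
          rw [this]
        rw [e]
        have := IHm κ' X B hX μ hμ
        rw [Matrix.det_one]
        linear_combination (c * ((-1) ^ (n + 1) * 1)) * (c * ((-1) ^ (n + 1) * (X.det * (Bᴴ * B).det))) * this
      · push Not at hκ
        obtain ⟨κ', hκ'⟩ : ∃ κ' : Fin (m + 1) → ℕ, κ = fun j => κ' j + 1 :=
          ⟨fun j => κ j - 1, funext fun j => by have := hκ j; show κ j = κ j - 1 + 1; omega⟩
        have hKL := fun H hH => KL hμ H hH (m + 1) κ'
        rw [← hκ'] at hKL
        set c1 := ∏ l ∈ Finset.range (m + 1), (((n + 1 : ℕ) : ℂ) + l)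
        set c2 := ∏ j, ((κ' j : ℂ) + 1) with hc2
        have hc2ne : c2 ≠ 0 := Finset.prod_ne_zero_iff.2 fun j _ => by
          exact Nat.cast_add_one_ne_zero _
        have h1 : c1 * Jf (m + 1) κ' (1 : Matrix (Fin n) (Fin n) ℂ).charpoly =
            c2 * Jf (m + 1) κ (1 : Matrix (Fin (n + 1)) (Fin (n + 1)) ℂ).charpoly := by
          rw [← hKL 1 Matrix.isHermitian_one]
          congr 1
          rw [integral_congr_ae (g := fun _ => Jf (m + 1) κ' (1 : Matrix (Fin n) (Fin n) ℂ).charpoly)]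
          · simp
          · filter_upwards [haar_ae hμ] with u hu
            have : u * 1 * uᴴ = 1 := by
              rw [Matrix.mul_one, ← Matrix.star_eq_conjTranspose]; exact Matrix.mem_unitaryGroup_iff.1 hu
            rw [this]
            have : cmpr (1 : Matrix (Fin (n + 1)) (Fin (n + 1)) ℂ) = 1 :=
              Matrix.submatrix_one _ (Fin.castSucc_injective n)
            rw [this]
        have h2 : c2 * ∫ k, Jf (m + 1) κ (k * X * kᴴ * (Bᴴ * B)).charpoly ∂μ =
            c1 * ∫ u, ∫ k, Jf (m + 1) κ' (cmpr (u * B * (k * X * kᴴ) * (u * B)ᴴ)).charpoly ∂μ ∂μ := by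
          rw [integral_integral_swap]
          · rw [← integral_const_mul, ← integral_const_mul]
            refine integral_congr_ae (Eventually.of_forall fun k => ?_)
            simp only
            have e1 : (k * X * kᴴ * (Bᴴ * B)).charpoly = (B * (k * X * kᴴ) * Bᴴ).charpoly := by
              rw [← Matrix.mul_assoc, Matrix.charpoly_mul_comm]; simp only [Matrix.mul_assoc]
            rw [e1, ← hKL _ (Matrix.isHermitian_mul_mul_conjTranspose B
              (Matrix.isHermitian_mul_mul_conjTranspose k hX))]
            refine congrArg (fun z => c1 * z) ?_
            refine integral_congr_ae (Eventually.of_forall fun u => ?_)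
            simp only [Matrix.conjTranspose_mul, Matrix.mul_assoc]
          · refine haar_prod_integrable hμ hμ ?_
            exact Jf_cmpr_continuous κ' (fun p : Matrix (Fin (n + 1)) (Fin (n + 1)) ℂ ×
              Matrix (Fin (n + 1)) (Fin (n + 1)) ℂ => p.1 * B * (p.2 * X * p.2ᴴ) * (p.1 * B)ᴴ)
              (cont_conj2 (continuous_fst.matrix_mul continuous_const) ((cont_conj X).comp continuous_snd))
        have h3 : Jf (m + 1) κ' (1 : Matrix (Fin n) (Fin n) ℂ).charpoly *
            ∫ u, ∫ k, Jf (m + 1) κ' (cmpr (u * B * (k * X * kᴴ) * (u * B)ᴴ)).charpoly ∂μ ∂μ =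
            (∫ k, Jf (m + 1) κ' (cmpr (k * X * kᴴ)).charpoly ∂μ) *
            ∫ u, Jf (m + 1) κ' (cmpr (u * (B * Bᴴ) * uᴴ)).charpoly ∂μ := by
          rw [← integral_const_mul, ← integral_const_mul]
          refine integral_congr_ae (Eventually.of_forall fun u => ?_)
          simp only
          rw [inner_lemma κ' (IHn (m + 1) κ') (u * B) X hX μ hμ]
          simp only [Matrix.conjTranspose_mul, Matrix.mul_assoc]
        have h4 := hKL X hX
        have h5 := hKL (B * Bᴴ) (Matrix.isHermitian_mul_conjTranspose_self B)
        rw [Matrix.charpoly_mul_comm B] at h5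
        refine mul_left_cancel₀ hc2ne (mul_left_cancel₀ hc2ne ?_)
        set I2 := ∫ u, ∫ k, Jf (m + 1) κ' (cmpr (u * B * (k * X * kᴴ) * (u * B)ᴴ)).charpoly ∂μ ∂μ
        set I1 := ∫ k, Jf (m + 1) κ (k * X * kᴴ * (Bᴴ * B)).charpoly ∂μ
        set I3 := ∫ k, Jf (m + 1) κ' (cmpr (k * X * kᴴ)).charpoly ∂μ
        set I4 := ∫ u, Jf (m + 1) κ' (cmpr (u * (B * Bᴴ) * uᴴ)).charpoly ∂μ
        set j1 := Jf (m + 1) κ' (1 : Matrix (Fin n) (Fin n) ℂ).charpoly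
        set j2 := Jf (m + 1) κ (1 : Matrix (Fin (n + 1)) (Fin (n + 1)) ℂ).charpoly
        set x1 := Jf (m + 1) κ X.charpoly
        set x2 := Jf (m + 1) κ (Bᴴ * B).charpoly
        calc c2 * (c2 * (j2 * I1)) = (c2 * j2) * (c2 * I1) := by ring
          _ = (c1 * j1) * (c1 * I2) := by rw [h1, h2]
          _ = c1 * c1 * (j1 * I2) := by ring
          _ = (c1 * I3) * (c1 * I4) := by rw [h3]; ring
          _ = c2 * (c2 * (x1 * x2)) := by rw [h4, h5]; ring

theorem Jf_map {R S : Type*} [CommRing R] [CommRing S] (f : R →+* S) (m : ℕ) (κ : Fin m → ℕ)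
    (χ : Polynomial R) : Jf m κ (χ.map f) = f (Jf m κ χ) := by
  simp only [Jf, RingHom.map_det]
  refine congrArg Matrix.det (Matrix.ext fun i j => ?_)
  simp only [Matrix.of_apply, RingHom.mapMatrix_apply, Matrix.map_apply]
  rw [← Polynomial.coeff_map]
  simp

theorem Pa_map {R S : Type*} [CommRing R] [CommRing S] (f : R →+* S) {n : ℕ} (a : Fin n → R) :
    (Pa a).map f = Pa (fun i => f (a i)) := by
  simp [Pa, Polynomial.map_prod]

theorem Pa_eq_charpoly {n : ℕ} (a : Fin n → ℂ) : Pa a = (Matrix.diagonal a).charpoly := by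
  rw [Matrix.charpoly_diagonal]; rfl

theorem Jf_Pa_ofReal {n : ℕ} (m : ℕ) (κ : Fin m → ℕ) (t : Fin n → ℝ) :
    Jf m κ (Pa (fun i => ((t i : ℝ) : ℂ))) = ((Jf m κ (Pa t) : ℝ) : ℂ) := by
  have := Jf_map Complex.ofRealHom m κ (Pa t)
  rw [Pa_map] at this
  exact this

theorem Jf_Pa_continuous {n : ℕ} (m : ℕ) (κ : Fin m → ℕ) :
    Continuous fun t : Fin n → ℝ => Jf m κ (Pa t) := by
  have h : (fun t : Fin n → ℝ => Jf m κ (Pa t)) = fun t : Fin n → ℝ =>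
      (Jf m κ (Matrix.diagonal (fun i => ((t i : ℝ) : ℂ))).charpoly).re := by
    funext t
    rw [← Pa_eq_charpoly, Jf_Pa_ofReal, Complex.ofReal_re]
  rw [h]
  refine Complex.continuous_re.comp (Jf_comp_continuous κ ?_)
  exact Continuous.matrix_diagonal (by fun_prop)

theorem vdet_prod {R : Type*} [CommRing R] {m : ℕ} (z : Fin m → R) :
    vdet z = ∏ i : Fin m, ∏ j ∈ Finset.Ioi i, (z j - z i) := by
  rw [vdet_eq, Matrix.det_vandermonde]

theorem slope_pow (s t : ℕ) : Tendsto (fun q : ℝ => (q ^ s - q ^ t) / (q - 1))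
    (nhdsWithin 1 {1}ᶜ) (nhds ((s : ℝ) - t)) := by
  have h : HasDerivAt (fun q : ℝ => q ^ s - q ^ t) ((s : ℝ) - t) 1 := by
    have := (hasDerivAt_pow s (1 : ℝ)).sub (hasDerivAt_pow t (1 : ℝ))
    simp only [one_pow, mul_one] at this
    exact this
  rw [hasDerivAt_iff_tendsto_slope] at h
  refine h.congr fun q => ?_
  simp [slope_def_field]

theorem vdet_pow_tendsto {n : ℕ} (ℓ : Fin n → ℕ) :
    Tendsto (fun q : ℝ => vdet (fun i => q ^ ℓ i) / ∏ i : Fin n, ∏ j ∈ Finset.Ioi i, (q - 1))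
      (nhdsWithin 1 {1}ᶜ) (nhds (vdet (fun i => (ℓ i : ℝ)))) := by
  simp only [vdet_prod, ← Finset.prod_div_distrib]
  exact tendsto_finset_prod _ fun i _ => tendsto_finset_prod _ fun j _ => slope_pow _ _

theorem vdet_id (n : ℕ) : vdet (fun i : Fin n => ((i : ℕ) : ℝ)) =
    ∏ j ∈ Finset.range n, (Nat.factorial j : ℝ) := by
  cases n with
  | zero => simp [vdet]
  | succ n =>
    rw [vdet_eq, Matrix.det_vandermonde_id_eq_superFactorial, ← Nat.prod_range_succ_factorial]
    push_cast
    rfl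

theorem Jf_one {n m : ℕ} (κ : Fin m → ℕ) (ε : ℤˣ) (ℓ : Fin n → ℕ)
    (h : ∀ a : Fin n → ℝ, vdet a * Jf m κ (Pa a) =
      ((ε : ℤ) : ℝ) * Matrix.det (Matrix.of fun i c => a c ^ ℓ i)) :
    (∏ j ∈ Finset.range n, (Nat.factorial j : ℝ)) * Jf m κ (Pa (fun _ : Fin n => (1 : ℝ))) =
      ((ε : ℤ) : ℝ) * vdet (fun i => (ℓ i : ℝ)) := by
  have h1 : ∀ q : ℝ, vdet (fun i : Fin n => q ^ (i : ℕ)) * Jf m κ (Pa (fun i : Fin n => q ^ (i : ℕ))) =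
      ((ε : ℤ) : ℝ) * vdet (fun i => q ^ ℓ i) := by
    intro q
    rw [h, ← Matrix.det_transpose, vdet]
    congr 2
    ext i j
    simp [← pow_mul, mul_comm]
  have t1 := vdet_pow_tendsto (fun i : Fin n => (i : ℕ))
  have t2 := vdet_pow_tendsto ℓ
  have t3 : Tendsto (fun q : ℝ => Jf m κ (Pa (fun i : Fin n => q ^ (i : ℕ)))) (nhdsWithin 1 {1}ᶜ)
      (nhds (Jf m κ (Pa (fun _ : Fin n => (1 : ℝ))))) := by
    have hc : Continuous fun q : ℝ => Jf m κ (Pa (fun i : Fin n => q ^ (i : ℕ))) :=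
      (Jf_Pa_continuous m κ).comp (by fun_prop)
    have := (hc.tendsto 1).mono_left (nhdsWithin_le_nhds (s := {1}ᶜ))
    simpa using this
  rw [← vdet_id]
  refine tendsto_nhds_unique (t1.mul t3) ((t2.const_mul ((ε : ℤ) : ℝ)).congr fun q => ?_)
  rw [← mul_div_assoc, ← h1]
  ring

theorem andreief {n : ℕ} (F G : Fin n → ℝ → ℝ) (hinteg : ∀ i j, Integrable fun x => F i x * G j x) :
    Integrable (fun x : Fin n → ℝ => Matrix.det (Matrix.of fun i c => F i (x c)) *
      Matrix.det (Matrix.of fun i c => G i (x c))) ∧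
    ∫ x : Fin n → ℝ, Matrix.det (Matrix.of fun i c => F i (x c)) *
      Matrix.det (Matrix.of fun i c => G i (x c)) =
      (n.factorial : ℝ) * Matrix.det (Matrix.of fun i j => ∫ x, F i x * G j x) := by
  have e : (fun x : Fin n → ℝ => Matrix.det (Matrix.of fun i c => F i (x c)) *
      Matrix.det (Matrix.of fun i c => G i (x c))) = fun x =>
      ∑ σ : Equiv.Perm (Fin n), ∑ τ : Equiv.Perm (Fin n),
        (((Equiv.Perm.sign σ : ℤ) : ℝ) * ((Equiv.Perm.sign τ : ℤ) : ℝ)) *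
          ∏ c, (F (σ c) (x c) * G (τ c) (x c)) := by
    funext x
    rw [Matrix.det_apply', Matrix.det_apply', Finset.sum_mul_sum]
    refine Finset.sum_congr rfl fun σ _ => Finset.sum_congr rfl fun τ _ => ?_
    simp only [Matrix.of_apply, Finset.prod_mul_distrib]
    ring
  have hi : ∀ σ τ : Equiv.Perm (Fin n), Integrable fun x : Fin n → ℝ =>
      (((Equiv.Perm.sign σ : ℤ) : ℝ) * ((Equiv.Perm.sign τ : ℤ) : ℝ)) *
          ∏ c, (F (σ c) (x c) * G (τ c) (x c)) := by
    intro σ τ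
    refine Integrable.const_mul ?_ _
    exact Integrable.fintype_prod (f := fun c x => F (σ c) x * G (τ c) x) fun c => hinteg _ _
  rw [e]
  refine ⟨integrable_finset_sum _ fun σ _ => integrable_finset_sum _ fun τ _ => hi σ τ, ?_⟩
  rw [integral_finset_sum _ fun σ _ => integrable_finset_sum _ fun τ _ => hi σ τ]
  have hσ : ∀ σ : Equiv.Perm (Fin n), ∫ x : Fin n → ℝ, ∑ τ : Equiv.Perm (Fin n),
      (((Equiv.Perm.sign σ : ℤ) : ℝ) * ((Equiv.Perm.sign τ : ℤ) : ℝ)) *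
          ∏ c, (F (σ c) (x c) * G (τ c) (x c)) =
        Matrix.det (Matrix.of fun i j => ∫ x, F i x * G j x) := by
    intro σ
    rw [integral_finset_sum _ fun τ _ => hi σ τ]
    have : ∀ τ : Equiv.Perm (Fin n), ∫ x : Fin n → ℝ,
        (((Equiv.Perm.sign σ : ℤ) : ℝ) * ((Equiv.Perm.sign τ : ℤ) : ℝ)) *
          ∏ c, (F (σ c) (x c) * G (τ c) (x c)) =
        ((Equiv.Perm.sign σ : ℤ) : ℝ) * (((Equiv.Perm.sign τ : ℤ) : ℝ) *
          ∏ c, ∫ x, F (σ c) x * G (τ c) x) := by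
      intro τ
      rw [integral_const_mul, integral_fintype_prod_volume_eq_prod (fun c x => F (σ c) x * G (τ c) x)]
      ring
    simp only [this]
    rw [← Finset.mul_sum]
    have h2 := Matrix.det_permute σ (Matrix.of fun i j => ∫ x, F i x * G j x)
    rw [← Matrix.det_transpose, Matrix.det_apply'] at h2
    have hs : ((Equiv.Perm.sign σ : ℤ) : ℝ) * ((Equiv.Perm.sign σ : ℤ) : ℝ) = 1 := by
      rw [← Int.cast_mul, ← Units.val_mul, Int.units_mul_self]; simp
    simp only [Matrix.transpose_apply, Matrix.submatrix_apply, Matrix.of_apply, id] at h2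
    rw [h2, ← mul_assoc, hs, one_mul]
  simp only [hσ]
  simp [Fintype.card_perm]

/-- nice weights: smooth, supported in `[δ, R]` with `δ > 0`. -/
def CW (N : ℕ) (δ R : ℝ) (ω : ℝ → ℝ) : Prop :=
  ContDiff ℝ N ω ∧ ∀ x, x ∉ Set.Icc δ R → ω x = 0

theorem CW.negxd {N : ℕ} {δ R : ℝ} {ω : ℝ → ℝ} (h : CW (N + 1) δ R ω) : CW N δ R (negxdOp ω) := by
  refine ⟨?_, fun x hx => ?_⟩
  · have h1 := h.1
    push_cast at h1
    have := (contDiff_succ_iff_deriv.1 h1).2.2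
    unfold negxdOp
    exact (contDiff_id.mul this).neg
  · have : ω =ᶠ[nhds x] fun _ => 0 := by
      filter_upwards [isClosed_Icc.isOpen_compl.mem_nhds hx] with y hy using h.2 y hy
    simp [negxdOp, this.deriv_eq]

theorem CW.mono {N M : ℕ} (hNM : M ≤ N) {δ R : ℝ} {ω : ℝ → ℝ} (h : CW N δ R ω) : CW M δ R ω :=
  ⟨h.1.of_le (by exact_mod_cast hNM), h.2⟩

theorem CW.iter {δ R : ℝ} {ω : ℝ → ℝ} (b : ℕ) : ∀ {N : ℕ}, CW (N + b) δ R ω →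
    CW N δ R (negxdOp^[b] ω) := by
  induction b with
  | zero => intro N h; exact h
  | succ b ih =>
    intro N h
    rw [Function.iterate_succ_apply']
    refine CW.negxd (ih ?_)
    exact h.mono (by omega)

theorem CW.integrable {N : ℕ} {δ R : ℝ} {ω : ℝ → ℝ} (h : CW N δ R ω) (u : ℝ → ℝ) (hu : Continuous u) :
    Integrable fun x => u x * ω x := by
  refine (hu.mul h.1.continuous).integrable_of_hasCompactSupport ?_
  refine HasCompactSupport.mul_left ?_
  exact HasCompactSupport.intro isCompact_Icc h.2

theorem CW.moment {δ R : ℝ} {ω : ℝ → ℝ} (h : CW 1 δ R ω) (r : ℕ) :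
    ∫ x, x ^ r * negxdOp ω x = ((r : ℝ) + 1) * ∫ x, x ^ r * ω x := by
  have hd : ∀ x, HasDerivAt ω (deriv ω x) x := fun x =>
    ((h.1.differentiable (by simp)) x).hasDerivAt
  have h0 : CW 0 δ R (negxdOp ω) := CW.negxd h
  have hu : ∀ x : ℝ, HasDerivAt (fun x : ℝ => x ^ (r + 1)) (((r : ℝ) + 1) * x ^ r) x := by
    intro x; simpa using hasDerivAt_pow (r + 1) x
  have key := integral_mul_deriv_eq_deriv_mul_of_integrable (u := fun x : ℝ => x ^ (r + 1)) (v := ω)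
    (fun x _ => hu x) (fun x _ => hd x) ?_ ?_ ?_
  · have e1 : ∀ x, x ^ r * negxdOp ω x = -(x ^ (r + 1) * deriv ω x) := by
      intro x; simp only [negxdOp]; ring
    simp only [e1]
    rw [integral_neg, key, neg_neg, ← integral_const_mul]
    refine integral_congr_ae (Eventually.of_forall fun x => ?_)
    simp only; ring
  · have := (h0.integrable (fun x => x ^ r) (by fun_prop)).neg
    refine this.congr (Eventually.of_forall fun x => ?_)
    simp only [Pi.neg_apply, Pi.mul_apply, negxdOp]; ring
  · exact h.integrable (fun x => ((r : ℝ) + 1) * x ^ r) (by fun_prop)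
  · exact h.integrable (fun x => x ^ (r + 1)) (by fun_prop)

theorem CW.moment_iter {δ R : ℝ} {ω : ℝ → ℝ} (b r : ℕ) (h : CW b δ R ω) :
    ∫ x, x ^ r * (negxdOp^[b] ω) x = ((r : ℝ) + 1) ^ b * ∫ x, x ^ r * ω x := by
  induction b with
  | zero => simp
  | succ b ih =>
    rw [Function.iterate_succ_apply', CW.moment (CW.iter b (h.mono (by omega))) r, ih (h.mono (by omega))]
    ring

/-- unnormalised Polya density -/
def Wd (n : ℕ) (ω : ℝ → ℝ) (a' : Fin n → ℝ) : ℝ :=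
  VdmF a' * Matrix.det (Matrix.of fun b c : Fin n => (negxdOp^[(b : ℕ)] ω) (a' c))

/-- unnormalised target density -/
def Vd (n : ℕ) (ω : ℝ → ℝ) (a t : Fin n → ℝ) : ℝ :=
  VdmF t * Matrix.det (Matrix.of fun b c : Fin n =>
      if 0 < t b * a c then ω (t b / a c) / |a c| else 0)

/-- the random matrix -/
def Mt {n : ℕ} (a : Fin n → ℝ) (p : Matrix (Fin n) (Fin n) ℂ × (Fin n → ℝ)) :
    Matrix (Fin n) (Fin n) ℂ :=
  sqrtDiag p.2 * (p.1 * realDiag a * p.1ᴴ) * sqrtDiag p.2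

theorem sqrtDiag_herm {n : ℕ} (a : Fin n → ℝ) : (sqrtDiag a)ᴴ = sqrtDiag a := by
  rw [sqrtDiag, Matrix.diagonal_conjTranspose]
  congr 1
  funext i
  simp

theorem realDiag_herm {n : ℕ} (a : Fin n → ℝ) : (realDiag a).IsHermitian := by
  rw [Matrix.IsHermitian, realDiag, Matrix.diagonal_conjTranspose]
  congr 1
  funext i
  simp

theorem Mt_herm {n : ℕ} (a : Fin n → ℝ) (p : Matrix (Fin n) (Fin n) ℂ × (Fin n → ℝ)) :
    (Mt a p).IsHermitian := by
  have h := Matrix.isHermitian_mul_mul_conjTranspose (sqrtDiag p.2)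
    (Matrix.isHermitian_mul_mul_conjTranspose p.1 (realDiag_herm a))
  rw [sqrtDiag_herm] at h
  exact h

theorem charpoly_eigs {n : ℕ} {M : Matrix (Fin n) (Fin n) ℂ} (hM : M.IsHermitian) :
    M.charpoly = Pa (fun i => ((eigs M i : ℝ) : ℂ)) := by
  rw [hM.charpoly_eq, eigs, dif_pos hM]; rfl

theorem charpoly_eigs' {n : ℕ} {M : Matrix (Fin n) (Fin n) ℂ} (hM : M.IsHermitian) :
    M.charpoly = (Pa (eigs M)).map Complex.ofRealHom := by
  rw [charpoly_eigs hM, Pa_map]; rfl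

theorem Mt_continuous {n : ℕ} (a : Fin n → ℝ) : Continuous (Mt a) := by
  have h1 : Continuous fun p : Matrix (Fin n) (Fin n) ℂ × (Fin n → ℝ) => sqrtDiag p.2 := by
    unfold sqrtDiag
    refine Continuous.matrix_diagonal ?_
    refine continuous_pi fun i => ?_
    exact Complex.continuous_ofReal.comp
      (Real.continuous_sqrt.comp ((continuous_apply i).comp continuous_snd))
  exact (h1.matrix_mul ((cont_conj (realDiag a)).comp continuous_fst)).matrix_mul h1

theorem JMt_continuous {n m : ℕ} (κ : Fin m → ℕ) (a : Fin n → ℝ) :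
    Continuous fun p : Matrix (Fin n) (Fin n) ℂ × (Fin n → ℝ) => Jf m κ (Pa (eigs (Mt a p))) := by
  have : (fun p : Matrix (Fin n) (Fin n) ℂ × (Fin n → ℝ) => Jf m κ (Pa (eigs (Mt a p)))) =
      fun p => (Jf m κ (Mt a p).charpoly).re := by
    funext p
    rw [charpoly_eigs (Mt_herm a p), Jf_Pa_ofReal, Complex.ofReal_re]
  rw [this]
  exact Complex.continuous_re.comp (Jf_comp_continuous κ (Mt_continuous a))

theorem CW.iter_le {δ R : ℝ} {ω : ℝ → ℝ} {N b : ℕ} (hb : b ≤ N) (h : CW N δ R ω) :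
    CW 0 δ R (negxdOp^[b] ω) := CW.iter b (h.mono (by omega))

theorem VdmF_continuous {n : ℕ} : Continuous (VdmF : (Fin n → ℝ) → ℝ) := by
  unfold VdmF
  fun_prop

theorem Wd_continuous {n : ℕ} {δ R : ℝ} {ω : ℝ → ℝ} (h : CW (n - 1) δ R ω) :
    Continuous (Wd n ω) := by
  unfold Wd
  refine VdmF_continuous.mul (Continuous.matrix_det ?_)
  refine continuous_matrix fun b c => ?_
  exact (CW.iter_le (by omega) h).1.continuous.comp (continuous_apply c)

theorem Wd_zero {n : ℕ} {δ R : ℝ} {ω : ℝ → ℝ} (h : CW (n - 1) δ R ω) (x : Fin n → ℝ)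
    (hx : x ∉ Set.pi Set.univ fun _ : Fin n => Set.Icc δ R) : Wd n ω x = 0 := by
  simp only [Set.mem_pi, Set.mem_univ, true_implies, not_forall] at hx
  obtain ⟨c, hc⟩ := hx
  rw [Wd, Matrix.det_eq_zero_of_column_eq_zero c, mul_zero]
  intro b
  exact (CW.iter_le (by omega) h).2 _ hc

theorem Wd_integrable {n : ℕ} {δ R : ℝ} {ω : ℝ → ℝ} (h : CW (n - 1) δ R ω) :
    Integrable (Wd n ω) :=
  (Wd_continuous h).integrable_of_hasCompactSupport
    (HasCompactSupport.intro (isCompact_univ_pi fun _ => isCompact_Icc) (Wd_zero h))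

theorem Wd_prod_integrable {n : ℕ} {δ R : ℝ} {ω : ℝ → ℝ} (h : CW (n - 1) δ R ω)
    {μ : Measure (Matrix (Fin n) (Fin n) ℂ)} (hμ : IsHaarUnitary n μ)
    (g : Matrix (Fin n) (Fin n) ℂ × (Fin n → ℝ) → ℝ) (hg : Continuous g) :
    Integrable (fun p => g p * Wd n ω p.2) (μ.prod volume) := by
  haveI := hμ.1
  have hK : IsCompact ({A : Matrix (Fin n) (Fin n) ℂ | A ∈ Matrix.unitaryGroup (Fin n) ℂ} ×ˢ
      (Set.pi Set.univ fun _ : Fin n => Set.Icc δ R)) :=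
    (unitary_isCompact n).prod (isCompact_univ_pi fun _ => isCompact_Icc)
  obtain ⟨C, hC⟩ := (hK.image hg).isBounded.exists_norm_le
  have hW : Integrable (fun p : Matrix (Fin n) (Fin n) ℂ × (Fin n → ℝ) => Wd n ω p.2) (μ.prod volume) :=
    (Wd_integrable h).comp_snd μ
  refine (hW.norm.const_mul C).mono' ?_ ?_
  · exact (hg.mul ((Wd_continuous h).comp continuous_snd)).aestronglyMeasurable
  · have hae : ∀ᵐ p ∂(μ.prod (volume : Measure (Fin n → ℝ))), p.1 ∈ Matrix.unitaryGroup (Fin n) ℂ :=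
      Measure.quasiMeasurePreserving_fst.ae (haar_ae hμ)
    filter_upwards [hae] with p hp
    by_cases hx : p.2 ∈ Set.pi Set.univ fun _ : Fin n => Set.Icc δ R
    · rw [norm_mul]
      exact mul_le_mul_of_nonneg_right (hC _ ⟨p, ⟨hp, hx⟩, rfl⟩) (norm_nonneg _)
    · simp [Wd_zero h _ hx]

theorem PF_real {n m : ℕ} (κ : Fin m → ℕ) (a a' : Fin n → ℝ) (ha' : ∀ i, 0 ≤ a' i)
    {μ : Measure (Matrix (Fin n) (Fin n) ℂ)} (hμ : IsHaarUnitary n μ) :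
    Jf m κ (Pa (fun _ : Fin n => (1 : ℝ))) * ∫ k, Jf m κ (Pa (eigs (Mt a (k, a')))) ∂μ =
      Jf m κ (Pa a) * Jf m κ (Pa a') := by
  have h := PF n m κ (realDiag a) (sqrtDiag a') (realDiag_herm a) μ hμ
  have e0 : (1 : Matrix (Fin n) (Fin n) ℂ).charpoly = Pa (fun _ : Fin n => (((1 : ℝ) : ℝ) : ℂ)) := by
    rw [← Matrix.diagonal_one, Matrix.charpoly_diagonal]; simp [Pa]
  have e1 : (realDiag a).charpoly = Pa (fun i => ((a i : ℝ) : ℂ)) := by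
    rw [Pa_eq_charpoly]; rfl
  have e2 : ((sqrtDiag a')ᴴ * sqrtDiag a').charpoly = Pa (fun i => ((a' i : ℝ) : ℂ)) := by
    rw [sqrtDiag_herm, Pa_eq_charpoly, sqrtDiag, Matrix.diagonal_mul_diagonal]
    congr 2
    funext i
    rw [← Complex.ofReal_mul, Real.mul_self_sqrt (ha' i)]
  have e3 : ∀ k : Matrix (Fin n) (Fin n) ℂ,
      (k * realDiag a * kᴴ * ((sqrtDiag a')ᴴ * sqrtDiag a')).charpoly =
      Pa (fun i => ((eigs (Mt a (k, a')) i : ℝ) : ℂ)) := by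
    intro k
    rw [← charpoly_eigs (Mt_herm a (k, a')), ← Matrix.mul_assoc, Matrix.charpoly_mul_comm, sqrtDiag_herm]
    simp only [Mt, Matrix.mul_assoc]
  simp only [e1, e2, e3] at h
  rw [e0] at h
  simp only [Jf_Pa_ofReal] at h
  rw [integral_complex_ofReal] at h
  exact_mod_cast h

theorem Jf_noninj {R : Type*} [CommRing R] {m : ℕ} (κ : Fin m → ℕ) (h : ¬ Function.Injective κ)
    (χ : Polynomial R) : Jf m κ χ = 0 := by
  simp only [Function.Injective, not_forall] at h
  obtain ⟨i, j, hij, hne⟩ := h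
  exact Matrix.det_zero_of_column_eq hne fun k => by simp [hij]

theorem Jf_big {R : Type*} [CommRing R] [Nontrivial R] {n m : ℕ} (κ : Fin m → ℕ) (h : ∃ j, n + m ≤ κ j)
    (a : Fin n → R) : Jf m κ (Pa a) = 0 := by
  obtain ⟨j, hj⟩ := h
  refine Matrix.det_eq_zero_of_column_eq_zero j fun i => ?_
  rw [Matrix.of_apply]
  refine Polynomial.coeff_eq_zero_of_natDegree_lt ?_
  refine lt_of_le_of_lt Polynomial.natDegree_mul_le ?_
  rw [Pa_natDegree, Polynomial.natDegree_X_pow]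
  omega

theorem ite_weight {δ R : ℝ} {ω : ℝ → ℝ} {N : ℕ} (hδ : 0 < δ) (h : CW N δ R ω) (t a : ℝ) (ha : a ≠ 0) :
    (if 0 < t * a then ω (t / a) / |a| else 0) = ω (t / a) / |a| := by
  split_ifs with h1
  · rfl
  · rw [h.2, zero_div]
    intro h2
    have h3 : 0 < t / a := lt_of_lt_of_le hδ h2.1
    apply h1
    have : t * a = (t / a) * a ^ 2 := by field_simp
    rw [this]; positivity

theorem weight_moment (ω : ℝ → ℝ) (a : ℝ) (ha : a ≠ 0) (l : ℕ) :
    ∫ t, t ^ l * (ω (t / a) / |a|) = a ^ l * ∫ x, x ^ l * ω x := by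
  have := Measure.integral_comp_div (fun x => (a * x) ^ l * (ω x / |a|)) a
  have e : ∀ t : ℝ, (a * (t / a)) ^ l * (ω (t / a) / |a|) = t ^ l * (ω (t / a) / |a|) := by
    intro t; rw [mul_div_cancel₀ _ ha]
  simp only [e] at this
  rw [this, smul_eq_mul, ← integral_const_mul, ← integral_const_mul]
  refine integral_congr_ae (Eventually.of_forall fun x => ?_)
  have : |a| ≠ 0 := abs_ne_zero.2 ha
  simp only
  field_simp
  ring

theorem det_mul_left {n : ℕ} (d : Fin n → ℝ) (A : Fin n → Fin n → ℝ) :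
    Matrix.det (Matrix.of fun i j => A i j * d i) = (∏ i, d i) * Matrix.det (Matrix.of A) := by
  rw [← Matrix.det_mul_column]
  refine congrArg Matrix.det (Matrix.ext fun i j => ?_)
  simp [mul_comm]

theorem vdet_add_one {n : ℕ} (ℓ : Fin n → ℝ) : vdet (fun i => ℓ i + 1) = vdet ℓ := by
  simp [vdet_prod]

theorem mom_W {n m : ℕ} (hn : 1 ≤ n) {δ R : ℝ} {ω : ℝ → ℝ} (h : CW (n - 1) δ R ω)
    (κ : Fin m → ℕ) (ε : ℤˣ) (ℓ : Fin n → ℕ)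
    (hJ : ∀ a : Fin n → ℝ, vdet a * Jf m κ (Pa a) =
      ((ε : ℤ) : ℝ) * Matrix.det (Matrix.of fun i c => a c ^ ℓ i)) :
    ∫ x, Jf m κ (Pa x) * Wd n ω x = ((ε : ℤ) : ℝ) * ((n.factorial : ℝ) *
      ((∏ i, ∫ x, x ^ ℓ i * ω x) * vdet (fun i => (ℓ i : ℝ)))) := by
  have e1 : ∀ x : Fin n → ℝ, Jf m κ (Pa x) * Wd n ω x = ((ε : ℤ) : ℝ) *
      (Matrix.det (Matrix.of fun i c => x c ^ ℓ i) *
        Matrix.det (Matrix.of fun b c : Fin n => (negxdOp^[(b : ℕ)] ω) (x c))) := by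
    intro x
    rw [Wd, VdmF_eq, ← mul_assoc, mul_comm (Jf m κ (Pa x)), hJ, mul_assoc]
  simp only [e1]
  rw [integral_const_mul, (andreief (fun i x => x ^ ℓ i) (fun b => negxdOp^[(b : ℕ)] ω) ?_).2]
  · congr 2
    have e2 : ∀ i j : Fin n, ∫ x, x ^ ℓ i * (negxdOp^[(j : ℕ)] ω) x =
        ((ℓ i : ℝ) + 1) ^ (j : ℕ) * ∫ x, x ^ ℓ i * ω x := fun i j =>
      CW.moment_iter _ _ (h.mono (by omega))
    simp only [e2]
    rw [det_mul_left (fun i => ∫ x, x ^ ℓ i * ω x) (fun i j => ((ℓ i : ℝ) + 1) ^ (j : ℕ)),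
      ← vdet_add_one, vdet, ← Matrix.det_transpose]
    rfl
  · intro i j
    exact (CW.iter_le (by omega) h).integrable _ (by fun_prop)

theorem mom_V {n m : ℕ} {δ R : ℝ} {ω : ℝ → ℝ} (hδ : 0 < δ) (h : CW (n - 1) δ R ω)
    (a : Fin n → ℝ) (ha : ∀ i, a i ≠ 0)
    (κ : Fin m → ℕ) (ε : ℤˣ) (ℓ : Fin n → ℕ)
    (hJ : ∀ a : Fin n → ℝ, vdet a * Jf m κ (Pa a) =
      ((ε : ℤ) : ℝ) * Matrix.det (Matrix.of fun i c => a c ^ ℓ i)) :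
    ∫ x, Jf m κ (Pa x) * Vd n ω a x = (n.factorial : ℝ) *
      ((∏ i, ∫ x, x ^ ℓ i * ω x) * (vdet a * Jf m κ (Pa a))) := by
  have e1 : ∀ x : Fin n → ℝ, Jf m κ (Pa x) * Vd n ω a x = ((ε : ℤ) : ℝ) *
      (Matrix.det (Matrix.of fun i c => x c ^ ℓ i) *
        Matrix.det (Matrix.of fun b c : Fin n => ω (x c / a b) / |a b|)) := by
    intro x
    rw [Vd, VdmF_eq, ← mul_assoc, mul_comm (Jf m κ (Pa x)), hJ, mul_assoc]
    congr 2
    rw [← Matrix.det_transpose]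
    refine congrArg Matrix.det (Matrix.ext fun i j => ?_)
    exact ite_weight hδ h _ _ (ha _)
  simp only [e1]
  rw [integral_const_mul, (andreief (fun i x => x ^ ℓ i) (fun b x => ω (x / a b) / |a b|) ?_).2, hJ]
  · simp only [weight_moment _ _ (ha _)]
    rw [det_mul_left (fun i => ∫ x, x ^ ℓ i * ω x) (fun i j => a j ^ ℓ i)]
    ring
  · intro i j
    have h0 := h.integrable (fun x => (a j * x) ^ ℓ i / |a j|) (by fun_prop)
    have := h0.comp_div (ha j)
    refine this.congr (Eventually.of_forall fun t => ?_)
    simp only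
    rw [mul_div_cancel₀ _ (ha j)]
    ring

theorem mom_id {n m : ℕ} (hn : 1 ≤ n) {δ R : ℝ} {ω : ℝ → ℝ} (hδ : 0 < δ) (h : CW (n - 1) δ R ω)
    (a : Fin n → ℝ) (ha : ∀ i, a i ≠ 0) {μ : Measure (Matrix (Fin n) (Fin n) ℂ)}
    (hμ : IsHaarUnitary n μ) (κ : Fin m → ℕ) :
    VdmF a * ∫ p, Jf m κ (Pa (eigs (Mt a p))) * Wd n ω p.2 ∂(μ.prod volume) =
      (∏ j ∈ Finset.range n, (Nat.factorial j : ℝ)) * ∫ t, Jf m κ (Pa t) * Vd n ω a t := by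
  haveI := hμ.1
  by_cases hinj : Function.Injective κ
  swap
  · simp [Jf_noninj κ hinj]
  by_cases hlt : ∀ j, κ j < n + m
  swap
  · push Not at hlt
    simp [Jf_big κ hlt]
  obtain ⟨ε, ℓ, hℓ, -, hal⟩ := Jf_alternant (n := n) κ hinj hlt
  have hJ := hal ℝ
  rw [mom_V hδ h a ha κ ε ℓ hJ]
  have hone := Jf_one κ ε ℓ hJ
  have hinteg := Wd_prod_integrable h hμ _ (JMt_continuous κ a)
  rw [integral_prod_symm _ hinteg]
  set J1 := Jf m κ (Pa (fun _ : Fin n => (1 : ℝ)))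
  have hεε : ((ε : ℤ) : ℝ) * ((ε : ℤ) : ℝ) = 1 := by
    rw [← Int.cast_mul, ← Units.val_mul, Int.units_mul_self]; simp
  have hv : vdet (fun i => (ℓ i : ℝ)) ≠ 0 := vdet_ne_zero fun i j hij => hℓ (by exact_mod_cast hij)
  have hJ1 : J1 ≠ 0 := by
    intro h0
    rw [h0, mul_zero] at hone
    have : ((ε : ℤ) : ℝ) ≠ 0 := by intro h; rw [h] at hεε; simp at hεε
    exact (mul_ne_zero this hv) hone.symm
  have e : J1 * ∫ y : Fin n → ℝ, ∫ x, Jf m κ (Pa (eigs (Mt a (x, y)))) * Wd n ω (x, y).2 ∂μ =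
      Jf m κ (Pa a) * ∫ x, Jf m κ (Pa x) * Wd n ω x := by
    rw [← integral_const_mul, ← integral_const_mul]
    refine integral_congr_ae (Eventually.of_forall fun y => ?_)
    simp only
    rw [integral_mul_const, ← mul_assoc]
    by_cases hy : y ∈ Set.pi Set.univ fun _ : Fin n => Set.Icc δ R
    · rw [PF_real κ a y (fun i => hδ.le.trans (hy i trivial).1) hμ, mul_assoc]
    · simp [Wd_zero h _ hy]
  rw [mom_W hn h κ ε ℓ hJ] at e
  rw [VdmF_eq]
  refine mul_left_cancel₀ hJ1 ?_
  set I := ∫ y : Fin n → ℝ, ∫ x, Jf m κ (Pa (eigs (Mt a (x, y)))) * Wd n ω (x, y).2 ∂μ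
  linear_combination vdet a * e - (n.factorial : ℝ) * (∏ i, ∫ x, x ^ ℓ i * ω x) * vdet a * Jf m κ (Pa a) * hone

theorem vdet_prod_eval {m N : ℕ} (z : Fin m → ℝ) (χ : Polynomial ℝ) (hχ : χ.natDegree + m ≤ N) :
    vdet z * ∏ j, χ.eval (z j) =
      ∑ r : Fin m → Fin N, (∏ j, z j ^ (r j : ℕ)) * Jf m (fun j => (r j : ℕ)) χ := by
  have h := det_cols_sum (fun (i : Fin m) (s : Fin N) => (Polynomial.X ^ (i : ℕ) * χ).coeff (s : ℕ))
    (fun (j : Fin m) (s : Fin N) => z j ^ (s : ℕ))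
  unfold Jf
  rw [← h]
  have e : ∀ i j : Fin m, ∑ s : Fin N, z j ^ (s : ℕ) * (Polynomial.X ^ (i : ℕ) * χ).coeff (s : ℕ) =
      χ.eval (z j) * z j ^ (i : ℕ) := by
    intro i j
    have hd : (Polynomial.X ^ (i : ℕ) * χ).natDegree < N := by
      refine Polynomial.natDegree_mul_le.trans_lt ?_
      rw [Polynomial.natDegree_X_pow]
      have := i.2
      omega
    rw [Fin.sum_univ_eq_sum_range (fun s : ℕ => z j ^ s * Polynomial.coeff (Polynomial.X ^ (i : ℕ) * χ) s) N]
    have := Polynomial.eval_eq_sum_range' hd (z j)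
    rw [Polynomial.eval_mul, Polynomial.eval_pow, Polynomial.eval_X] at this
    rw [mul_comm (χ.eval _), this]
    exact Finset.sum_congr rfl fun s _ => mul_comm _ _
  simp only [e]
  rw [vdet]
  have h2 := Matrix.det_mul_row (fun j => χ.eval (z j)) (Matrix.of fun i j : Fin m => z j ^ (i : ℕ))
  simp only [Matrix.of_apply] at h2
  rw [mul_comm]
  exact h2.symm

theorem coeff_eval_shift (M : ℕ) (c : ℝ) : ∃ w : Fin M → Fin M → ℝ, ∀ (f : Polynomial ℝ),
    f.natDegree < M → ∀ k : Fin M,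
      f.coeff k = ∑ s : Fin M, w k s * f.eval (c + (s : ℕ)) := by
  set V : Matrix (Fin M) (Fin M) ℝ := Matrix.vandermonde (fun s => c + ((s : ℕ) : ℝ)) with hV
  have hdet : V.det ≠ 0 := Matrix.det_vandermonde_ne_zero_iff.2 fun i j h => by
    simpa [Fin.ext_iff] using h
  obtain ⟨W, h1⟩ : ∃ W : Matrix (Fin M) (Fin M) ℝ, W * V = 1 :=
    ⟨V⁻¹, Matrix.nonsing_inv_mul _ (isUnit_iff_ne_zero.2 hdet)⟩
  refine ⟨fun k s => W k s, fun f hf k => ?_⟩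
  have h2 : ∀ l : Fin M, ∑ s, W k s * (c + ((s : ℕ) : ℝ)) ^ (l : ℕ) = if k = l then 1 else 0 := by
    intro l
    have := congrFun (congrFun h1 k) l
    rw [Matrix.mul_apply, Matrix.one_apply] at this
    simpa [hV, Matrix.vandermonde_apply] using this
  simp only [Polynomial.eval_eq_sum_range' hf, Finset.mul_sum]
  rw [Finset.sum_comm, ← Fin.sum_univ_eq_sum_range (fun l => ∑ s : Fin M, W k s * (f.coeff l * (c + (s : ℕ)) ^ l))]
  have h3 : ∀ l : Fin M, ∑ s : Fin M, W k s * (f.coeff l * (c + (s : ℕ)) ^ (l : ℕ))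
      = f.coeff l * (if k = l then 1 else 0) := by
    intro l
    rw [← h2 l, Finset.mul_sum]
    refine Finset.sum_congr rfl fun s _ => ?_
    ring
  simp only [h3]
  rw [Finset.sum_eq_single k]
  · simp
  · intro b _ hb
    rw [if_neg hb.symm]; simp
  · simp

theorem mono_span {n m : ℕ} (e : Fin m → Fin (n + 1)) :
    ∃ C : (Fin m → Fin (n + m)) → ℝ, ∀ χ : Polynomial ℝ, χ.natDegree ≤ n →
      ∏ j, χ.coeff (e j) = ∑ r, C r * Jf m (fun j => (r j : ℕ)) χ := by
  choose w hw using fun j : Fin m => coeff_eval_shift (n + 1) (((j : ℕ) * (n + 1) : ℕ) : ℝ)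
  let z : (Fin m → Fin (n + 1)) → Fin m → ℝ := fun s j => (((j : ℕ) * (n + 1) : ℕ) : ℝ) + (s j : ℕ)
  have hz : ∀ s, Function.Injective (z s) := by
    intro s i j hij
    have h : (i : ℕ) * (n + 1) + (s i : ℕ) = (j : ℕ) * (n + 1) + (s j : ℕ) := by
      simp only [z] at hij
      exact_mod_cast hij
    have h1 := congrArg (· / (n + 1)) h
    simp only [Nat.add_comm (_ * (n + 1))] at h1
    rw [Nat.add_mul_div_right _ _ (by omega), Nat.add_mul_div_right _ _ (by omega),
      Nat.div_eq_of_lt (s i).2, Nat.div_eq_of_lt (s j).2] at h1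
    exact Fin.ext (by omega)
  refine ⟨fun r => ∑ s : Fin m → Fin (n + 1), (∏ j, w j (e j) (s j)) * (vdet (z s))⁻¹ *
    ∏ j, z s j ^ (r j : ℕ), fun χ hχ => ?_⟩
  have h1 : ∏ j, χ.coeff (e j) = ∏ j, ∑ s : Fin (n + 1), w j (e j) s *
      χ.eval ((((j : ℕ) * (n + 1) : ℕ) : ℝ) + (s : ℕ)) :=
    Finset.prod_congr rfl fun j _ => hw j χ (by omega) (e j)
  rw [h1, Finset.prod_univ_sum, Fintype.piFinset_univ]
  simp only [Finset.sum_mul]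
  rw [Finset.sum_comm]
  refine Finset.sum_congr rfl fun s _ => ?_
  have h2 := vdet_prod_eval (N := n + m) (z s) χ (by omega)
  have h3 := vdet_ne_zero (hz s)
  rw [Finset.prod_mul_distrib]
  have h4 : ∏ j, χ.eval (z s j) = (vdet (z s))⁻¹ * ∑ r : Fin m → Fin (n + m),
      (∏ j, z s j ^ (r j : ℕ)) * Jf m (fun j => (r j : ℕ)) χ := by
    rw [← h2, inv_mul_cancel_left₀ h3]
  have h5 : ∏ j : Fin m, χ.eval ((((j : ℕ) * (n + 1) : ℕ) : ℝ) + (s j : ℕ)) = ∏ j, χ.eval (z s j) := rfl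
  rw [h5, h4, Finset.mul_sum, Finset.mul_sum]
  exact Finset.sum_congr rfl fun r _ => by ring

theorem int_comp {d : ℕ} {X : Type*} [MeasurableSpace X] {P : Measure X} {G : X → Fin d → ℝ}
    (hG : Measurable G) {p : X → ℝ} (hp : Integrable p P) {K : Set (Fin d → ℝ)} (hK : IsCompact K)
    (hpK : ∀ᵐ x ∂P, p x ≠ 0 → G x ∈ K) {φ : (Fin d → ℝ) → ℝ} (hφ : Continuous φ) :
    Integrable (fun x => φ (G x) * p x) P := by
  obtain ⟨C, hC⟩ := (hK.image hφ).isBounded.exists_norm_le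
  refine (hp.norm.const_mul C).mono' ?_ ?_
  · exact (hφ.measurable.comp hG).aestronglyMeasurable.mul hp.1
  · filter_upwards [hpK] with x hx
    by_cases h0 : p x = 0
    · simp [h0]
    · rw [norm_mul]
      exact mul_le_mul_of_nonneg_right (hC _ ⟨_, hx h0, rfl⟩) (norm_nonneg _)

theorem int_comp_bdd {d : ℕ} {X : Type*} [MeasurableSpace X] {P : Measure X} {G : X → Fin d → ℝ}
    (hG : Measurable G) {p : X → ℝ} (hp : Integrable p P)
    {F : (Fin d → ℝ) → ℝ} (hF : Measurable F) (hFb : ∃ C, ∀ v, |F v| ≤ C) :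
    Integrable (fun x => F (G x) * p x) P := by
  obtain ⟨C, hC⟩ := hFb
  exact hp.bdd_mul (hF.comp hG).aestronglyMeasurable (Eventually.of_forall fun x => hC _)

theorem int_est {d : ℕ} {X : Type*} [MeasurableSpace X] {P : Measure X} {G : X → Fin d → ℝ}
    {p : X → ℝ} (hp : Integrable p P) {K : Set (Fin d → ℝ)}
    (hpK : ∀ᵐ x ∂P, p x ≠ 0 → G x ∈ K) {φ : (Fin d → ℝ) → ℝ} {ε : ℝ}
    (hε : ∀ v ∈ K, |φ v| ≤ ε) :
    |∫ x, φ (G x) * p x ∂P| ≤ ε * ∫ x, |p x| ∂P := by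
  rw [← integral_const_mul, ← Real.norm_eq_abs]
  refine norm_integral_le_of_norm_le (hp.abs.const_mul ε) ?_
  filter_upwards [hpK] with x hx
  by_cases h0 : p x = 0
  · simp [h0]
  · rw [norm_mul]
    exact mul_le_mul_of_nonneg_right (hε _ (hx h0)) (norm_nonneg _)

theorem mono_of_closure {d : ℕ} (φ : C(Fin d → ℝ, ℝ))
    (hφ : φ ∈ Submonoid.closure (Set.range fun i : Fin d =>
      (⟨fun v => v i, continuous_apply i⟩ : C(Fin d → ℝ, ℝ)))) :
    ∃ (m : ℕ) (e : Fin m → Fin d), ∀ v, φ v = ∏ j, v (e j) := by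
  induction hφ using Submonoid.closure_induction with
  | mem x hx =>
    obtain ⟨i, rfl⟩ := hx
    exact ⟨1, fun _ => i, fun v => by simp⟩
  | one => exact ⟨0, Fin.elim0, fun v => by simp⟩
  | mul x y _ _ hx hy =>
    obtain ⟨m, e, he⟩ := hx
    obtain ⟨m', e', he'⟩ := hy
    refine ⟨m + m', Fin.append e e', fun v => ?_⟩
    rw [ContinuousMap.mul_apply, he, he', Fin.prod_univ_add]
    simp

theorem det_cont {d : ℕ} {X Y : Type*} [MeasurableSpace X] [MeasurableSpace Y]
    {P : Measure X} {Q : Measure Y} {G : X → Fin d → ℝ} {H : Y → Fin d → ℝ}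
    (hG : Measurable G) (hH : Measurable H) {p : X → ℝ} {q : Y → ℝ}
    (hp : Integrable p P) (hq : Integrable q Q) {K : Set (Fin d → ℝ)} (hK : IsCompact K)
    (hpK : ∀ᵐ x ∂P, p x ≠ 0 → G x ∈ K) (hqK : ∀ᵐ x ∂Q, q x ≠ 0 → H x ∈ K)
    (hmom : ∀ (m : ℕ) (e : Fin m → Fin d),
      ∫ x, (∏ j, G x (e j)) * p x ∂P = ∫ y, (∏ j, H y (e j)) * q y ∂Q)
    (φ : C(Fin d → ℝ, ℝ)) : ∫ x, φ (G x) * p x ∂P = ∫ y, φ (H y) * q y ∂Q := by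
  let A : Subalgebra ℝ C(Fin d → ℝ, ℝ) := Algebra.adjoin ℝ (Set.range fun i : Fin d =>
      (⟨fun v => v i, continuous_apply i⟩ : C(Fin d → ℝ, ℝ)))
  have hA : ∀ g ∈ A, ∫ x, g (G x) * p x ∂P = ∫ y, g (H y) * q y ∂Q := by
    intro g hg
    have hg' : g ∈ Submodule.span ℝ ((Submonoid.closure (Set.range fun i : Fin d =>
      (⟨fun v => v i, continuous_apply i⟩ : C(Fin d → ℝ, ℝ))) : Submonoid _) : Set C(Fin d → ℝ, ℝ)) := by
      rw [← Algebra.adjoin_eq_span]; exact hg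
    induction hg' using Submodule.span_induction with
    | mem x hx =>
      obtain ⟨m, e, he⟩ := mono_of_closure x hx
      simp only [he]
      exact hmom m e
    | zero => simp
    | add x y hx hy h1 h2 =>
      simp only [ContinuousMap.add_apply, add_mul]
      rw [integral_add (int_comp hG hp hK hpK x.continuous) (int_comp hG hp hK hpK y.continuous),
        integral_add (int_comp hH hq hK hqK x.continuous) (int_comp hH hq hK hqK y.continuous),
        h1 (by rw [← Algebra.adjoin_eq_span] at hx; exact hx),
        h2 (by rw [← Algebra.adjoin_eq_span] at hy; exact hy)]
    | smul c x hx h1 =>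
      simp only [ContinuousMap.smul_apply, smul_eq_mul, mul_assoc]
      rw [integral_const_mul, integral_const_mul,
        h1 (by rw [← Algebra.adjoin_eq_span] at hx; exact hx)]
  have hsep : A.SeparatesPoints := by
    intro u v huv
    obtain ⟨i, hi⟩ := Function.ne_iff.1 huv
    exact ⟨_, ⟨_, Algebra.subset_adjoin ⟨i, rfl⟩, rfl⟩, hi⟩
  rw [← sub_eq_zero, ← abs_nonpos_iff]
  refine le_of_forall_pos_le_add fun ε hε => ?_
  rw [zero_add]
  set B := ∫ x, |p x| ∂P + ∫ y, |q y| ∂Q with hB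
  have hB0 : 0 ≤ B := add_nonneg (integral_nonneg fun _ => abs_nonneg _)
    (integral_nonneg fun _ => abs_nonneg _)
  obtain ⟨g, hg, hgε⟩ := ContinuousMap.exists_mem_subalgebra_near_continuous_of_isCompact_of_separatesPoints
    hsep φ hK (ε := ε / (B + 1)) (by positivity)
  have h1 := int_est (φ := fun v => g v - φ v) hp hpK (fun v hv => (hgε v hv).le)
  have h2 := int_est (φ := fun v => g v - φ v) hq hqK (fun v hv => (hgε v hv).le)
  simp only [sub_mul] at h1 h2
  rw [integral_sub (int_comp hG hp hK hpK g.continuous) (int_comp hG hp hK hpK φ.continuous)] at h1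
  rw [integral_sub (int_comp hH hq hK hqK g.continuous) (int_comp hH hq hK hqK φ.continuous),
    ← hA g hg] at h2
  have h3 : ε / (B + 1) * B ≤ ε := by
    rw [div_mul_eq_mul_div, div_le_iff₀ (by positivity)]
    nlinarith
  have h4 : ε / (B + 1) * B = ε / (B + 1) * ∫ x, |p x| ∂P + ε / (B + 1) * ∫ y, |q y| ∂Q := by
    rw [hB, mul_add]
  rw [abs_le] at h1 h2 ⊢
  constructor <;> linarith [h1.1, h1.2, h2.1, h2.2]

/-- push-forward of the positive part -/
def Sm {d : ℕ} {X : Type*} [MeasurableSpace X] (P : Measure X) (G : X → Fin d → ℝ) (p : X → ℝ) :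
    Measure (Fin d → ℝ) :=
  (P.withDensity fun x => ((Real.toNNReal (p x) : NNReal) : ENNReal)).map G

theorem Sm_finite {d : ℕ} {X : Type*} [MeasurableSpace X] {P : Measure X} {G : X → Fin d → ℝ}
    {p : X → ℝ} (hp : Integrable p P) : IsFiniteMeasure (Sm P G p) := by
  haveI : IsFiniteMeasure (P.withDensity fun x => ((Real.toNNReal (p x) : NNReal) : ENNReal)) :=
    isFiniteMeasure_withDensity_ofReal hp.2
  unfold Sm
  infer_instance

theorem Sm_integral {d : ℕ} {X : Type*} [MeasurableSpace X] {P : Measure X} {G : X → Fin d → ℝ}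
    (hG : Measurable G) {p : X → ℝ} (hp : Integrable p P)
    {F : (Fin d → ℝ) → ℝ} (hF : Measurable F) :
    ∫ v, F v ∂(Sm P G p) = ∫ x, F (G x) * max (p x) 0 ∂P := by
  unfold Sm
  rw [integral_map hG.aemeasurable hF.aestronglyMeasurable,
    integral_withDensity_eq_integral_smul₀ hp.1.aemeasurable.real_toNNReal]
  refine integral_congr_ae (Eventually.of_forall fun x => ?_)
  simp only [NNReal.smul_def, Real.coe_toNNReal', smul_eq_mul]
  ring

theorem det_lemma {d : ℕ} {X Y : Type*} [MeasurableSpace X] [MeasurableSpace Y]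
    {P : Measure X} {Q : Measure Y} {G : X → Fin d → ℝ} {H : Y → Fin d → ℝ}
    (hG : Measurable G) (hH : Measurable H) {p : X → ℝ} {q : Y → ℝ}
    (hp : Integrable p P) (hq : Integrable q Q) {K : Set (Fin d → ℝ)} (hK : IsCompact K)
    (hpK : ∀ᵐ x ∂P, p x ≠ 0 → G x ∈ K) (hqK : ∀ᵐ x ∂Q, q x ≠ 0 → H x ∈ K)
    (hmom : ∀ (m : ℕ) (e : Fin m → Fin d),
      ∫ x, (∏ j, G x (e j)) * p x ∂P = ∫ y, (∏ j, H y (e j)) * q y ∂Q)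
    {F : (Fin d → ℝ) → ℝ} (hF : Measurable F) (hFb : ∃ C, ∀ v, |F v| ≤ C) :
    ∫ x, F (G x) * p x ∂P = ∫ y, F (H y) * q y ∂Q := by
  haveI := Sm_finite (G := G) hp
  haveI := Sm_finite (G := G) hp.neg
  haveI := Sm_finite (G := H) hq
  haveI := Sm_finite (G := H) hq.neg
  have key : ∀ f : (Fin d → ℝ) → ℝ, Measurable f → (∃ C, ∀ v, |f v| ≤ C) →
      (∫ v, f v ∂(Sm P G p + Sm Q H (-q)) - ∫ v, f v ∂(Sm P G (-p) + Sm Q H q) =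
        ∫ x, f (G x) * p x ∂P - ∫ y, f (H y) * q y ∂Q) := by
    intro f hf hfb
    have hi : ∀ (μ : Measure (Fin d → ℝ)) [IsFiniteMeasure μ], Integrable f μ := by
      intro μ _
      obtain ⟨C, hC⟩ := hfb
      exact Integrable.of_bound hf.aestronglyMeasurable C (Eventually.of_forall hC)
    rw [integral_add_measure (hi _) (hi _), integral_add_measure (hi _) (hi _),
      Sm_integral hG hp hf, Sm_integral hG hp.neg hf, Sm_integral hH hq hf, Sm_integral hH hq.neg hf]
    have e1 : ∫ x, f (G x) * p x ∂P = ∫ x, f (G x) * max (p x) 0 ∂P - ∫ x, f (G x) * max ((-p) x) 0 ∂P := by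
      rw [← integral_sub (int_comp_bdd hG hp.pos_part hf hfb) (int_comp_bdd hG hp.neg.pos_part hf hfb)]
      refine integral_congr_ae (Eventually.of_forall fun x => ?_)
      simp only [Pi.neg_apply, ← mul_sub]
      congr 1
      rcases le_total (p x) 0 with h | h
      · rw [max_eq_right h, max_eq_left (by linarith)]; ring
      · rw [max_eq_left h, max_eq_right (by linarith)]; ring
    have e2 : ∫ x, f (H x) * q x ∂Q = ∫ x, f (H x) * max (q x) 0 ∂Q - ∫ x, f (H x) * max ((-q) x) 0 ∂Q := by
      rw [← integral_sub (int_comp_bdd hH hq.pos_part hf hfb) (int_comp_bdd hH hq.neg.pos_part hf hfb)]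
      refine integral_congr_ae (Eventually.of_forall fun x => ?_)
      simp only [Pi.neg_apply, ← mul_sub]
      congr 1
      rcases le_total (q x) 0 with h | h
      · rw [max_eq_right h, max_eq_left (by linarith)]; ring
      · rw [max_eq_left h, max_eq_right (by linarith)]; ring
    rw [e1, e2]
    ring
  have hm : Sm P G p + Sm Q H (-q) = Sm P G (-p) + Sm Q H q := by
    refine ext_of_forall_integral_eq_of_IsFiniteMeasure fun φ => ?_
    have h1 := key φ φ.continuous.measurable ⟨‖φ‖, fun v => φ.norm_coe_le_norm v⟩
    have h2 := det_cont hG hH hp hq hK hpK hqK hmom φ.toContinuousMap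
    have h3 : ∫ x, φ (G x) * p x ∂P = ∫ y, φ (H y) * q y ∂Q := h2
    rw [h3, sub_self] at h1
    exact sub_eq_zero.1 h1
  have := key F hF hFb
  rw [hm, sub_self] at this
  exact (sub_eq_zero.1 this.symm)

/-- elementary symmetric coordinates -/
def coefv {n : ℕ} (t : Fin n → ℝ) : Fin n → ℝ := fun i => (Pa t).coeff i

theorem coefv_continuous {n : ℕ} : Continuous (coefv : (Fin n → ℝ) → Fin n → ℝ) := by
  refine continuous_pi fun i => ?_
  have : (fun t : Fin n → ℝ => coefv t i) =
      fun t => (((Matrix.diagonal fun k => ((t k : ℝ) : ℂ)).charpoly).coeff i).re := by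
    funext t
    rw [← Pa_eq_charpoly]
    have := Pa_map Complex.ofRealHom t
    have e : Pa (fun k => ((t k : ℝ) : ℂ)) = (Pa t).map Complex.ofRealHom := by rw [this]; rfl
    rw [e, Polynomial.coeff_map]
    simp [coefv]
  rw [this]
  refine Complex.continuous_re.comp ((charpoly_coeff_continuous n i).comp ?_)
  refine Continuous.matrix_diagonal (continuous_pi fun k => ?_)
  exact Complex.continuous_ofReal.comp (continuous_apply k)

theorem coefv_Pa {n : ℕ} {s t : Fin n → ℝ} (h : coefv s = coefv t) : Pa s = Pa t := by
  ext k
  rcases lt_trichotomy k n with hk | hk | hk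
  · exact congrFun h ⟨k, hk⟩
  · have h1 := (Pa_monic s).coeff_natDegree
    have h2 := (Pa_monic t).coeff_natDegree
    rw [Pa_natDegree] at h1 h2
    rw [hk, h1, h2]
  · rw [Polynomial.coeff_eq_zero_of_natDegree_lt (by rw [Pa_natDegree]; exact hk),
      Polynomial.coeff_eq_zero_of_natDegree_lt (by rw [Pa_natDegree]; exact hk)]

theorem Pa_roots {n : ℕ} (s : Fin n → ℝ) : (Pa s).roots = (List.ofFn s : Multiset ℝ) := by
  have h := Polynomial.roots_multiset_prod_X_sub_C (Multiset.map s (Finset.univ : Finset (Fin n)).val)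
  rw [Multiset.map_map] at h
  rw [← Fin.univ_val_map]
  exact h

theorem coefv_inj {n : ℕ} {s t : Fin n → ℝ} (hs : Monotone s) (ht : Monotone t)
    (h : coefv s = coefv t) : s = t := by
  have h1 := congrArg Polynomial.roots (coefv_Pa h)
  rw [Pa_roots, Pa_roots, Multiset.coe_eq_coe] at h1
  exact List.ofFn_injective (h1.eq_of_pairwise' hs.sortedLE_ofFn.pairwise ht.sortedLE_ofFn.pairwise)

theorem Pa_perm {n : ℕ} (σ : Equiv.Perm (Fin n)) (t : Fin n → ℝ) : Pa (t ∘ σ) = Pa t := by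
  unfold Pa
  exact Equiv.prod_comp σ (fun k => Polynomial.X - Polynomial.C (t k))

theorem symm_factor {n : ℕ} (f : (Fin n → ℝ) → ℝ) (hf : Measurable f) (hfb : ∃ C, ∀ v, |f v| ≤ C)
    (hsymm : ∀ (σ : Equiv.Perm (Fin n)) (v : Fin n → ℝ), f (v ∘ σ) = f v) :
    ∃ F : (Fin n → ℝ) → ℝ, Measurable F ∧ (∃ C, ∀ v, |F v| ≤ C) ∧ ∀ t, f t = F (coefv t) := by
  obtain ⟨C, hC⟩ := hfb
  let T : Set (Fin n → ℝ) := {t | Monotone t}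
  have hT : IsClosed T := isClosed_monotone
  haveI : PolishSpace T := hT.polishSpace
  have hemb : MeasurableEmbedding (fun t : T => coefv (t : Fin n → ℝ)) :=
    (coefv_continuous.comp continuous_subtype_val).measurableEmbedding
      (fun s t h => Subtype.ext (coefv_inj s.2 t.2 h))
  obtain ⟨F, hF, hFf⟩ := hemb.exists_measurable_extend (g := fun t : T => f t)
    (hf.comp measurable_subtype_coe) (fun _ => ⟨0⟩)
  have h0 : 0 ≤ C := (abs_nonneg _).trans (hC 0)
  refine ⟨fun v => max (-C) (min (F v) C), measurable_const.max (hF.min measurable_const), ⟨C, fun v => ?_⟩, fun t => ?_⟩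
  · rw [abs_le]
    exact ⟨le_max_left _ _, max_le (by linarith) (min_le_right _ _)⟩
  · have h1 := congrFun hFf ⟨t ∘ Tuple.sort t, Tuple.monotone_sort t⟩
    have h2 : coefv (t ∘ Tuple.sort t) = coefv t := by
      unfold coefv
      rw [Pa_perm]
    simp only [Function.comp_apply] at h1
    have h3 : F (coefv (t ∘ Tuple.sort t)) = f (t ∘ Tuple.sort t) := h1
    rw [h2, hsymm] at h3
    show f t = max (-C) (min (F (coefv t)) C)
    rw [h3]
    have := abs_le.1 (hC t)
    rw [min_eq_left this.2, max_eq_right this.1]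

/-- coefficients for the matrix -/
theorem coefMt_continuous {n : ℕ} (a : Fin n → ℝ) :
    Continuous fun p : Matrix (Fin n) (Fin n) ℂ × (Fin n → ℝ) => coefv (eigs (Mt a p)) := by
  refine continuous_pi fun i => ?_
  have : (fun p : Matrix (Fin n) (Fin n) ℂ × (Fin n → ℝ) => coefv (eigs (Mt a p)) i) =
      fun p => ((Mt a p).charpoly.coeff i).re := by
    funext p
    rw [charpoly_eigs' (Mt_herm a p), Polynomial.coeff_map]
    simp [coefv]
  rw [this]
  exact Complex.continuous_re.comp ((charpoly_coeff_continuous n i).comp (Mt_continuous a))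

theorem Vd_eq {n : ℕ} {δ R : ℝ} {ω : ℝ → ℝ} (hδ : 0 < δ) (h : CW (n - 1) δ R ω) (a : Fin n → ℝ)
    (ha : ∀ i, a i ≠ 0) (t : Fin n → ℝ) :
    Vd n ω a t = VdmF t * Matrix.det (Matrix.of fun b c : Fin n => ω (t b / a c) / |a c|) := by
  unfold Vd
  refine congrArg (fun z => VdmF t * z) (congrArg Matrix.det (Matrix.ext fun b c => ?_))
  exact ite_weight hδ h (t b) (a c) (ha c)

theorem Vd_continuous {n : ℕ} {δ R : ℝ} {ω : ℝ → ℝ} (hδ : 0 < δ) (h : CW (n - 1) δ R ω) (a : Fin n → ℝ)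
    (ha : ∀ i, a i ≠ 0) : Continuous (Vd n ω a) := by
  have : Vd n ω a = fun t => VdmF t * Matrix.det (Matrix.of fun b c : Fin n => ω (t b / a c) / |a c|) :=
    funext (Vd_eq hδ h a ha)
  rw [this]
  refine VdmF_continuous.mul (Continuous.matrix_det (continuous_matrix fun b c => ?_))
  exact (h.1.continuous.comp ((continuous_apply b).div_const _)).div_const _

theorem Vd_zero {n : ℕ} {δ R : ℝ} {ω : ℝ → ℝ} (hδ : 0 < δ) (h : CW (n - 1) δ R ω) (a : Fin n → ℝ)
    (ha : ∀ i, a i ≠ 0) : ∃ B : ℝ, ∀ t, t ∉ Metric.closedBall (0 : Fin n → ℝ) B → Vd n ω a t = 0 := by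
  refine ⟨|R| * ∑ c, |a c|, fun t ht => ?_⟩
  have hB : 0 ≤ |R| * ∑ c, |a c| := by positivity
  rw [mem_closedBall_zero_iff, pi_norm_le_iff_of_nonneg hB] at ht
  push Not at ht
  obtain ⟨b, hb⟩ := ht
  rw [Vd_eq hδ h a ha, Matrix.det_eq_zero_of_row_eq_zero b, mul_zero]
  intro c
  rw [Matrix.of_apply, h.2, zero_div]
  intro hmem
  have h1 : |t b / a c| ≤ |R| := by
    rw [abs_of_nonneg (hδ.le.trans hmem.1)]
    exact hmem.2.trans (le_abs_self R)
  rw [abs_div, div_le_iff₀ (abs_pos.2 (ha c))] at h1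
  have h2 : |a c| ≤ ∑ c, |a c| :=
    Finset.single_le_sum (f := fun c => |a c|) (fun _ _ => abs_nonneg _) (Finset.mem_univ c)
  have h3 := mul_le_mul_of_nonneg_left h2 (abs_nonneg R)
  rw [Real.norm_eq_abs] at hb
  linarith

theorem Vd_integrable_mul {n : ℕ} {δ R : ℝ} {ω : ℝ → ℝ} (hδ : 0 < δ) (h : CW (n - 1) δ R ω) (a : Fin n → ℝ)
    (ha : ∀ i, a i ≠ 0) (g : (Fin n → ℝ) → ℝ) (hg : Continuous g) :
    Integrable (fun t => g t * Vd n ω a t) := by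
  obtain ⟨B, hB⟩ := Vd_zero hδ h a ha
  refine (hg.mul (Vd_continuous hδ h a ha)).integrable_of_hasCompactSupport
    (HasCompactSupport.intro (isCompact_closedBall 0 B) fun t ht => ?_)
  simp [hB t ht]

theorem cw_main {n : ℕ} (hn : 1 ≤ n) {δ R : ℝ} {ω : ℝ → ℝ} (hδ : 0 < δ) (h : CW (n - 1) δ R ω)
    (a : Fin n → ℝ) (ha : ∀ i, a i ≠ 0) {μ : Measure (Matrix (Fin n) (Fin n) ℂ)}
    (hμ : IsHaarUnitary n μ) {F : (Fin n → ℝ) → ℝ} (hF : Measurable F) (hFb : ∃ C, ∀ v, |F v| ≤ C) :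
    VdmF a * ∫ p, F (coefv (eigs (Mt a p))) * Wd n ω p.2 ∂(μ.prod volume) =
      (∏ j ∈ Finset.range n, (Nat.factorial j : ℝ)) * ∫ t, F (coefv t) * Vd n ω a t := by
  haveI := hμ.1
  set c1 := VdmF a
  set c2 := ∏ j ∈ Finset.range n, (Nat.factorial j : ℝ)
  have hW1 := Wd_prod_integrable h hμ (fun _ => 1) continuous_const
  have hV1 := Vd_integrable_mul hδ h a ha (fun _ => 1) continuous_const
  simp only [one_mul] at hW1 hV1
  have hmom : ∀ (m : ℕ) (e : Fin m → Fin n),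
      ∫ p, (∏ j, coefv (eigs (Mt a p)) (e j)) * (c1 * Wd n ω p.2) ∂(μ.prod volume) =
      ∫ t, (∏ j, coefv t (e j)) * (c2 * Vd n ω a t) := by
    intro m e
    obtain ⟨D, hD⟩ := mono_span (fun j => (e j).castSucc)
    have hD' : ∀ t : Fin n → ℝ, ∏ j, coefv t (e j) = ∑ r, D r * Jf m (fun j => (r j : ℕ)) (Pa t) := by
      intro t
      exact hD (Pa t) (Pa_natDegree t).le
    simp only [hD', Finset.sum_mul]
    rw [integral_finset_sum, integral_finset_sum]
    · refine Finset.sum_congr rfl fun r _ => ?_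
      have := mom_id hn hδ h a ha hμ (fun j => (r j : ℕ))
      rw [← integral_const_mul, ← integral_const_mul] at this
      have h2 := congrArg (fun z => D r * z) this
      simp only [← integral_const_mul] at h2
      refine Eq.trans ?_ (h2.trans ?_)
      · refine integral_congr_ae (Eventually.of_forall fun p => ?_)
        simp only; ring
      · refine integral_congr_ae (Eventually.of_forall fun p => ?_)
        simp only; ring
    · intro r _
      refine (((Vd_integrable_mul hδ h a ha _ (Jf_Pa_continuous m (fun j => (r j : ℕ)))).const_mul (D r)).const_mul c2).congr
        (Eventually.of_forall fun p => ?_)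
      simp only; ring
    · intro r _
      refine (((Wd_prod_integrable h hμ _ (JMt_continuous (fun j => (r j : ℕ)) a)).const_mul (D r)).const_mul c1).congr
        (Eventually.of_forall fun p => ?_)
      simp only; ring
  obtain ⟨B, hB⟩ := Vd_zero hδ h a ha
  have hK1 : IsCompact ((fun p : Matrix (Fin n) (Fin n) ℂ × (Fin n → ℝ) => coefv (eigs (Mt a p))) ''
      ({A : Matrix (Fin n) (Fin n) ℂ | A ∈ Matrix.unitaryGroup (Fin n) ℂ} ×ˢ
      (Set.pi Set.univ fun _ : Fin n => Set.Icc δ R))) :=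
    ((unitary_isCompact n).prod (isCompact_univ_pi fun _ => isCompact_Icc)).image (coefMt_continuous a)
  have hK2 : IsCompact (coefv '' Metric.closedBall (0 : Fin n → ℝ) B) :=
    (isCompact_closedBall 0 B).image coefv_continuous
  have hae : ∀ᵐ p ∂(μ.prod (volume : Measure (Fin n → ℝ))), p.1 ∈ Matrix.unitaryGroup (Fin n) ℂ :=
      Measure.quasiMeasurePreserving_fst.ae (haar_ae hμ)
  have key := det_lemma (P := μ.prod (volume : Measure (Fin n → ℝ))) (Q := (volume : Measure (Fin n → ℝ)))
    (G := fun p => coefv (eigs (Mt a p))) (H := coefv)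
    (coefMt_continuous a).measurable coefv_continuous.measurable
    (p := fun p => c1 * Wd n ω p.2) (q := fun t => c2 * Vd n ω a t)
    (hW1.const_mul c1) (hV1.const_mul c2) (hK1.union hK2)
    (by
      filter_upwards [hae] with p hp h0
      refine Or.inl ⟨p, ⟨hp, ?_⟩, rfl⟩
      by_contra hx
      exact h0 (by simp only [Wd_zero h _ hx, mul_zero]))
    (Eventually.of_forall fun t h0 => by
      refine Or.inr ⟨t, ?_, rfl⟩
      by_contra hx
      exact h0 (by simp only [hB t hx, mul_zero]))
    hmom hF hFb
  rw [← integral_const_mul, ← integral_const_mul]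
  refine Eq.trans ?_ (key.trans ?_)
  · refine integral_congr_ae (Eventually.of_forall fun p => ?_)
    simp only; ring
  · refine integral_congr_ae (Eventually.of_forall fun p => ?_)
    simp only; ring

/-- fixed smooth bump -/
def bmp : ContDiffBump (0 : ℝ) := ⟨1, 2, one_pos, one_lt_two⟩

/-- truncated weight -/
def trw (ε : ℝ) (ω : ℝ → ℝ) : ℝ → ℝ := fun x => if 0 < x then ω x * bmp (ε * Real.log x) else 0

theorem bmp_bound (N : ℕ) : ∃ B : ℝ, 0 ≤ B ∧ ∀ k ≤ N, ∀ s, |iteratedDeriv k bmp s| ≤ B := by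
  have h : ∀ k : ℕ, ∃ B : ℝ, ∀ s, |iteratedDeriv k bmp s| ≤ B := by
    intro k
    have hc : Continuous (iteratedFDeriv ℝ k (bmp : ℝ → ℝ)) :=
      (bmp.contDiff (n := k)).continuous_iteratedFDeriv le_rfl
    obtain ⟨B, hB⟩ := (bmp.hasCompactSupport.iteratedFDeriv k).exists_bound_of_continuous hc
    refine ⟨B, fun s => ?_⟩
    have := hB s
    rwa [norm_iteratedFDeriv_eq_norm_iteratedDeriv, Real.norm_eq_abs] at this
  choose B hB using h
  refine ⟨∑ k ∈ Finset.range (N + 1), |B k|, Finset.sum_nonneg fun _ _ => abs_nonneg _, fun k hk s => ?_⟩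
  refine (hB k s).trans ((le_abs_self _).trans ?_)
  exact Finset.single_le_sum (f := fun k => |B k|) (fun _ _ => abs_nonneg _) (Finset.mem_range.2 (by omega))

theorem bmp_scaled (N : ℕ) : ∃ B : ℝ, 0 ≤ B ∧ ∀ ε, 0 < ε → ε ≤ 1 → ∀ k ≤ N, ∀ s,
    |iteratedDeriv k (fun s => bmp (ε * s)) s| ≤ B := by
  obtain ⟨B, hB0, hB⟩ := bmp_bound N
  refine ⟨B, hB0, fun ε h0 h1 k hk s => ?_⟩
  rw [iteratedDeriv_comp_const_mul bmp.contDiff ε, abs_mul, abs_pow, abs_of_pos h0]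
  calc ε ^ k * |iteratedDeriv k bmp (ε * s)| ≤ 1 * B :=
        mul_le_mul (pow_le_one₀ h0.le h1) (hB k hk _) (abs_nonneg _) zero_le_one
    _ = B := one_mul B

theorem deriv_comp_exp (h : ℝ → ℝ) (s : ℝ) :
    deriv (fun s => h (Real.exp s)) s = Real.exp s * deriv h (Real.exp s) := by
  by_cases hd : DifferentiableAt ℝ h (Real.exp s)
  · have := hd.hasDerivAt.comp s (Real.hasDerivAt_exp s)
    rw [mul_comm]
    exact this.deriv
  · rw [deriv_zero_of_not_differentiableAt hd, mul_zero, deriv_zero_of_not_differentiableAt]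
    intro hd'
    apply hd
    have h1 : DifferentiableAt ℝ (fun x => h (Real.exp (Real.log x))) (Real.exp s) := by
      have hlog : DifferentiableAt ℝ Real.log (Real.exp s) :=
        Real.differentiableAt_log (Real.exp_pos s).ne'
      have hd2 : DifferentiableAt ℝ (fun s => h (Real.exp s)) (Real.log (Real.exp s)) := by
        rw [Real.log_exp]; exact hd'
      exact hd2.comp _ hlog
    refine h1.congr_of_eventuallyEq ?_
    filter_upwards [lt_mem_nhds (Real.exp_pos s)] with x hx
    rw [Real.exp_log hx]

theorem xd_exp (g : ℝ → ℝ) (j : ℕ) : ∀ s, (xdOp^[j] g) (Real.exp s) =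
    iteratedDeriv j (fun s => g (Real.exp s)) s := by
  induction j with
  | zero => intro s; simp
  | succ j ih =>
    intro s
    rw [Function.iterate_succ_apply', iteratedDeriv_succ, xdOp, ← deriv_comp_exp]
    exact congrArg (fun q => deriv q s) (funext ih)

theorem negxd_iter (g : ℝ → ℝ) (j : ℕ) : negxdOp^[j] g = fun x => (-1) ^ j * (xdOp^[j] g) x := by
  induction j with
  | zero => funext x; simp
  | succ j ih =>
    rw [Function.iterate_succ_apply', ih, Function.iterate_succ_apply']
    funext x
    simp only [negxdOp, xdOp]
    rw [deriv_const_mul_field]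
    ring

theorem negxd_congr {g h : ℝ → ℝ} {x : ℝ} (hgh : g =ᶠ[nhds x] h) (j : ℕ) :
    negxdOp^[j] g =ᶠ[nhds x] negxdOp^[j] h := by
  induction j with
  | zero => exact hgh
  | succ j ih =>
    rw [Function.iterate_succ_apply', Function.iterate_succ_apply']
    filter_upwards [ih.deriv] with y hy
    simp only [negxdOp, hy]

theorem trw_eventually (ω : ℝ → ℝ) (x : ℝ) (hx : 0 < x) :
    ∀ᶠ N : ℕ in atTop, trw (1 / ((N : ℝ) + 1)) ω =ᶠ[nhds x] ω := by
  obtain ⟨M, hM⟩ := exists_nat_gt |Real.log x|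
  filter_upwards [eventually_ge_atTop M] with N hN
  have hc : ContinuousAt (fun y => |Real.log y|) x := (Real.continuousAt_log hx.ne').abs
  have hlt : |Real.log x| < (N : ℝ) + 1 := by
    have : (M : ℝ) ≤ N := by exact_mod_cast hN
    linarith
  filter_upwards [lt_mem_nhds hx, hc.eventually_lt continuousAt_const hlt] with y hy hy2
  have h1 : bmp (1 / ((N : ℝ) + 1) * Real.log y) = 1 := by
    refine bmp.one_of_mem_closedBall ?_
    rw [mem_closedBall_zero_iff, Real.norm_eq_abs, abs_mul, abs_of_pos (by positivity)]
    show _ ≤ (1 : ℝ)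
    rw [one_div, inv_mul_le_iff₀ (by positivity)]
    linarith
  rw [trw, if_pos hy, h1, mul_one]

theorem trw_CW {m : ℕ} {ω : ℝ → ℝ} (h : ContDiffOn ℝ (m : ℕ∞) ω (Set.Ioi 0)) {ε : ℝ} (hε : 0 < ε) :
    CW m (Real.exp (-(2 / ε))) (Real.exp (2 / ε)) (trw ε ω) := by
  have hz : ∀ x, x ∉ Set.Icc (Real.exp (-(2 / ε))) (Real.exp (2 / ε)) → trw ε ω x = 0 := by
    intro x hx
    rw [trw]
    split_ifs with h0
    · rw [bmp.zero_of_le_dist, mul_zero]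
      show (2 : ℝ) ≤ _
      rw [dist_zero_right, Real.norm_eq_abs, abs_mul, abs_of_pos hε]
      by_contra hlt
      push Not at hlt
      have : |Real.log x| < 2 / ε := by rw [lt_div_iff₀ hε]; linarith
      rw [abs_lt] at this
      apply hx
      constructor
      · rw [← Real.le_log_iff_exp_le h0]; exact this.1.le
      · rw [← Real.log_le_iff_le_exp h0]; exact this.2.le
    · rfl
  refine ⟨?_, hz⟩
  rw [contDiff_iff_contDiffAt]
  intro x
  rcases lt_or_ge x (Real.exp (-(2 / ε))) with hx | hx
  · refine (contDiffAt_const (c := (0 : ℝ))).congr_of_eventuallyEq ?_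
    filter_upwards [gt_mem_nhds hx] with y hy
    exact hz y fun hm => absurd hm.1 (not_le.2 hy)
  · have hx0 : 0 < x := (Real.exp_pos _).trans_le hx
    have h1 : ContDiffAt ℝ (m : ℕ∞) (fun y => ω y * bmp (ε * Real.log y)) x := by
      refine (h.contDiffAt (Ioi_mem_nhds hx0)).mul ?_
      exact bmp.contDiffAt.comp x (contDiffAt_const.mul (Real.contDiffAt_log.2 hx0.ne'))
    refine ContDiffAt.congr_of_eventuallyEq (by exact_mod_cast h1) ?_
    filter_upwards [lt_mem_nhds hx0] with y hy
    rw [trw, if_pos hy]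

theorem trw_bound {m : ℕ} {ω : ℝ → ℝ} (h : ContDiffOn ℝ (m : ℕ∞) ω (Set.Ioi 0)) :
    ∃ C : ℝ, 0 ≤ C ∧ ∀ ε, 0 < ε → ε ≤ 1 → ∀ j ≤ m, ∀ x, 0 < x →
      |(negxdOp^[j] (trw ε ω)) x| ≤ C * ∑ i ∈ Finset.range (m + 1), |(xdOp^[i] ω) x| := by
  obtain ⟨B, hB0, hB⟩ := bmp_scaled m
  refine ⟨2 ^ m * B, by positivity, fun ε h0 h1 j hj x hx => ?_⟩
  have hj1 : |(negxdOp^[j] (trw ε ω)) x| = |(xdOp^[j] (trw ε ω)) x| := by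
    rw [negxd_iter]; simp [abs_mul]
  obtain ⟨s, rfl⟩ : ∃ s, Real.exp s = x := ⟨Real.log x, Real.exp_log hx⟩
  rw [hj1, xd_exp]
  have e1 : (fun s => trw ε ω (Real.exp s)) = fun s => (fun s => ω (Real.exp s)) s * (fun s => bmp (ε * s)) s := by
    funext s
    rw [trw, if_pos (Real.exp_pos s), Real.log_exp]
  have hu : ContDiff ℝ (m : ℕ∞) (fun s => ω (Real.exp s)) :=
    h.comp_contDiff Real.contDiff_exp fun s => Real.exp_pos s
  have hb : ContDiff ℝ (m : ℕ∞) (fun s => bmp (ε * s)) :=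
    bmp.contDiff.comp (contDiff_const.mul contDiff_id)
  have h2 := norm_iteratedFDeriv_mul_le hu hb s (n := j) (by exact_mod_cast hj)
  rw [e1, ← Real.norm_eq_abs, ← norm_iteratedFDeriv_eq_norm_iteratedDeriv]
  refine h2.trans ?_
  rw [Finset.mul_sum]
  calc _ ≤ ∑ i ∈ Finset.range (j + 1), 2 ^ m * B * |(xdOp^[i] ω) (Real.exp s)| := by
        refine Finset.sum_le_sum fun i hi => ?_
        rw [norm_iteratedFDeriv_eq_norm_iteratedDeriv, norm_iteratedFDeriv_eq_norm_iteratedDeriv,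
          Real.norm_eq_abs, Real.norm_eq_abs, xd_exp]
        have hc : (j.choose i : ℝ) ≤ 2 ^ m := by
          have : j.choose i ≤ 2 ^ j := Nat.choose_le_two_pow j i
          have h3 : (2 : ℕ) ^ j ≤ 2 ^ m := Nat.pow_le_pow_right (by norm_num) hj
          exact_mod_cast this.trans h3
        have h4 := hB ε h0 h1 (j - i) (by omega) s
        calc _ ≤ 2 ^ m * |iteratedDeriv i (fun s => ω (Real.exp s)) s| * B := by gcongr
          _ = _ := by ring
    _ ≤ _ := by
        refine Finset.sum_le_sum_of_subset_of_nonneg ?_ fun i _ _ => by positivity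
        exact Finset.range_mono (by omega)

theorem det_abs_le {n : ℕ} (A : Fin n → Fin n → ℝ) (B : Fin n → ℝ) (h : ∀ i j, |A i j| ≤ B j) :
    |Matrix.det (Matrix.of A)| ≤ (n.factorial : ℝ) * ∏ j, B j := by
  rw [Matrix.det_apply]
  refine (Finset.abs_sum_le_sum_abs _ _).trans ?_
  have : ∀ σ ∈ (Finset.univ : Finset (Equiv.Perm (Fin n))),
      |Equiv.Perm.sign σ • ∏ i, Matrix.of A (σ i) i| ≤ ∏ j, B j := by
    intro σ _
    have e : |Equiv.Perm.sign σ • ∏ i, Matrix.of A (σ i) i| = ∏ i, |A (σ i) i| := by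
      rw [← Finset.abs_prod]
      rcases Int.units_eq_one_or (Equiv.Perm.sign σ) with h | h <;> rw [h] <;> simp
    rw [e]
    exact Finset.prod_le_prod (fun _ _ => abs_nonneg _) fun i _ => h _ _
  refine (Finset.sum_le_sum this).trans ?_
  rw [Finset.sum_const, Finset.card_univ, Fintype.card_perm, Fintype.card_fin, nsmul_eq_mul]

/-- sum of powers -/
def Sp (n : ℕ) (y : ℝ) : ℝ := ∑ k ∈ Finset.range n, |y| ^ k

theorem Sp_nonneg (n : ℕ) (y : ℝ) : 0 ≤ Sp n y := Finset.sum_nonneg fun _ _ => by positivity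

theorem VdmF_abs_le {n : ℕ} (x : Fin n → ℝ) : |VdmF x| ≤ (n.factorial : ℝ) * ∏ c, Sp n (x c) := by
  rw [VdmF_eq, vdet]
  refine det_abs_le _ _ fun i j => ?_
  rw [abs_pow]
  exact Finset.single_le_sum (f := fun k => |x j| ^ k) (fun _ _ => by positivity) (Finset.mem_range.2 i.2)

/-- positive orthant -/
def Orth (n : ℕ) : Set (Fin n → ℝ) := Set.pi Set.univ (fun _ : Fin n => Set.Ioi (0 : ℝ))

theorem Orth_meas (n : ℕ) : MeasurableSet (Orth n) :=
  MeasurableSet.univ_pi fun _ => measurableSet_Ioi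

theorem orth_prod_integrable {n : ℕ} {g : ℝ → ℝ} (hg : IntegrableOn g (Set.Ioi 0)) :
    Integrable (fun x : Fin n → ℝ => ∏ c, g (x c)) (volume.restrict (Orth n)) := by
  rw [Orth, volume_pi, Measure.restrict_pi_pi]
  exact Integrable.fintype_prod fun _ => hg

/-- the dominating one-variable function -/
def Em (n : ℕ) (ω : ℝ → ℝ) (C x : ℝ) : ℝ :=
  Sp n x * (C * ∑ i ∈ Finset.range n, |(xdOp^[i] ω) x|)

theorem Em_integrable {n : ℕ} {ω : ℝ → ℝ} (hω : IsPolyaWeight n ω) (C : ℝ) :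
    IntegrableOn (Em n ω C) (Set.Ioi 0) := by
  have h1 : IntegrableOn (fun x : ℝ => C * ∑ k ∈ Finset.range n, ∑ i ∈ Finset.range n,
      x ^ k * |(xdOp^[i] ω) x|) (Set.Ioi 0) := by
    refine Integrable.const_mul (integrable_finset_sum _ fun k hk => integrable_finset_sum _ fun i hi => ?_) C
    have := hω.2.2.2.1 i (Finset.mem_range.1 hi) (k + 1) (by omega) (by have := Finset.mem_range.1 hk; omega)
    simpa [IntegrableOn] using this
  refine h1.congr_fun (fun x hx => ?_) measurableSet_Ioi
  simp only [Em, Sp, abs_of_pos (show (0 : ℝ) < x from hx)]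
  rw [mul_left_comm, Finset.sum_mul_sum]

theorem trw_dom {n : ℕ} (hn : 1 ≤ n) {ω : ℝ → ℝ} (hω : IsPolyaWeight n ω) :
    ∃ C : ℝ, 0 ≤ C ∧ ∀ ε, 0 < ε → ε ≤ 1 → ∀ x ∈ Orth n,
      |Wd n (trw ε ω) x| ≤ (n.factorial : ℝ) ^ 2 * ∏ c, Em n ω C (x c) := by
  obtain ⟨C, hC0, hC⟩ := trw_bound hω.2.1
  refine ⟨C, hC0, fun ε h0 h1 x hx => ?_⟩
  have hd := det_abs_le (fun b c : Fin n => (negxdOp^[(b : ℕ)] (trw ε ω)) (x c))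
    (fun c => C * ∑ i ∈ Finset.range n, |(xdOp^[i] ω) (x c)|) (fun b c => by
      have := hC ε h0 h1 b (by omega) (x c) (hx c trivial)
      rwa [Nat.sub_add_cancel hn] at this)
  rw [Wd, abs_mul]
  have hn0 : 0 ≤ (n.factorial : ℝ) * ∏ c, Sp n (x c) :=
    mul_nonneg (by positivity) (Finset.prod_nonneg fun _ _ => Sp_nonneg _ _)
  refine (mul_le_mul (VdmF_abs_le x) hd (abs_nonneg _) hn0).trans (le_of_eq ?_)
  simp only [Em]
  rw [Finset.prod_mul_distrib (f := fun c => Sp n (x c))]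
  ring

theorem Wd_eventually {n : ℕ} (ω : ℝ → ℝ) (x : Fin n → ℝ) (hx : x ∈ Orth n) :
    ∀ᶠ N : ℕ in atTop, Wd n (trw (1 / ((N : ℝ) + 1)) ω) x = Wd n ω x := by
  have h := eventually_all.2 fun c : Fin n => trw_eventually ω (x c) (hx c trivial)
  filter_upwards [h] with N hN
  unfold Wd
  refine congrArg (fun z => VdmF x * z) (congrArg Matrix.det (Matrix.ext fun b c => ?_))
  exact (negxd_congr (hN c) b).eq_of_nhds

theorem eps_pos (N : ℕ) : 0 < 1 / ((N : ℝ) + 1) := by positivity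
theorem eps_le (N : ℕ) : 1 / ((N : ℝ) + 1) ≤ 1 := by
  rw [div_le_one (by positivity)]
  have : (0 : ℝ) ≤ N := by positivity
  linarith

theorem Wd_orth_integrable {n : ℕ} (hn : 1 ≤ n) {ω : ℝ → ℝ} (hω : IsPolyaWeight n ω) :
    Integrable (Wd n ω) (volume.restrict (Orth n)) := by
  obtain ⟨C, -, hC⟩ := trw_dom hn hω
  refine ((orth_prod_integrable (Em_integrable hω C)).const_mul ((n.factorial : ℝ) ^ 2)).mono' ?_ ?_
  · refine aestronglyMeasurable_of_tendsto_ae (f := fun N : ℕ => Wd n (trw (1 / ((N : ℝ) + 1)) ω)) atTop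
      (fun N => (Wd_continuous (trw_CW hω.2.1 (eps_pos N))).aestronglyMeasurable) ?_
    filter_upwards [ae_restrict_mem (Orth_meas n)] with x hx
    exact tendsto_nhds_of_eventually_eq (Wd_eventually ω x hx)
  · filter_upwards [ae_restrict_mem (Orth_meas n)] with x hx
    obtain ⟨N, hN⟩ := (Wd_eventually ω x hx).exists
    rw [← hN]
    exact hC _ (eps_pos N) (eps_le N) x hx

theorem lim_W {n : ℕ} (hn : 1 ≤ n) {ω : ℝ → ℝ} (hω : IsPolyaWeight n ω)
    (a : Fin n → ℝ) {μ : Measure (Matrix (Fin n) (Fin n) ℂ)}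
    (hμ : IsHaarUnitary n μ) {F : (Fin n → ℝ) → ℝ} (hF : Measurable F) (hFb : ∃ C, ∀ v, |F v| ≤ C) :
    Tendsto (fun N : ℕ => ∫ p, F (coefv (eigs (Mt a p))) * Wd n (trw (1 / ((N : ℝ) + 1)) ω) p.2
      ∂(μ.prod volume)) atTop
      (nhds (∫ p, F (coefv (eigs (Mt a p))) * Wd n ω p.2 ∂(μ.prod (volume.restrict (Orth n))))) := by
  haveI := hμ.1
  obtain ⟨B, hB⟩ := hFb
  obtain ⟨C, -, hC⟩ := trw_dom hn hω
  have hB0 : 0 ≤ B := (abs_nonneg _).trans (hB 0)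
  have e : μ.prod ((volume : Measure (Fin n → ℝ)).restrict (Orth n)) =
      (μ.prod volume).restrict (Set.univ ×ˢ Orth n) := by
    rw [← Measure.prod_restrict, Measure.restrict_univ]
  have h1 : ∀ N : ℕ, ∫ p, F (coefv (eigs (Mt a p))) * Wd n (trw (1 / ((N : ℝ) + 1)) ω) p.2
      ∂(μ.prod volume) = ∫ p, F (coefv (eigs (Mt a p))) * Wd n (trw (1 / ((N : ℝ) + 1)) ω) p.2
      ∂(μ.prod (volume.restrict (Orth n))) := by
    intro N
    rw [e, setIntegral_eq_integral_of_forall_compl_eq_zero]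
    intro p hp
    rw [Wd_zero (trw_CW hω.2.1 (eps_pos N)), mul_zero]
    intro hm
    apply hp
    refine ⟨trivial, fun i _ => ?_⟩
    exact (Real.exp_pos _).trans_le (hm i trivial).1
  simp only [h1]
  have hae : ∀ᵐ p ∂(μ.prod ((volume : Measure (Fin n → ℝ)).restrict (Orth n))), p.2 ∈ Orth n :=
    Measure.quasiMeasurePreserving_snd.ae (ae_restrict_mem (Orth_meas n))
  refine tendsto_integral_of_dominated_convergence
    (fun p => B * ((n.factorial : ℝ) ^ 2 * ∏ c, Em n ω C (p.2 c))) ?_ ?_ ?_ ?_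
  · intro N
    exact ((hF.comp (coefMt_continuous a).measurable).mul
      ((Wd_continuous (trw_CW hω.2.1 (eps_pos N))).comp continuous_snd).measurable).aestronglyMeasurable
  · exact (((orth_prod_integrable (Em_integrable hω C)).const_mul ((n.factorial : ℝ) ^ 2)).const_mul B).comp_snd μ
  · intro N
    filter_upwards [hae] with p hp
    rw [norm_mul]
    exact mul_le_mul (hB _) (hC _ (eps_pos N) (eps_le N) p.2 hp) (norm_nonneg _) hB0
  · filter_upwards [hae] with p hp
    refine tendsto_nhds_of_eventually_eq ?_
    filter_upwards [Wd_eventually ω p.2 hp] with N hN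
    rw [hN]

theorem lim_W_iter {n : ℕ} (hn : 1 ≤ n) {ω : ℝ → ℝ} (hω : IsPolyaWeight n ω)
    (a : Fin n → ℝ) {μ : Measure (Matrix (Fin n) (Fin n) ℂ)}
    (hμ : IsHaarUnitary n μ) {F : (Fin n → ℝ) → ℝ} (hF : Measurable F) (hFb : ∃ C, ∀ v, |F v| ≤ C) :
    ∫ p, F (coefv (eigs (Mt a p))) * Wd n ω p.2 ∂(μ.prod (volume.restrict (Orth n))) =
      ∫ k, (∫ x in Orth n, F (coefv (eigs (Mt a (k, x)))) * Wd n ω x) ∂μ := by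
  haveI := hμ.1
  obtain ⟨B, hB⟩ := hFb
  rw [integral_prod]
  have h := (Wd_orth_integrable hn hω).comp_snd μ
  exact h.bdd_mul (hF.comp (coefMt_continuous a).measurable).aestronglyMeasurable
    (Eventually.of_forall fun p => hB _)

/-- dominating one-variable function for the target -/
def Et (n : ℕ) (ω : ℝ → ℝ) (a : Fin n → ℝ) (t : ℝ) : ℝ :=
  Sp n t * ∑ c, if 0 < t * a c then |ω (t / a c)| / |a c| else 0

theorem Et_integrable {n : ℕ} (hn : 1 ≤ n) {ω : ℝ → ℝ} (hω : IsPolyaWeight n ω) (a : Fin n → ℝ)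
    (ha : ∀ i, a i ≠ 0) : Integrable (Et n ω a) := by
  have h1 : ∀ c, ∀ k ∈ Finset.range n, Integrable fun t : ℝ =>
      |t| ^ k * (if 0 < t * a c then |ω (t / a c)| / |a c| else 0) := by
    intro c k hk
    have h2 := hω.2.2.2.1 0 (by omega) (k + 1) (by omega) (by have := Finset.mem_range.1 hk; omega)
    rw [← integrable_indicator_iff measurableSet_Ioi] at h2
    refine ((h2.comp_div (ha c)).const_mul (|a c| ^ k / |a c|)).congr (Eventually.of_forall fun t => ?_)
    have hiff : t / a c ∈ Set.Ioi (0 : ℝ) ↔ 0 < t * a c := by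
      rw [Set.mem_Ioi, div_pos_iff, mul_pos_iff]
    have ha' : |a c| ≠ 0 := abs_ne_zero.2 (ha c)
    by_cases h3 : 0 < t * a c
    · simp only [if_pos h3, Set.indicator_of_mem (hiff.2 h3), Nat.add_sub_cancel, Function.iterate_zero, id]
      have h4 : t / a c = |t| / |a c| := by
        rw [← abs_div, abs_of_pos (show 0 < t / a c from hiff.2 h3)]
      rw [h4, div_pow]
      field_simp
    · simp only [if_neg h3, Set.indicator_of_notMem (fun h => h3 (hiff.1 h)), mul_zero]
  have h5 := integrable_finset_sum Finset.univ fun c _ => integrable_finset_sum (Finset.range n) (h1 c)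
  refine h5.congr (Eventually.of_forall fun t => ?_)
  simp only [Et, Sp]
  rw [Finset.sum_mul_sum, Finset.sum_comm]

theorem trw_abs_le (ω : ℝ → ℝ) (ε x : ℝ) : |trw ε ω x| ≤ |ω x| := by
  rw [trw]
  split_ifs
  · rw [abs_mul, abs_of_nonneg bmp.nonneg]
    exact mul_le_of_le_one_right (abs_nonneg _) bmp.le_one
  · simp

theorem Vd_dom {n : ℕ} (ω : ℝ → ℝ) (a : Fin n → ℝ) (ε : ℝ) (t : Fin n → ℝ) :
    |Vd n (trw ε ω) a t| ≤ (n.factorial : ℝ) ^ 2 * ∏ c, Et n ω a (t c) := by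
  have hd := det_abs_le (fun c b : Fin n => if 0 < t b * a c then trw ε ω (t b / a c) / |a c| else 0)
    (fun b => ∑ c, if 0 < t b * a c then |ω (t b / a c)| / |a c| else 0) (fun c b => by
      have h1 : |if 0 < t b * a c then trw ε ω (t b / a c) / |a c| else 0| ≤
          if 0 < t b * a c then |ω (t b / a c)| / |a c| else 0 := by
        split_ifs
        · rw [abs_div, abs_abs]
          exact div_le_div_of_nonneg_right (trw_abs_le _ _ _) (abs_nonneg _)
        · simp
      refine h1.trans ?_
      exact Finset.single_le_sum (f := fun c => if 0 < t b * a c then |ω (t b / a c)| / |a c| else 0)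
        (fun c _ => by split_ifs <;> positivity) (Finset.mem_univ c))
  have ht : Matrix.det (Matrix.of fun b c : Fin n => if 0 < t b * a c then trw ε ω (t b / a c) / |a c| else 0) =
      Matrix.det (Matrix.of fun c b : Fin n => if 0 < t b * a c then trw ε ω (t b / a c) / |a c| else 0) := by
    rw [← Matrix.det_transpose]; rfl
  rw [Vd, abs_mul, ht]
  have hn0 : 0 ≤ (n.factorial : ℝ) * ∏ c, Sp n (t c) :=
    mul_nonneg (by positivity) (Finset.prod_nonneg fun _ _ => Sp_nonneg _ _)
  refine (mul_le_mul (VdmF_abs_le t) hd (abs_nonneg _) hn0).trans (le_of_eq ?_)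
  simp only [Et]
  rw [Finset.prod_mul_distrib (f := fun c => Sp n (t c))]
  ring

theorem Vd_eventually {n : ℕ} (ω : ℝ → ℝ) (a : Fin n → ℝ) (t : Fin n → ℝ) :
    ∀ᶠ N : ℕ in atTop, Vd n (trw (1 / ((N : ℝ) + 1)) ω) a t = Vd n ω a t := by
  have h : ∀ᶠ N : ℕ in atTop, ∀ b c : Fin n, 0 < t b * a c →
      trw (1 / ((N : ℝ) + 1)) ω (t b / a c) = ω (t b / a c) := by
    refine eventually_all.2 fun b => eventually_all.2 fun c => ?_
    by_cases h0 : 0 < t b * a c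
    · have hpos : 0 < t b / a c := by rw [div_pos_iff]; rwa [mul_pos_iff] at h0
      filter_upwards [trw_eventually ω _ hpos] with N hN _
      exact hN.eq_of_nhds
    · exact Eventually.of_forall fun N h => absurd h h0
  filter_upwards [h] with N hN
  unfold Vd
  refine congrArg (fun z => VdmF t * z) (congrArg Matrix.det (Matrix.ext fun b c => ?_))
  simp only [Matrix.of_apply]
  split_ifs with h0
  · rw [hN b c h0]
  · rfl

theorem lim_V {n : ℕ} (hn : 1 ≤ n) {ω : ℝ → ℝ} (hω : IsPolyaWeight n ω)
    (a : Fin n → ℝ) (ha : ∀ i, a i ≠ 0)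
    {F : (Fin n → ℝ) → ℝ} (hF : Measurable F) (hFb : ∃ C, ∀ v, |F v| ≤ C) :
    Tendsto (fun N : ℕ => ∫ t, F (coefv t) * Vd n (trw (1 / ((N : ℝ) + 1)) ω) a t) atTop
      (nhds (∫ t, F (coefv t) * Vd n ω a t)) := by
  obtain ⟨B, hB⟩ := hFb
  have hB0 : 0 ≤ B := (abs_nonneg _).trans (hB 0)
  refine tendsto_integral_of_dominated_convergence
    (fun t => B * ((n.factorial : ℝ) ^ 2 * ∏ c, Et n ω a (t c))) ?_ ?_ ?_ ?_
  · intro N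
    exact ((hF.comp coefv_continuous.measurable).mul
      (Vd_continuous (Real.exp_pos _) (trw_CW hω.2.1 (eps_pos N)) a ha).measurable).aestronglyMeasurable
  · refine Integrable.const_mul (Integrable.const_mul ?_ _) B
    rw [volume_pi]
    exact Integrable.fintype_prod fun _ => Et_integrable hn hω a ha
  · intro N
    refine Eventually.of_forall fun t => ?_
    rw [norm_mul]
    exact mul_le_mul (hB _) (Vd_dom ω a _ t) (norm_nonneg _) hB0
  · refine Eventually.of_forall fun t => tendsto_nhds_of_eventually_eq ?_
    filter_upwards [Vd_eventually ω a t] with N hN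
    rw [hN]

theorem polya_main {n : ℕ} (hn : 1 ≤ n) {ω : ℝ → ℝ} (hω : IsPolyaWeight n ω)
    (a : Fin n → ℝ) (ha : ∀ i, a i ≠ 0) {μ : Measure (Matrix (Fin n) (Fin n) ℂ)}
    (hμ : IsHaarUnitary n μ) {F : (Fin n → ℝ) → ℝ} (hF : Measurable F) (hFb : ∃ C, ∀ v, |F v| ≤ C) :
    VdmF a * ∫ k, (∫ x in Orth n, F (coefv (eigs (Mt a (k, x)))) * Wd n ω x) ∂μ =
      (∏ j ∈ Finset.range n, (Nat.factorial j : ℝ)) * ∫ t, F (coefv t) * Vd n ω a t := by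
  rw [← lim_W_iter hn hω a hμ hF hFb]
  refine tendsto_nhds_unique ((lim_W hn hω a hμ hF hFb).const_mul (VdmF a)) ?_
  refine ((lim_V hn hω a ha hF hFb).const_mul (∏ j ∈ Finset.range n, (Nat.factorial j : ℝ))).congr fun N => ?_
  exact (cw_main hn (Real.exp_pos _) (trw_CW hω.2.1 (eps_pos N)) a ha hμ hF hFb).symm

/-- The eigenvalue distribution of `√a'·k diag(a) k*·√a'`, where `a'` is
drawn from the Pólya ensemble density `p_ω` and `k` is Haar unitary, has density `p(·|a)`. -/
theorem statement11 (n : ℕ) (hn : 1 ≤ n) (ω : ℝ → ℝ) (hω : IsPolyaWeight n ω)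
    (a : Fin n → ℝ) (ha0 : ∀ i, a i ≠ 0) (hadist : Function.Injective a)
    (μ : Measure (Matrix (Fin n) (Fin n) ℂ)) (hμ : IsHaarUnitary n μ)
    (f : (Fin n → ℝ) → ℝ) (hfmeas : Measurable f) (hfbdd : ∃ C, ∀ v, |f v| ≤ C)
    (hfsymm : ∀ (σ : Equiv.Perm (Fin n)) (v : Fin n → ℝ), f (v ∘ σ) = f v) :
    (∫ k, (∫ a' in Set.pi Set.univ (fun _ : Fin n => Set.Ioi (0 : ℝ)),
        f (eigs (sqrtDiag a' * (k * realDiag a * kᴴ) * sqrtDiag a')) * polyaDensity n ω a')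
      ∂μ) =
    ∫ t : Fin n → ℝ, f t * fixedDensity n ω a t := by
  obtain ⟨F, hF, hFb, hfF⟩ := symm_factor f hfmeas hfbdd hfsymm
  have main := polya_main hn hω a ha0 hμ hF hFb
  have hv : VdmF a ≠ 0 := by rw [VdmF_eq]; exact vdet_ne_zero hadist
  set M := ∏ j ∈ Finset.range n, MellinNat ω (j + 1) with hM
  have hM0 : M ≠ 0 := Finset.prod_ne_zero_iff.2 fun j hj =>
    (hω.2.2.2.2.1 (j + 1) (by omega) (by have := Finset.mem_range.1 hj; omega)).ne'
  set P := ∏ j ∈ Finset.range n, (Nat.factorial j : ℝ) with hP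
  have hP0 : P ≠ 0 := Finset.prod_ne_zero_iff.2 fun j _ => by positivity
  have hn0 : (n.factorial : ℝ) ≠ 0 := by positivity
  have hfac : ∏ j ∈ Finset.range n, ((Nat.factorial (j + 1) : ℝ) * MellinNat ω (j + 1)) =
      (n.factorial : ℝ) * P * M := by
    rw [Finset.prod_mul_distrib]
    refine congrArg (fun z => z * M) ?_
    have h1 := Finset.prod_range_succ (fun j => (Nat.factorial j : ℝ)) n
    have h2 := Finset.prod_range_succ' (fun j => (Nat.factorial j : ℝ)) n
    rw [h1] at h2
    simp only [Nat.factorial_zero, Nat.cast_one, mul_one] at h2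
    rw [← h2, mul_comm]
  have hL : (∫ k, (∫ a' in Set.pi Set.univ (fun _ : Fin n => Set.Ioi (0 : ℝ)),
        f (eigs (sqrtDiag a' * (k * realDiag a * kᴴ) * sqrtDiag a')) * polyaDensity n ω a') ∂μ) =
      ((n.factorial : ℝ) * P * M)⁻¹ *
        ∫ k, (∫ x in Orth n, F (coefv (eigs (Mt a (k, x)))) * Wd n ω x) ∂μ := by
    rw [← integral_const_mul]
    refine integral_congr_ae (Eventually.of_forall fun k => ?_)
    simp only
    rw [← integral_const_mul]
    refine integral_congr_ae (Eventually.of_forall fun x => ?_)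
    simp only [hfF, polyaDensity, hfac]
    simp only [Wd, Mt]
    ring
  have hR : ∫ t : Fin n → ℝ, f t * fixedDensity n ω a t =
      ((n.factorial : ℝ) * M * VdmF a)⁻¹ * ∫ t, F (coefv t) * Vd n ω a t := by
    rw [← integral_const_mul]
    refine integral_congr_ae (Eventually.of_forall fun t => ?_)
    simp only [hfF, fixedDensity, Vd, ← hM]
    rw [mul_inv, mul_inv]
    ring
  rw [hL, hR]
  set I1 := ∫ k, (∫ x in Orth n, F (coefv (eigs (Mt a (k, x)))) * Wd n ω x) ∂μ
  set I2 := ∫ t, F (coefv t) * Vd n ω a t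
  have e : I1 = P * I2 / VdmF a := by rw [← main, mul_div_cancel_left₀ _ hv]
  rw [e]
  field_simp

end RMT
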